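/- Suppose m, n are natural numbers and x_1, …, x_m, y_1, …, y_n are positive real numbers such that P_Λ(t) · ∏_{j=1}^n (1 − y_j t) = ∏_{i=1}^m (1 + x_i t) as formal power series over ℝ. Then ∏_{i=1}^m x_i = 1 and ∏_{j=1}^n y_j = 1. -/

import Mathlib

open TensorProduct Polynomial

noncomputable section

/-- The linear map `V ⊗ V → T(V)` sending `v ⊗ w` to `ι v * ι w`. -/
def mulTwo (K : Type) [Field K] (V : Type) [AddCommGroup V] [Module K V] :
    V ⊗[K] V →ₗ[K] TensorAlgebra K V :=
  TensorProduct.lift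
    ((LinearMap.mul K (TensorAlgebra K V)).compl₁₂ (TensorAlgebra.ι K) (TensorAlgebra.ι K))

/-- `R : V ⊗ V → V ⊗ V` is a Hecke symmetry with parameter `q`:
it is invertible, satisfies the braid relation, the Hecke relation
`(R + 1)(R - q) = 0`, and its half adjoint `R♯ : V* ⊗ V → V ⊗ V*`,
characterized by `⟨R♯(ξ ⊗ v), w⟩ = ⟨ξ, R(v ⊗ w)⟩`, is invertible. -/
def IsHeckeSymmetry (K : Type) [Field K] (V : Type) [AddCommGroup V] [Module K V]
    (q : K) (R : V ⊗[K] V →ₗ[K] V ⊗[K] V) : Prop :=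
  Function.Bijective R ∧
  (TensorProduct.map R LinearMap.id ∘ₗ
      ((TensorProduct.assoc K V V V).symm.toLinearMap ∘ₗ
        TensorProduct.map LinearMap.id R ∘ₗ (TensorProduct.assoc K V V V).toLinearMap) ∘ₗ
      TensorProduct.map R LinearMap.id =
    ((TensorProduct.assoc K V V V).symm.toLinearMap ∘ₗ
        TensorProduct.map LinearMap.id R ∘ₗ (TensorProduct.assoc K V V V).toLinearMap) ∘ₗ
      TensorProduct.map R LinearMap.id ∘ₗ
      ((TensorProduct.assoc K V V V).symm.toLinearMap ∘ₗ
        TensorProduct.map LinearMap.id R ∘ₗ (TensorProduct.assoc K V V V).toLinearMap)) ∧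
  ((R + LinearMap.id) ∘ₗ (R - q • LinearMap.id) = 0) ∧
  (∃ Rs : Module.Dual K V ⊗[K] V →ₗ[K] V ⊗[K] Module.Dual K V,
    Function.Bijective Rs ∧
    ∀ (ξ : Module.Dual K V) (v w : V),
      dualTensorHom K V V ((TensorProduct.comm K V (Module.Dual K V)) (Rs (ξ ⊗ₜ[K] v))) w =
        TensorProduct.lid K V (TensorProduct.map ξ LinearMap.id (R (v ⊗ₜ[K] w))))

/-- The relation on `T(V)` whose closure cuts out the exterior algebra `Λ` of `R`:
all elements of the image of `R + 1` in degree two are set to zero. -/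
def lambdaRel (K : Type) [Field K] (V : Type) [AddCommGroup V] [Module K V]
    (R : V ⊗[K] V →ₗ[K] V ⊗[K] V) :
    TensorAlgebra K V → TensorAlgebra K V → Prop :=
  fun a b => b = 0 ∧ ∃ u : V ⊗[K] V, a = mulTwo K V ((R + (LinearMap.id : V ⊗[K] V →ₗ[K] V ⊗[K] V)) u)

/-- The `l`-th homogeneous component of the exterior algebra `Λ = T(V)/(im(R+1))`,
as the image of the `l`-th graded piece of the tensor algebra. -/
def lambdaGrade (K : Type) [Field K] (V : Type) [AddCommGroup V] [Module K V]
    (R : V ⊗[K] V →ₗ[K] V ⊗[K] V) (l : ℕ) :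
    Submodule K (RingQuot (lambdaRel K V R)) :=
  Submodule.map (RingQuot.mkAlgHom K (lambdaRel K V R)).toLinearMap
    (LinearMap.range (TensorAlgebra.ι K : V →ₗ[K] TensorAlgebra K V) ^ l)

/-- The Poincaré series `P_Λ(t) = ∑ (dim Λ_l) t^l` of the exterior algebra,
as a formal power series over `ℝ`. -/
def poincareLambda (K : Type) [Field K] (V : Type) [AddCommGroup V] [Module K V]
    (R : V ⊗[K] V →ₗ[K] V ⊗[K] V) : PowerSeries ℝ :=
  PowerSeries.mk fun l => (Module.finrank K (lambdaGrade K V R l) : ℝ)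

namespace HS
variable {k : Type} [Field k]

inductive HRel (p : k) : FreeAlgebra k ℕ → FreeAlgebra k ℕ → Prop
  | quad (i : ℕ) : HRel p (FreeAlgebra.ι k i * FreeAlgebra.ι k i)
      ((p - 1) • FreeAlgebra.ι k i + p • 1)
  | braid (i : ℕ) : HRel p
      (FreeAlgebra.ι k i * FreeAlgebra.ι k (i+1) * FreeAlgebra.ι k i)
      (FreeAlgebra.ι k (i+1) * FreeAlgebra.ι k i * FreeAlgebra.ι k (i+1))
  | comm (i j : ℕ) (h : i + 2 ≤ j) : HRel p
      (FreeAlgebra.ι k i * FreeAlgebra.ι k j) (FreeAlgebra.ι k j * FreeAlgebra.ι k i)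

def Hec (p : k) : Type := RingQuot (HRel p)

instance (p : k) : Ring (Hec p) := inferInstanceAs (Ring (RingQuot (HRel p)))
instance (p : k) : Algebra k (Hec p) := inferInstanceAs (Algebra k (RingQuot (HRel p)))

def mkH (p : k) : FreeAlgebra k ℕ →ₐ[k] Hec p := RingQuot.mkAlgHom k (HRel p)

lemma mkH_rel {p : k} {a b : FreeAlgebra k ℕ} (h : HRel p a b) : mkH p a = mkH p b :=
  RingQuot.mkAlgHom_rel k h

lemma mkH_surj (p : k) : Function.Surjective (mkH p) := RingQuot.mkAlgHom_surjective k (HRel p)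

def S (p : k) (i : ℕ) : Hec p := mkH p (FreeAlgebra.ι k i)

variable {p : k}

lemma S_quad (i : ℕ) : S p i * S p i = (p - 1) • S p i + p • 1 := by
  have := mkH_rel (HRel.quad (p := p) i)
  simpa [S] using this

lemma S_braid (i : ℕ) : S p i * S p (i+1) * S p i = S p (i+1) * S p i * S p (i+1) := by
  have := mkH_rel (HRel.braid (p := p) i)
  simpa [S] using this

lemma S_comm {i j : ℕ} (h : i + 2 ≤ j) : Commute (S p i) (S p j) := by
  have := mkH_rel (HRel.comm (p := p) i j h)
  simpa [S, Commute, SemiconjBy] using this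

/-- Lifting. -/
def lft {A : Type} [Ring A] [Algebra k A] (σ : ℕ → A)
    (h1 : ∀ i, σ i * σ i = (p - 1) • σ i + p • 1)
    (h2 : ∀ i, σ i * σ (i+1) * σ i = σ (i+1) * σ i * σ (i+1))
    (h3 : ∀ i j, i + 2 ≤ j → σ i * σ j = σ j * σ i) : Hec p →ₐ[k] A :=
  RingQuot.liftAlgHom k ⟨FreeAlgebra.lift k σ, by
    intro x y h
    cases h with
    | quad i => simp [h1]
    | braid i => simp [h2]
    | comm i j h => simp [h3 i j h]⟩

lemma lft_S {A : Type} [Ring A] [Algebra k A] (σ : ℕ → A) (h1 h2 h3) (i : ℕ) :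
    lft (p := p) σ h1 h2 h3 (S p i) = σ i := by
  exact (RingQuot.liftAlgHom_mkAlgHom_apply k _ _ _).trans (FreeAlgebra.lift_ι_apply _ _)

lemma adjoin_S : Algebra.adjoin k (Set.range (S p)) = ⊤ := by
  rw [eq_top_iff]
  rintro x -
  obtain ⟨y, rfl⟩ := mkH_surj p x
  induction y using FreeAlgebra.induction with
  | grade0 r => rw [AlgHom.commutes]; exact Subalgebra.algebraMap_mem _ _
  | grade1 x => exact Algebra.subset_adjoin ⟨x, rfl⟩
  | mul a b ha hb => rw [map_mul]; exact mul_mem ha hb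
  | add a b ha hb => rw [map_add]; exact add_mem ha hb

lemma hec_ext {A : Type} [Ring A] [Algebra k A] {f g : Hec p →ₐ[k] A}
    (h : ∀ i, f (S p i) = g (S p i)) : f = g := by
  apply AlgHom.ext_of_adjoin_eq_top adjoin_S
  rintro _ ⟨i, rfl⟩
  exact h i

def sh (a : ℕ) : Hec p →ₐ[k] Hec p :=
  lft (fun i => S p (i + a)) (fun i => S_quad _) 
    (fun i => by have := S_braid (p := p) (i + a); rwa [show i + a + 1 = i + 1 + a by ring] at this)
    (fun i j h => S_comm (by omega))

@[simp] lemma sh_S (a i : ℕ) : sh a (S p i) = S p (i + a) := lft_S _ _ _ _ _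

lemma sh_sh (a b : ℕ) (h : Hec p) : sh a (sh b h) = sh (b + a) h := by
  have : (sh a).comp (sh b) = sh (p := p) (b + a) := hec_ext (by intro i; simp [add_assoc])
  exact DFunLike.congr_fun this h

lemma sh_zero (h : Hec p) : sh 0 h = h := by
  have : (sh 0) = AlgHom.id k (Hec p) := hec_ext (by intro i; simp)
  exact DFunLike.congr_fun this h

def Hn (p : k) (N : ℕ) : Subalgebra k (Hec p) := Algebra.adjoin k {x | ∃ i, i + 1 < N ∧ x = S p i}

lemma S_mem {i N : ℕ} (h : i + 1 < N) : S p i ∈ Hn p N := Algebra.subset_adjoin ⟨i, h, rfl⟩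

lemma Hn_le {N : ℕ} {B : Subalgebra k (Hec p)} (h : ∀ i, i + 1 < N → S p i ∈ B) : Hn p N ≤ B := by
  apply Algebra.adjoin_le
  rintro _ ⟨i, hi, rfl⟩
  exact h i hi

lemma Hn_mono {N M : ℕ} (h : N ≤ M) : Hn p N ≤ Hn p M := Hn_le fun _ hi => S_mem (by omega)

lemma sh_mem {a N M : ℕ} {h : Hec p} (hh : h ∈ Hn p N) (hM : N + a ≤ M) : sh a h ∈ Hn p M := by
  have : Hn p N ≤ (Hn p M).comap (sh a) := Hn_le fun i hi => by
    rw [Subalgebra.mem_comap, sh_S]; exact S_mem (by omega)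
  exact this hh

lemma comm_sh {a b : ℕ} (hab : a ≤ b) {h : Hec p} (hh : h ∈ Hn p a) (h' : Hec p) :
    Commute h (sh b h') := by
  have h1 : ∀ i, i + 1 < a → ∀ h' : Hec p, Commute (S p i) (sh b h') := by
    intro i hi h'
    have : (⊤ : Subalgebra k (Hec p)) ≤ (Subalgebra.centralizer k {S p i}).comap (sh b) := by
      rw [← adjoin_S]
      apply Algebra.adjoin_le
      rintro _ ⟨j, rfl⟩
      simp only [SetLike.mem_coe, Subalgebra.mem_comap, sh_S, Subalgebra.mem_centralizer_iff, Set.mem_singleton_iff, forall_eq]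
      exact S_comm (by omega)
    have := this (Algebra.mem_top (x := h'))
    simp only [Subalgebra.mem_comap, Subalgebra.mem_centralizer_iff, Set.mem_singleton_iff, forall_eq] at this
    exact this
  have : Hn p a ≤ Subalgebra.centralizer k {sh b h'} := Hn_le fun i hi => by
    simp only [Subalgebra.mem_centralizer_iff, Set.mem_singleton_iff, forall_eq]
    exact (h1 i hi h').symm
  have := this hh
  simp only [Subalgebra.mem_centralizer_iff, Set.mem_singleton_iff, forall_eq] at this
  exact this.symm

/-- inverse generators -/
def T (p : k) (i : ℕ) : Hec p := p⁻¹ • (S p i - (p - 1) • 1)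

lemma sh_T (a i : ℕ) : sh a (T p i) = T p (i + a) := by simp [T]

lemma T_mem {i N : ℕ} (h : i + 1 < N) : T p i ∈ Hn p N :=
  Subalgebra.smul_mem _ (sub_mem (S_mem h) (Subalgebra.smul_mem _ (one_mem _) _)) _

lemma S_T (hp : p ≠ 0) (i : ℕ) : S p i * T p i = 1 := by
  rw [T, mul_smul_comm, mul_sub, S_quad, mul_smul_comm, mul_one, add_sub_cancel_left, smul_smul,
    inv_mul_cancel₀ hp, one_smul]

lemma T_S (hp : p ≠ 0) (i : ℕ) : T p i * S p i = 1 := by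
  rw [T, smul_mul_assoc, sub_mul, S_quad, smul_mul_assoc, one_mul, add_sub_cancel_left, smul_smul,
    inv_mul_cancel₀ hp, one_smul]

/-- `asc G n r = G n * G (n+1) * ... * G (n+r-1)`. -/
def asc (G : ℕ → Hec p) (n : ℕ) : ℕ → Hec p
  | 0 => 1
  | r + 1 => asc G n r * G (n + r)

lemma asc_succ' (G : ℕ → Hec p) (n r : ℕ) : asc G n (r+1) = G n * asc G (n+1) r := by
  induction r with
  | zero => simp [asc]
  | succ r ih => rw [asc, ih, asc, mul_assoc]; congr 3; ring

lemma sh_ascS (a n r : ℕ) : sh a (asc (S p) n r) = asc (S p) (n + a) r := by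
  induction r with
  | zero => simp [asc]
  | succ r ih => simp [asc, ih]; congr 1; ring_nf

lemma sh_ascT (a n r : ℕ) : sh a (asc (T p) n r) = asc (T p) (n + a) r := by
  induction r with
  | zero => simp [asc]
  | succ r ih => simp [asc, ih, sh_T]; congr 1; ring_nf

lemma ascS_mem {n r N : ℕ} (h : n + r < N) : asc (S p) n r ∈ Hn p N := by
  induction r with
  | zero => exact one_mem _
  | succ r ih => exact mul_mem (ih (by omega)) (S_mem (by omega))

lemma ascT_mem {n r N : ℕ} (h : n + r < N) : asc (T p) n r ∈ Hn p N := by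
  induction r with
  | zero => exact one_mem _
  | succ r ih => exact mul_mem (ih (by omega)) (T_mem (by omega))

/-- `dsc k j = S (k+j-1) * ... * S k`. -/
def dsc (p : k) (n : ℕ) : ℕ → Hec p
  | 0 => 1
  | r + 1 => S p (n + r) * dsc p n r

lemma dsc_succ' (n r : ℕ) : dsc p n (r+1) = dsc p (n+1) r * S p n := by
  induction r with
  | zero => simp [dsc]
  | succ r ih => rw [dsc, ih, dsc, mul_assoc]; congr 2; ring

lemma dsc_mem {n r N : ℕ} (h : n + r < N) : dsc p n r ∈ Hn p N := by
  induction r with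
  | zero => exact one_mem _
  | succ r ih => exact mul_mem (S_mem (by omega)) (ih (by omega))

lemma S_comm' {i j : ℕ} (h : i + 2 ≤ j ∨ j + 2 ≤ i) : S p i * S p j = S p j * S p i := by
  rcases h with h | h
  · exact S_comm h
  · exact (S_comm h).symm

lemma dsc_S_far {n r i : ℕ} (h : i + 1 < n) : dsc p n r * S p i = S p i * dsc p n r := by
  induction r with
  | zero => simp [dsc]
  | succ r ih => 
    rw [dsc, mul_assoc, ih, ← mul_assoc, ← mul_assoc, S_comm' (by omega)]

lemma dsc_S_far' {n r i : ℕ} (h : n + r < i) : dsc p n r * S p i = S p i * dsc p n r := by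
  induction r with
  | zero => simp [dsc]
  | succ r ih => 
    rw [dsc, mul_assoc, ih (by omega), ← mul_assoc, ← mul_assoc, S_comm' (by omega)]

lemma dsc_S_in {n r i : ℕ} (h1 : n < i + 1) (h2 : i + 1 < n + r) :
    dsc p n r * S p (i+1) = S p i * dsc p n r := by
  induction r with
  | zero => omega
  | succ r ih =>
    rcases Nat.lt_or_ge (i+1) (n + r) with h | h
    · rw [dsc, mul_assoc, ih h, ← mul_assoc, ← mul_assoc, S_comm' (by omega)]
    · have : n + r = i + 1 := by omega
      cases r with
      | zero => omega
      | succ r =>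
        have hi : i = n + r := by omega
        subst hi
        rw [dsc, dsc, mul_assoc, mul_assoc, dsc_S_far' (by omega), ← mul_assoc, ← mul_assoc]
        rw [show n + (r+1) = n + r + 1 by ring, ← S_braid]
        simp only [mul_assoc]

/-- normal form -/
lemma Hn_normal (N : ℕ) {h : Hec p} (hh : h ∈ Hn p (N+1)) :
    ∃ c : ℕ → Hec p, (∀ i, c i ∈ Hn p N) ∧ h = ∑ j ∈ Finset.range (N+1), c j * dsc p (N - j) j := by
  let Q : Submodule k (Hec p) := 
    { carrier := {h | ∃ c : ℕ → Hec p, (∀ i, c i ∈ Hn p N) ∧ h = ∑ j ∈ Finset.range (N+1), c j * dsc p (N - j) j}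
      add_mem' := by
        rintro _ _ ⟨c, hc, rfl⟩ ⟨d, hd, rfl⟩
        exact ⟨c + d, fun i => add_mem (hc i) (hd i), by simp [add_mul, Finset.sum_add_distrib]⟩
      zero_mem' := ⟨0, fun i => zero_mem _, by simp⟩
      smul_mem' := by
        rintro a _ ⟨c, hc, rfl⟩
        exact ⟨a • c, fun i => Subalgebra.smul_mem _ (hc i) _, by simp [Finset.smul_sum]⟩ }
  have base : ∀ c ∈ Hn p N, ∀ j ≤ N, c * dsc p (N - j) j ∈ Q := by
    intro c hc j hj
    refine ⟨fun i => if i = j then c else 0, fun i => by dsimp only; split_ifs; exacts [hc, zero_mem _], ?_⟩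
    rw [Finset.sum_eq_single j]
    · simp
    · intro b _ hb; simp [hb]
    · intro h; simp at h; omega
  have key : ∀ i, i + 1 < N + 1 → ∀ x ∈ Q, x * S p i ∈ Q := by
    rintro i hi _ ⟨c, hc, rfl⟩
    rw [Finset.sum_mul]
    refine Submodule.sum_mem _ fun j hj => ?_
    simp only [Finset.mem_range] at hj
    rcases lt_trichotomy (i + 1) (N - j) with h | h | h
    · rw [mul_assoc, dsc_S_far h, ← mul_assoc]
      exact base _ (mul_mem (hc j) (S_mem (by omega))) j (by omega)
    · rw [mul_assoc, ← h, ← dsc_succ', show i = N - (j+1) by omega]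
      exact base _ (hc j) (j+1) (by omega)
    · rcases Nat.lt_or_ge (N - j) i with h' | h'
      · obtain ⟨i', rfl⟩ : ∃ i', i = i' + 1 := ⟨i - 1, by omega⟩
        rw [mul_assoc, dsc_S_in (by omega) (by omega), ← mul_assoc]
        exact base _ (mul_mem (hc j) (S_mem (by omega))) j (by omega)
      · have hi : i = N - j := by omega
        obtain ⟨j', rfl⟩ : ∃ j', j = j' + 1 := ⟨j - 1, by omega⟩
        rw [← hi, dsc_succ', mul_assoc, mul_assoc, S_quad, mul_add, mul_add, mul_smul_comm, mul_smul_comm, 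
          mul_smul_comm, mul_smul_comm, ← dsc_succ', mul_one]
        refine add_mem (Q.smul_mem _ ?_) (Q.smul_mem _ ?_)
        · rw [hi]; exact base _ (hc _) (j'+1) (by omega)
        · rw [show i + 1 = N - j' by omega]; exact base _ (hc _) j' (by omega)
  have one : (1 : Hec p) ∈ Q := by
    have := base 1 (one_mem _) 0 (by omega)
    simpa [dsc] using this
  have : ∀ x ∈ Hn p (N+1), ∀ y ∈ Q, y * x ∈ Q := by
    intro x hx
    induction hx using Algebra.adjoin_induction with
    | mem x hx => obtain ⟨i, hi, rfl⟩ := hx; exact key i hi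
    | algebraMap r => 
      intro y hy; rw [← Algebra.commutes, ← Algebra.smul_def]; exact Q.smul_mem _ hy
    | add x y _ _ hx hy => intro z hz; rw [mul_add]; exact add_mem (hx z hz) (hy z hz)
    | mul x y _ _ hx hy => intro z hz; rw [← mul_assoc]; exact hy _ (hx z hz)
  have := this h hh 1 one
  rwa [one_mul] at this

lemma Hn_ind (N : ℕ) {P : Hec p → Prop} (hadd : ∀ x y, P x → P y → P (x + y))
    (h0 : ∀ x ∈ Hn p N, P x) 
    (h1 : ∀ n, N = n + 1 → ∀ x ∈ Hn p N, ∀ y ∈ Hn p N, P (x * S p n * y)) {h : Hec p}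
    (hh : h ∈ Hn p (N+1)) : P h := by
  obtain ⟨c, hc, rfl⟩ := Hn_normal N hh
  refine Finset.sum_induction _ P hadd (h0 0 (zero_mem _)) fun j hj => ?_
  simp only [Finset.mem_range] at hj
  cases j with
  | zero => simpa [dsc] using h0 _ (hc 0)
  | succ j =>
    rw [dsc, ← mul_assoc]
    exact h1 _ (by omega) _ (hc _) _ (dsc_mem (by omega))

/-- decomposition -/
lemma Hn_dec (n : ℕ) {h : Hec p} (hh : h ∈ Hn p (n+2)) :
    ∃ a ∈ Hn p (n+1), ∃ (m : ℕ) (b c : Fin m → Hec p), (∀ i, b i ∈ Hn p (n+1)) ∧ (∀ i, c i ∈ Hn p (n+1)) ∧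
      h = a + ∑ i, b i * S p n * c i := by
  obtain ⟨c, hc, rfl⟩ := Hn_normal (n+1) hh
  refine ⟨c 0, hc 0, n+1, fun i => c (i+1), fun i => dsc p (n - i) i, fun i => hc _, fun i => dsc_mem (by omega), ?_⟩
  rw [Finset.sum_range_succ', Finset.sum_range, add_comm]
  congr 1
  · simp [dsc]
  · refine Finset.sum_congr rfl fun i _ => ?_
    have : n + 1 - (↑i+1) + ↑i = n := by omega
    rw [dsc, ← mul_assoc, this]
    congr 2; omega

lemma Hn_le_one {N : ℕ} (hN : N ≤ 1) {h : Hec p} (hh : h ∈ Hn p N) : ∃ c : k, h = c • 1 := by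
  have : Hn p N ≤ ⊥ := Hn_le fun i hi => by omega
  obtain ⟨c, hc⟩ := Algebra.mem_bot.1 (this hh)
  exact ⟨c, by rw [← hc, Algebra.algebraMap_eq_smul_one]⟩

end HS

namespace HS
variable {k : Type} [Field k] {p : k}

lemma S_assoc_cancel (hp : p ≠ 0) (i : ℕ) (x : Hec p) : S p i * (T p i * x) = x := by
  rw [← mul_assoc, S_T hp, one_mul]
lemma T_assoc_cancel (hp : p ≠ 0) (i : ℕ) (x : Hec p) : T p i * (S p i * x) = x := by
  rw [← mul_assoc, T_S hp, one_mul]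

lemma TTS (hp : p ≠ 0) (i : ℕ) : T p i * T p (i+1) * S p i = S p (i+1) * (T p i * T p (i+1)) := by
  calc T p i * T p (i+1) * S p i = T p i * T p (i+1) * (S p i * (S p (i+1) * (S p i * (T p i * T p (i+1))))) := by
        rw [S_assoc_cancel hp, S_T hp, mul_one]
    _ = T p i * T p (i+1) * (S p i * S p (i+1) * S p i) * (T p i * T p (i+1)) := by simp only [mul_assoc]
    _ = S p (i+1) * (T p i * T p (i+1)) := by
        rw [S_braid]; simp only [mul_assoc]; rw [T_assoc_cancel hp, T_assoc_cancel hp]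

lemma STT (hp : p ≠ 0) (i : ℕ) : S p i * (T p (i+1) * T p i) = T p (i+1) * T p i * S p (i+1) := by
  calc S p i * (T p (i+1) * T p i) = T p (i+1) * (T p i * (S p i * (S p (i+1) * (S p i * (T p (i+1) * T p i))))) := by
        rw [T_assoc_cancel hp, T_assoc_cancel hp]
    _ = T p (i+1) * T p i * (S p i * S p (i+1) * S p i) * (T p (i+1) * T p i) := by simp only [mul_assoc]
    _ = _ := by
        rw [S_braid]; simp only [mul_assoc]; rw [S_assoc_cancel hp, S_T hp, mul_one]

lemma T_comm_S {i j : ℕ} (h : i + 2 ≤ j ∨ j + 2 ≤ i) : T p i * S p j = S p j * T p i := by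
  simp only [T, smul_mul_assoc, mul_smul_comm, sub_mul, mul_sub, one_mul, mul_one, S_comm' h]

lemma ascT_far {n r i : ℕ} (h : i + 2 ≤ n ∨ n + r + 1 ≤ i) : S p i * asc (T p) n r = asc (T p) n r * S p i := by
  induction r with
  | zero => simp [asc]
  | succ r ih =>
    rw [asc, ← mul_assoc, ih (by omega), mul_assoc, mul_assoc, T_comm_S (by omega)]

lemma ascT_in (hp : p ≠ 0) {n r i : ℕ} (h : n ≤ i) (h2 : i + 1 < n + r) :
    S p (i+1) * asc (T p) n r = asc (T p) n r * S p i := by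
  induction r with
  | zero => omega
  | succ r ih =>
    rcases Nat.lt_or_ge (i+1) (n+r) with h' | h'
    · rw [asc, ← mul_assoc, ih h', mul_assoc, mul_assoc, T_comm_S (by omega)]
    · obtain ⟨r, rfl⟩ : ∃ r', r = r' + 1 := ⟨r - 1, by omega⟩
      obtain rfl : i = n + r := by omega
      rw [asc, asc, mul_assoc, ← mul_assoc, ascT_far (by omega), mul_assoc, ← add_assoc, ← TTS hp]
      simp only [mul_assoc]

/-- braids -/
def bt (p : k) (r : ℕ) : ℕ → Hec p
  | 0 => 1
  | N + 1 => asc (T p) N r * bt p r N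

lemma bt_mem {r N M : ℕ} (h : N + r ≤ M) : bt p r N ∈ Hn p M := by
  induction N with
  | zero => exact one_mem _
  | succ N ih => exact mul_mem (ascT_mem (by omega)) (ih (by omega))

lemma bt_add (r n j : ℕ) : bt p r (n + j) = sh n (bt p r j) * bt p r n := by
  induction j with
  | zero => simp [bt]
  | succ j ih => rw [← add_assoc, bt, ih, bt, map_mul, sh_ascT, mul_assoc, add_comm j n]

lemma bt_two (hp : p ≠ 0) (r : ℕ) : S p 0 * bt p r 2 = bt p r 2 * S p r := by
  simp only [bt, mul_one]
  induction r with
  | zero => simp [asc]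
  | succ r ih =>
    have e : asc (T p) 1 (r+1) * asc (T p) 0 (r+1) = asc (T p) 1 r * asc (T p) 0 r * (T p (r+1) * T p r) := by
      simp only [asc]
      have : T p (1 + r) * asc (T p) 0 r = asc (T p) 0 r * T p (1 + r) := by
        simp only [T, smul_mul_assoc, mul_smul_comm, sub_mul, mul_sub, one_mul, mul_one]
        rw [ascT_far (by omega)]
      rw [mul_assoc, ← mul_assoc (T p (1+r)), this, add_comm 1 r, zero_add]; simp only [mul_assoc]
    rw [e, ← mul_assoc, ih, mul_assoc, STT hp]
    simp only [mul_assoc]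

lemma bt_comm (hp : p ≠ 0) (r N : ℕ) {h : Hec p} (hh : h ∈ Hn p N) : h * bt p r N = bt p r N * sh r h := by
  induction hh using Algebra.adjoin_induction with
  | mem x hx =>
    obtain ⟨i, hi, rfl⟩ := hx
    obtain ⟨j, rfl⟩ : ∃ j, N = (i + 2) + j := ⟨N - (i+2), by omega⟩
    rw [bt_add, bt_add r i 2, sh_S, ← mul_assoc, ← mul_assoc, (comm_sh (le_refl _) (S_mem (by omega)) _).eq]
    have h1 : S p i * sh i (bt p r 2) = sh i (bt p r 2) * S p (i + r) := by
      have := congrArg (sh i) (bt_two hp r)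
      simpa [add_comm] using this
    have h2 : S p (i + r) * bt p r i = bt p r i * S p (i + r) := by
      have := comm_sh (a := i + r) (le_refl _) (bt_mem (p := p) (r := r) (N := i) le_rfl) (S p 0)
      rw [sh_S, zero_add] at this
      exact this.symm.eq
    simp only [mul_assoc]
    rw [← mul_assoc (S p i), h1, mul_assoc, h2]
  | algebraMap r => rw [AlgHom.commutes, Algebra.commutes]
  | add x y _ _ hx hy => rw [add_mul, map_add, mul_add, hx, hy]
  | mul x y _ _ hx hy => rw [map_mul, mul_assoc, hy, ← mul_assoc, hx, mul_assoc]

lemma ascT_comm (hp : p ≠ 0) (r N : ℕ) {h : Hec p} (hh : h ∈ Hn p r) :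
    sh (N+1) h * asc (T p) N r = asc (T p) N r * sh N h := by
  induction hh using Algebra.adjoin_induction with
  | mem x hx =>
    obtain ⟨i, hi, rfl⟩ := hx
    rw [sh_S, sh_S, ← add_assoc, ascT_in hp (by omega) (by omega)]
  | algebraMap r => rw [AlgHom.commutes, AlgHom.commutes, Algebra.commutes]
  | add x y _ _ hx hy => rw [map_add, add_mul, map_add, mul_add, hx, hy]
  | mul x y _ _ hx hy => rw [map_mul, map_mul, mul_assoc, hy, ← mul_assoc, hx, mul_assoc]

lemma bt_comm' (hp : p ≠ 0) (r N : ℕ) {h : Hec p} (hh : h ∈ Hn p r) : sh N h * bt p r N = bt p r N * h := by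
  induction N with
  | zero => simp [bt, sh_zero]
  | succ N ih => rw [bt, ← mul_assoc, ascT_comm hp _ _ hh, mul_assoc, ih, mul_assoc]

lemma bt_succ_left (r N : ℕ) : bt p (r+1) N = bt p 1 N * sh 1 (bt p r N) := by
  induction N with
  | zero => simp [bt]
  | succ N ih =>
    rw [bt, bt, bt, ih, asc_succ', map_mul, sh_ascT]
    have := comm_sh (le_refl _) (bt_mem (p := p) (r := 1) (N := N) le_rfl) (asc (T p) 0 r)
    rw [sh_ascT, zero_add] at this
    simp only [asc, one_mul, add_zero, mul_assoc]
    rw [← mul_assoc (asc (T p) (N+1) r), ← this.eq]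
    simp only [mul_assoc]

def NC (p : k) (r N : ℕ) : Submodule k (Hec p) :=
  Submodule.span k {x | ∃ b ∈ Hn p N, ∃ c ∈ Hn p N, x = b * sh r c}

lemma NC_combine (hp : p ≠ 0) {r N1 N2 : ℕ} (hr : r ≤ N1) (hN2 : 1 ≤ N2) {z1 z2 : Hec p}
    (h1 : z1 ∈ NC p r N1) (h2 : z2 ∈ NC p 1 N2) :
    sh N1 z2 * bt p 1 N1 * sh 1 (sh N1 (bt p r N2) * z1) ∈ NC p (r+1) (N1+N2) := by
  induction h2 using Submodule.span_induction with
  | zero => simp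
  | add x y _ _ hx hy => rw [map_add, add_mul, add_mul]; exact add_mem hx hy
  | smul a x _ hx => rw [map_smul, smul_mul_assoc, smul_mul_assoc]; exact Submodule.smul_mem _ _ hx
  | mem x hx =>
    obtain ⟨b2, hb2, c2, hc2, rfl⟩ := hx
    induction h1 using Submodule.span_induction with
    | zero => simp
    | add x y _ _ hx hy => rw [mul_add, map_add, mul_add]; exact add_mem hx hy
    | smul a x _ hx => rw [mul_smul_comm, map_smul, mul_smul_comm]; exact Submodule.smul_mem _ _ hx
    | mem x hx =>
      obtain ⟨b1, hb1, c1, hc1, rfl⟩ := hx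
      apply Submodule.subset_span
      obtain ⟨d, rfl⟩ : ∃ d, N1 = d + r := ⟨N1 - r, by omega⟩
      refine ⟨sh (d + r) b2 * b1 * bt p 1 (d + r), ?_, sh d (bt p r N2) * (sh (d+r) c2 * c1), ?_, ?_⟩
      · exact mul_mem (mul_mem (sh_mem hb2 (by omega)) (Hn_mono (by omega) hb1)) (bt_mem (by omega))
      · exact mul_mem (sh_mem (bt_mem le_rfl) (by omega)) (mul_mem (sh_mem hc2 (by omega)) (Hn_mono (by omega) hc1))
      · simp only [map_mul, sh_sh]
        rw [show 1 + (d+r) = d + r + 1 by ring, show d + (r+1) = d + r + 1 by ring, 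
          show d + r + (r+1) = r + (d + r + 1) by ring]
        have e1 : sh (d+r+1) (bt p r N2) * sh 1 b1 = sh 1 b1 * sh (d+r+1) (bt p r N2) := by
          have := comm_sh (le_refl _) (sh_mem (a := 1) hb1 le_rfl) (bt p r N2)
          exact this.symm.eq
        have e2 : bt p 1 (d+r) * sh 1 b1 = b1 * bt p 1 (d+r) := (bt_comm hp _ _ hb1).symm
        have e3 : sh (d+r+1) c2 * b1 = b1 * sh (d+r+1) c2 := (comm_sh (by omega) hb1 c2).symm.eq
        have e4 : sh (d+r+1) c2 * bt p 1 (d+r) = bt p 1 (d+r) * sh (d+r+1) c2 :=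
          (comm_sh le_rfl (bt_mem le_rfl) c2).symm.eq
        have e5 : sh (d+r+1) c2 * sh (d+r+1) (bt p r N2) = sh (d+r+1) (bt p r N2) * sh (r + (d+r+1)) c2 := by
          rw [← map_mul, bt_comm hp _ _ hc2, map_mul, sh_sh]
        rw [add_comm r 1]
        simp only [mul_assoc]
        rw [← mul_assoc (sh (d+r+1) (bt p r N2)), e1]
        simp only [mul_assoc]
        rw [← mul_assoc (bt p 1 (d+r)), e2]
        simp only [mul_assoc]
        rw [← mul_assoc (sh (d+r+1) c2), e3, mul_assoc, ← mul_assoc (sh (d+r+1) c2), e4, mul_assoc,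
          ← mul_assoc (sh (d+r+1) c2), e5]
        simp only [mul_assoc]

def Deep {A : Type} [Ring A] [Algebra k A] (Φ : Hec p →ₐ[k] A) (r N : ℕ) (a : Hec p) : Prop :=
  a ∈ Hn p N ∧ ∃ z ∈ NC p r N, Φ (a * bt p r N) = Φ z

lemma Deep.combine (hp : p ≠ 0) {A : Type} [Ring A] [Algebra k A] {Φ : Hec p →ₐ[k] A}
    (hΦ : ∀ x y, Φ x = Φ y → ∀ a, Φ (sh a x) = Φ (sh a y)) {r N1 N2 : ℕ} (hr : r ≤ N1) (hN2 : 1 ≤ N2)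
    {a1 a2 : Hec p} (h1 : Deep Φ r N1 a1) (h2 : Deep Φ 1 N2 a2) :
    Deep Φ (r+1) (N1+N2) (a1 * sh N1 a2) := by
  obtain ⟨m1, z1, hz1, e1⟩ := h1
  obtain ⟨m2, z2, hz2, e2⟩ := h2
  refine ⟨mul_mem (Hn_mono (by omega) m1) (sh_mem m2 (by omega)), _, NC_combine hp hr hN2 hz1 hz2, ?_⟩
  have e : a1 * sh N1 a2 * bt p (r+1) (N1+N2) = 
      sh N1 (a2 * bt p 1 N2) * bt p 1 N1 * sh 1 (sh N1 (bt p r N2) * (a1 * bt p r N1)) := by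
    have c1 : a1 * sh N1 a2 = sh N1 a2 * a1 := (comm_sh le_rfl m1 _).eq
    have c2 : a1 * bt p 1 (N1+N2) = bt p 1 (N1+N2) * sh 1 a1 := bt_comm hp _ _ (Hn_mono (by omega) m1)
    have c3 : sh N1 (bt p r N2) * a1 = a1 * sh N1 (bt p r N2) := (comm_sh le_rfl m1 _).symm.eq
    rw [c1, bt_succ_left, mul_assoc, ← mul_assoc a1, c2, ← mul_assoc (sh N1 (bt p r N2)), c3, bt_add, bt_add]
    simp only [map_mul, mul_assoc]
  rw [e]
  have f1 := hΦ _ _ e2 N1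
  have f2 : Φ (sh 1 (sh N1 (bt p r N2) * (a1 * bt p r N1))) = Φ (sh 1 (sh N1 (bt p r N2) * z1)) :=
    hΦ _ _ (by rw [map_mul, e1, map_mul]) 1
  rw [map_mul Φ, map_mul Φ, f1, f2, ← map_mul, ← map_mul]

/-- sign character -/
def eps (p : k) : Hec p →ₐ[k] k := lft (fun _ => -1) (fun _ => by simp) (fun _ => by simp) (fun _ _ _ => by simp)

@[simp] lemma eps_S (i : ℕ) : eps p (S p i) = -1 := lft_S _ _ _ _ _

def qn (p : k) (n : ℕ) : k := ∑ i ∈ Finset.range n, p⁻¹ ^ i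

lemma qn_succ (n : ℕ) : qn p (n+1) = 1 + p⁻¹ * qn p n := by
  rw [qn, Finset.sum_range_succ', qn, Finset.mul_sum, add_comm]; simp [pow_succ']

def An (p : k) : ℕ → Hec p
  | 0 => 1
  | 1 => 1
  | n + 2 => (qn p (n+2))⁻¹ • (An p (n+1) + (-p⁻¹ * qn p (n+1)) • (An p (n+1) * S p n * An p (n+1)))

lemma absorb_right {N : ℕ} {A : Hec p} (hA : ∀ i, i + 1 < N → A * S p i = -A) {h : Hec p} (hh : h ∈ Hn p N) :
    A * h = eps p h • A := by
  induction hh using Algebra.adjoin_induction with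
  | mem x hx => obtain ⟨i, hi, rfl⟩ := hx; simp [hA i hi]
  | algebraMap r => rw [AlgHom.commutes, ← Algebra.commutes, Algebra.smul_def]; rfl
  | add x y _ _ hx hy => rw [mul_add, map_add, add_smul, hx, hy]
  | mul x y _ _ hx hy => rw [← mul_assoc, hx, smul_mul_assoc, hy, map_mul, smul_smul]

lemma absorb_left {N : ℕ} {A : Hec p} (hA : ∀ i, i + 1 < N → S p i * A = -A) {h : Hec p} (hh : h ∈ Hn p N) :
    h * A = eps p h • A := by
  induction hh using Algebra.adjoin_induction with
  | mem x hx => obtain ⟨i, hi, rfl⟩ := hx; simp [hA i hi]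
  | algebraMap r => rw [AlgHom.commutes, Algebra.smul_def]; rfl
  | add x y _ _ hx hy => rw [add_mul, map_add, add_smul, hx, hy]
  | mul x y _ _ hx hy => rw [mul_assoc, hy, mul_smul_comm, hx, map_mul, smul_smul, mul_comm]

lemma key_right {H : Type} [Ring H] [Algebra k H] {A B g s : H} {c n1 n2 : k} (hc : c * p = -1)
    (AB : A * B = A) (gB : g * B = B * g) (As : A * s = -A) (gsg : g * s * g = s * g * s)
    (gg : g * g = (p - 1) • g + p • 1) (hA : n1 • A = B + (c * n2) • (B * s * B)) :
    (A + (c * n1) • (A * g * A)) * g = -(A + (c * n1) • (A * g * A)) := by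
  have AgB : A * g * B = A * g := by rw [mul_assoc, gB, ← mul_assoc, AB]
  have e : n1 • (A * g * A) = A * g + (c * n2) • (A * g * s * B) := by
    rw [← mul_smul_comm, hA, mul_add, AgB, mul_smul_comm, ← mul_assoc, ← mul_assoc, AgB]
  have e2 : A * g * s * B * g = - (A * g * s * B) := by
    rw [mul_assoc, ← gB, ← mul_assoc, mul_assoc A, mul_assoc A, gsg, ← mul_assoc, ← mul_assoc, As]; simp [mul_assoc]
  rw [mul_smul, e, add_mul, smul_mul_assoc, add_mul, mul_assoc A g g, gg, smul_mul_assoc, e2]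
  simp only [mul_add, mul_smul_comm, mul_one, smul_add, smul_smul, smul_neg, neg_add]
  rw [hc]
  have : c * (p - 1) = -1 - c := by linear_combination hc
  rw [this]
  module

lemma key_left {H : Type} [Ring H] [Algebra k H] {A B g s : H} {c n1 n2 : k} (hc : c * p = -1)
    (BA : B * A = A) (gB : g * B = B * g) (sA : s * A = -A) (gsg : g * s * g = s * g * s)
    (gg : g * g = (p - 1) • g + p • 1) (hA : n1 • A = B + (c * n2) • (B * s * B)) :
    g * (A + (c * n1) • (A * g * A)) = -(A + (c * n1) • (A * g * A)) := by
  have BgA : B * g * A = g * A := by rw [← gB, mul_assoc, BA]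
  have e : n1 • (A * g * A) = g * A + (c * n2) • (B * s * g * A) := by
    rw [mul_assoc, ← smul_mul_assoc, hA, add_mul, ← mul_assoc, BgA, smul_mul_assoc, ← mul_assoc, mul_assoc (B * s) B g, ← gB, 
      ← mul_assoc, mul_assoc (B * s * g), BA]
  have e2 : g * (B * s * g * A) = - (B * s * g * A) := by
    rw [← mul_assoc, ← mul_assoc, ← mul_assoc, gB, mul_assoc B, mul_assoc B, gsg]
    simp only [mul_assoc]; rw [sA]; simp
  rw [mul_smul, e, mul_add, mul_smul_comm, mul_add, ← mul_assoc g g A, gg, mul_smul_comm, e2]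
  simp only [add_mul, smul_mul_assoc, one_mul, smul_add, smul_smul, smul_neg, neg_add]
  rw [hc]
  have : c * (p - 1) = -1 - c := by linear_combination hc
  rw [this]
  module

lemma An_props (hp : p ≠ 0) (hq : ∀ n, qn p (n+1) ≠ 0) (n : ℕ) :
    An p (n+1) ∈ Hn p (n+1) ∧ eps p (An p (n+1)) = 1 ∧
      (∀ i, i + 1 < n + 1 → An p (n+1) * S p i = - An p (n+1)) ∧
      (∀ i, i + 1 < n + 1 → S p i * An p (n+1) = - An p (n+1)) := by
  induction n using Nat.strong_induction_on with
  | _ n ih =>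
  cases n with
  | zero => exact ⟨one_mem _, by simp [An], fun i hi => by omega, fun i hi => by omega⟩
  | succ n =>
    obtain ⟨m, e, r, l⟩ := ih n (by omega)
    have hc : (-p⁻¹) * p = -1 := by field_simp
    have AA : An p (n+1) * An p (n+1) = An p (n+1) := by rw [absorb_right r m, e, one_smul]
    have def' : An p (n+2) = (qn p (n+2))⁻¹ • (An p (n+1) + (-p⁻¹ * qn p (n+1)) • (An p (n+1) * S p n * An p (n+1))) := rfl
    refine ⟨?_, ?_, ?_, ?_⟩
    · rw [def']
      have m' := Hn_mono (show n + 1 ≤ n + 1 + 1 by omega) m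
      exact Subalgebra.smul_mem _ (add_mem m' (Subalgebra.smul_mem _ (mul_mem (mul_mem m' (S_mem (by omega))) m') _)) _
    · rw [def', map_smul, map_add, map_smul, map_mul, map_mul, e, eps_S]
      simp only [smul_eq_mul]
      rw [inv_mul_eq_one₀ (hq _), qn_succ]; ring
    · intro i hi
      rw [def', smul_mul_assoc, ← smul_neg]
      congr 1
      rcases Nat.lt_or_ge i n with h | h
      · rw [add_mul, r i (by omega), smul_mul_assoc, mul_assoc, r i (by omega)]; simp only [mul_neg, smul_neg]; abel
      · obtain rfl : i = n := by omega
        cases i with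
        | zero => simp only [An, qn, zero_add, one_mul, mul_one, add_mul, smul_mul_assoc, S_quad]
                  simp only [smul_add, smul_smul, Finset.sum_range_one, pow_zero, mul_one]
                  rw [hc, show -p⁻¹ * (p-1) = -1 + p⁻¹ by field_simp; ring]
                  module
        | succ j =>
          obtain ⟨m', e', r', l'⟩ := ih j (by omega)
          refine key_right (p := p) (B := An p (j+1)) (s := S p j) (n2 := qn p (j+1)) hc ?_ ?_ (r j (by omega)) (S_braid j).symm (S_quad _) ?_
          · rw [absorb_right r (Hn_mono (by omega) m'), e', one_smul]
          · have := comm_sh le_rfl m' (S p 0)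
            rw [sh_S, zero_add] at this
            exact this.symm.eq
          · rw [An, smul_smul, mul_inv_cancel₀ (hq _), one_smul]
    · intro i hi
      rw [def', mul_smul_comm, ← smul_neg]
      congr 1
      rcases Nat.lt_or_ge i n with h | h
      · rw [mul_add, l i (by omega), mul_smul_comm, ← mul_assoc, ← mul_assoc, l i (by omega)]; simp only [neg_mul, smul_neg]; abel
      · obtain rfl : i = n := by omega
        cases i with
        | zero => simp only [An, qn, zero_add, one_mul, mul_one, mul_add, mul_smul_comm, S_quad]
                  simp only [smul_add, smul_smul, Finset.sum_range_one, pow_zero, mul_one]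
                  rw [hc, show -p⁻¹ * (p-1) = -1 + p⁻¹ by field_simp; ring]
                  module
        | succ j =>
          obtain ⟨m', e', r', l'⟩ := ih j (by omega)
          refine key_left (p := p) (B := An p (j+1)) (s := S p j) (n2 := qn p (j+1)) hc ?_ ?_ (l j (by omega)) (S_braid j).symm (S_quad _) ?_
          · rw [absorb_left l (Hn_mono (by omega) m'), e', one_smul]
          · have := comm_sh le_rfl m' (S p 0)
            rw [sh_S, zero_add] at this
            exact this.symm.eq
          · rw [An, smul_smul, mul_inv_cancel₀ (hq _), one_smul]

lemma An_props' (hp : p ≠ 0) (hq : ∀ n, qn p (n+1) ≠ 0) (n : ℕ) :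
    An p n ∈ Hn p n ∧ eps p (An p n) = 1 ∧
      (∀ i, i + 1 < n → An p n * S p i = - An p n) ∧
      (∀ i, i + 1 < n → S p i * An p n = - An p n) := by
  cases n with
  | zero => exact ⟨one_mem _, by simp [An], fun i hi => by omega, fun i hi => by omega⟩
  | succ n => exact An_props hp hq n

end HS

namespace HS
set_option linter.unusedSectionVars false
set_option linter.unusedVariables false
set_option linter.unusedSimpArgs false
variable {k : Type} [Field k] {p : k} {I : Type}

abbrev Fn (k I : Type) : Type := (ℕ → I) → k

def spl (a : ℕ) (s s' : ℕ → I) : ℕ → I := fun i => if i < a then s i else s' (i - a)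

lemma spl_spl (a b : ℕ) (s : ℕ → I) (t : ℕ → I) :
    spl a s (spl b (fun n => s (n + a)) t) = spl (b + a) s t := by
  funext i
  simp only [spl]
  split_ifs <;> first | rfl | (exfalso; omega) | (congr 1; omega)

def Sh (a : ℕ) : Module.End k (Fn k I) →ₐ[k] Module.End k (Fn k I) :=
  AlgHom.ofLinearMap
    { toFun := fun A =>
        { toFun := fun f s => A (fun s' => f (spl a s s')) (fun n => s (n + a))
          map_add' := fun f g => by
            funext s
            exact congrFun (map_add A (fun s' => f (spl a s s')) (fun s' => g (spl a s s'))) _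
          map_smul' := fun c f => by
            funext s
            exact congrFun (map_smul A c (fun s' => f (spl a s s'))) _ }
      map_add' := fun A B => rfl
      map_smul' := fun c A => rfl }
    (by 
      ext f s
      simp only [LinearMap.coe_mk, AddHom.coe_mk, Module.End.one_apply]
      congr 1; funext i; simp only [spl]; split_ifs with h
      · rfl
      · congr 1; omega)
    (by
      intro A B
      ext f s
      simp only [LinearMap.coe_mk, AddHom.coe_mk, Module.End.mul_apply]
      have e1 : ∀ s', (fun s'' => f (spl a (spl a s s') s'')) = fun s'' => f (spl a s s'') := fun s' => by
        funext s''; congr 1; funext i; simp only [spl]; split_ifs <;> rfl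
      have e2 : ∀ s', (fun n => spl a s s' (n + a)) = s' := fun s' => by funext n; simp [spl]
      simp only [e1, e2])

lemma Sh_apply (a : ℕ) (A : Module.End k (Fn k I)) (f : Fn k I) (s : ℕ → I) :
    Sh a A f s = A (fun s' => f (spl a s s')) (fun n => s (n + a)) := rfl

lemma Sh_Sh (a b : ℕ) (A : Module.End k (Fn k I)) : Sh a (Sh b A) = Sh (b + a) A := by
  ext f s
  simp only [Sh_apply]
  simp only [spl_spl, add_assoc]

structure IsHk (p : k) (A : Module.End k (Fn k I)) : Prop where
  quad : A * A = (p - 1) • A + p • 1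
  braid : A * Sh 1 A * A = Sh 1 A * A * Sh 1 A
  comm : ∀ B, A * Sh 2 B = Sh 2 B * A

def rho {A : Module.End k (Fn k I)} (hA : IsHk p A) : Hec p →ₐ[k] Module.End k (Fn k I) :=
  lft (fun i => Sh i A)
    (fun i => by rw [← map_mul, hA.quad, map_add, map_smul, map_smul, map_one])
    (fun i => by
      have := congrArg (Sh i) hA.braid
      simp only [map_mul, Sh_Sh] at this
      rwa [add_comm 1 i] at this)
    (fun i j h => by
      obtain ⟨j, rfl⟩ : ∃ j', j = j' + 2 + i := ⟨j - 2 - i, by omega⟩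
      have := congrArg (Sh i) (hA.comm (Sh j A))
      simpa only [map_mul, Sh_Sh] using this)

lemma rho_S {A : Module.End k (Fn k I)} (hA : IsHk p A) (i : ℕ) : rho hA (S p i) = Sh i A := lft_S _ _ _ _ _

lemma rho_sh {A : Module.End k (Fn k I)} (hA : IsHk p A) (a : ℕ) (h : Hec p) :
    rho hA (sh a h) = Sh a (rho hA h) := by
  have : (rho hA).comp (sh a) = (Sh a).comp (rho hA) := hec_ext fun i => by simp [rho_S, Sh_Sh]
  exact DFunLike.congr_fun this h

def app {n : ℕ} (u : Fin n → I) (e : ℕ → I) : ℕ → I := fun i => if h : i < n then u ⟨i, h⟩ else e (i - n)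

lemma spl_app {n : ℕ} (u : Fin n → I) (e s : ℕ → I) : spl n (app u e) s = app u s := by
  funext i; simp only [spl, app]; split_ifs <;> rfl

lemma app_tail {n : ℕ} (u : Fin n → I) (e : ℕ → I) : (fun i => app u e (i + n)) = e := by
  funext i; simp [app]

lemma Sh_app {n : ℕ} (A : Module.End k (Fn k I)) (f : Fn k I) (u : Fin n → I) (e : ℕ → I) :
    Sh n A f (app u e) = A (fun s' => f (app u s')) e := by
  rw [Sh_apply, app_tail]; simp only [spl_app]

lemma app_inj {n : ℕ} {u v : Fin n → I} {e e' : ℕ → I} (h : app u e = app v e') : u = v := by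
  funext i
  have := congrFun h i
  simpa [app] using this

lemma exists_app (n : ℕ) (s : ℕ → I) : ∃ (u : Fin n → I) (e : ℕ → I), s = app u e :=
  ⟨fun i => s i, fun i => s (i + n), by
    funext i; simp only [app]; split_ifs with h
    · rfl
    · congr 1; omega⟩

def cat {a b N : ℕ} (h : N = a + b) (u : Fin a → I) (w : Fin b → I) : Fin N → I :=
  fun i => if h' : i.1 < a then u ⟨i, h'⟩ else w ⟨i - a, by omega⟩

lemma app_cat {a b N : ℕ} (h : N = a + b) (u : Fin a → I) (w : Fin b → I) (e : ℕ → I) :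
    app (cat h u w) e = app u (app w e) := by
  funext i; simp only [app, cat]; split_ifs <;> first | rfl | (exfalso; omega) | (congr 1; omega)

def catE {a b N : ℕ} (h : N = a + b) : (Fin a → I) × (Fin b → I) ≃ (Fin N → I) where
  toFun x := cat h x.1 x.2
  invFun s := (fun i => s ⟨i, by omega⟩, fun j => s ⟨a + j, by omega⟩)
  left_inv x := by
    ext i
    · simp [cat]
    · simp [cat]
  right_inv s := by
    ext i
    simp only [cat]; split_ifs
    · rfl
    · congr 1; ext; simp; omega

lemma cat_inj {a b N : ℕ} (h : N = a + b) {u u' : Fin a → I} {w w' : Fin b → I} :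
    cat h u w = cat h u' w' ↔ u = u' ∧ w = w' := by
  have := (catE (I := I) h).injective.eq_iff (a := (u, w)) (b := (u', w'))
  simpa [catE] using this

lemma exists_cat {a b N : ℕ} (h : N = a + b) (s : Fin N → I) : ∃ u w, s = cat h u w := by
  obtain ⟨x, rfl⟩ := (catE h).surjective s
  exact ⟨x.1, x.2, rfl⟩

lemma cat_assoc [Nonempty I] {a b c N M L : ℕ} (h1 : M = a + b) (h2 : N = M + c) (h3 : L = b + c) (h4 : N = a + L)
    (u : Fin a → I) (v : Fin b → I) (w : Fin c → I) : cat h2 (cat h1 u v) w = cat h4 u (cat h3 v w) := by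
  have e : ℕ → I := fun _ => Classical.arbitrary I
  apply app_inj (e := e) (e' := e)
  simp only [app_cat]

section fin
variable [Fintype I] 

lemma sum_cat {a b N : ℕ} (h : N = a + b) {M : Type} [AddCommMonoid M] (F : (Fin N → I) → M) :
    ∑ s, F s = ∑ u, ∑ w, F (cat h u w) := by
  rw [← (catE h).sum_comp, Fintype.sum_prod_type]; rfl

def LocBy (N : ℕ) (A : Module.End k (Fn k I)) (X : Matrix (Fin N → I) (Fin N → I) k) : Prop :=
  ∀ (f : Fn k I) (s : Fin N → I) (e : ℕ → I), A f (app s e) = ∑ t, X s t * f (app t e)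

variable [DecidableEq I]

lemma LocBy.one (N : ℕ) : LocBy N (1 : Module.End k (Fn k I)) 1 := by
  intro f s e; simp [Matrix.one_apply]

lemma LocBy.add {N : ℕ} {A B : Module.End k (Fn k I)} {X Y} (hA : LocBy N A X) (hB : LocBy N B Y) :
    LocBy N (A + B) (X + Y) := by
  intro f s e
  simp [hA f s e, hB f s e, add_mul, Finset.sum_add_distrib]

lemma LocBy.smul {N : ℕ} {A : Module.End k (Fn k I)} {X} (c : k) (hA : LocBy N A X) :
    LocBy N (c • A) (c • X) := by
  intro f s e
  simp [hA f s e, Finset.mul_sum, mul_assoc]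

lemma LocBy.mul {N : ℕ} {A B : Module.End k (Fn k I)} {X Y} (hA : LocBy N A X) (hB : LocBy N B Y) :
    LocBy N (A * B) (X * Y) := by
  intro f s e
  simp only [Module.End.mul_apply, hA (B f) s e, hB f, Matrix.mul_apply, Finset.sum_mul, Finset.mul_sum]
  rw [Finset.sum_comm]
  simp only [mul_assoc]

def tens {a b N : ℕ} (h : N = a + b) (X : Matrix (Fin a → I) (Fin a → I) k) (Y : Matrix (Fin b → I) (Fin b → I) k) :
    Matrix (Fin N → I) (Fin N → I) k :=
  fun s t => X ((catE h).symm s).1 ((catE h).symm t).1 * Y ((catE h).symm s).2 ((catE h).symm t).2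

lemma tens_cat {a b N : ℕ} (h : N = a + b) (X : Matrix (Fin a → I) (Fin a → I) k) (Y : Matrix (Fin b → I) (Fin b → I) k)
    (u u' w w') : tens h X Y (cat h u w) (cat h u' w') = X u u' * Y w w' := by
  have e : ∀ u w, (catE (I := I) h).symm (cat h u w) = (u, w) := fun u w => (catE h).symm_apply_apply (u, w)
  simp [tens, e]

lemma LocBy.tens {a b N : ℕ} (h : N = a + b) {A B : Module.End k (Fn k I)} {X Y} (hA : LocBy a A X) (hB : LocBy b B Y) :
    LocBy N (A * Sh a B) (tens h X Y) := by
  intro f s e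
  obtain ⟨u, w, rfl⟩ := exists_cat h s
  rw [sum_cat h, app_cat, Module.End.mul_apply, hA]
  refine Finset.sum_congr rfl fun u' _ => ?_
  rw [Sh_app, hB, Finset.mul_sum]
  refine Finset.sum_congr rfl fun w' _ => ?_
  rw [tens_cat, app_cat, mul_assoc]

def cyl {N : ℕ} (t : Fin N → I) : Fn k I := fun s => if ∀ i : Fin N, s i = t i then 1 else 0

lemma cyl_app {N : ℕ} (t s : Fin N → I) (e : ℕ → I) : cyl (k := k) t (app s e) = if s = t then 1 else 0 := by
  simp [cyl, app, funext_iff]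

variable [Nonempty I]

def dflt (I : Type) [Nonempty I] : ℕ → I := fun _ => Classical.arbitrary I

lemma LocBy.eq {N : ℕ} {A : Module.End k (Fn k I)} {X} (hA : LocBy N A X) (s t : Fin N → I) :
    X s t = A (cyl t) (app s (dflt I)) := by
  rw [hA]; simp [cyl_app]

lemma LocBy.unique {N : ℕ} {A : Module.End k (Fn k I)} {X Y} (hA : LocBy N A X) (hB : LocBy N A Y) : X = Y := by
  ext s t; rw [hA.eq, hB.eq]

def op0 (X : I → I → I → I → k) : Module.End k (Fn k I) where
  toFun f s := ∑ c, ∑ d, X (s 0) (s 1) c d * f (spl 2 (fun i => if i = 0 then c else d) (fun n => s (n + 2)))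
  map_add' f g := by
    funext s; simp [mul_add, Finset.sum_add_distrib]
  map_smul' c f := by
    funext s; simp [Finset.mul_sum, mul_left_comm]

lemma sum_two {M : Type} [AddCommMonoid M] (F : (Fin 2 → I) → M) : ∑ s, F s = ∑ a, ∑ b, F ![a, b] := by
  rw [← (finTwoArrowEquiv I).symm.sum_comp, Fintype.sum_prod_type]; rfl

lemma op0_loc (X : I → I → I → I → k) : LocBy 2 (op0 X) (fun s t => X (s 0) (s 1) (t 0) (t 1)) := by
  intro f s e
  rw [sum_two]
  simp only [op0, LinearMap.coe_mk, AddHom.coe_mk]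
  refine Finset.sum_congr rfl fun c _ => Finset.sum_congr rfl fun d _ => ?_
  congr 2
  funext i
  simp only [spl, app]
  split_ifs with h1 h2
  · subst h2; rfl
  · obtain rfl : i = 1 := by omega
    rfl
  · omega
  · congr 1

lemma op0_comm (X : I → I → I → I → k) (B : Module.End k (Fn k I)) : op0 X * Sh 2 B = Sh 2 B * op0 X := by
  ext f s
  obtain ⟨u, e, rfl⟩ := exists_app 2 s
  have := op0_loc X
  simp only [Module.End.mul_apply]
  rw [this, Sh_app]
  simp only [Sh_app]
  have e2 : (fun s' => (op0 X f) (app u s')) = ∑ t : Fin 2 → I, X (u 0) (u 1) (t 0) (t 1) • (fun s' => f (app t s')) := by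
    funext s'; rw [this]; simp
  rw [e2, map_sum]; simp

structure Dat (p : k) (I : Type) [Fintype I] [DecidableEq I] [Nonempty I] where
  X : I → I → I → I → k
  hk : IsHk p (op0 X)
  g : I → k
  g0 : ∀ i, g i ≠ 0
  hg : ∀ a b c d, X a b c d * (g c * g d) = g a * g b * X a b c d

namespace Dat
variable (D : Dat p I)

def ρ : Hec p →ₐ[k] Module.End k (Fn k I) := rho D.hk

lemma ρ_S (i : ℕ) : D.ρ (S p i) = Sh i (op0 D.X) := rho_S _ _
lemma ρ_sh (a : ℕ) (h : Hec p) : D.ρ (sh a h) = Sh a (D.ρ h) := rho_sh _ _ _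

def M (N : ℕ) : Hec p →ₗ[k] Matrix (Fin N → I) (Fin N → I) k where
  toFun h := Matrix.of fun s t => D.ρ h (cyl t) (app s (dflt I))
  map_add' h h' := by ext; simp
  map_smul' c h := by ext; simp

lemma M_eq {N : ℕ} {h : Hec p} {X} (hX : LocBy N (D.ρ h) X) : D.M N h = X := by
  ext s t; rw [hX.eq]; rfl

lemma loc_exists {N : ℕ} {h : Hec p} (hh : h ∈ Hn p N) : ∃ X, LocBy N (D.ρ h) X := by
  induction hh using Algebra.adjoin_induction with
  | mem x hx =>
    obtain ⟨i, hi, rfl⟩ := hx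
    rw [ρ_S]
    have h1 := (LocBy.one (k := k) (I := I) i).tens (N := i + 2) rfl (op0_loc D.X)
    have h2 := h1.tens (N := N) (b := N - (i+2)) (by omega) (LocBy.one (k := k) (I := I) _)
    rw [one_mul, map_one, mul_one] at h2
    exact ⟨_, h2⟩
  | algebraMap r => 
    rw [AlgHom.commutes, Algebra.algebraMap_eq_smul_one]
    exact ⟨_, (LocBy.one N).smul r⟩
  | add x y _ _ hx hy => 
    obtain ⟨X, hX⟩ := hx
    obtain ⟨Y, hY⟩ := hy
    rw [map_add]; exact ⟨_, hX.add hY⟩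
  | mul x y _ _ hx hy =>
    obtain ⟨X, hX⟩ := hx
    obtain ⟨Y, hY⟩ := hy
    rw [map_mul]; exact ⟨_, hX.mul hY⟩

lemma loc {N : ℕ} {h : Hec p} (hh : h ∈ Hn p N) : LocBy N (D.ρ h) (D.M N h) := by
  obtain ⟨X, hX⟩ := D.loc_exists hh
  rwa [D.M_eq hX]

lemma M_mul {N : ℕ} {h h' : Hec p} (hh : h ∈ Hn p N) (hh' : h' ∈ Hn p N) : D.M N (h * h') = D.M N h * D.M N h' := by
  apply M_eq; rw [map_mul]; exact (D.loc hh).mul (D.loc hh')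

lemma M_one (N : ℕ) : D.M N 1 = 1 := by
  apply M_eq; rw [map_one]; exact LocBy.one N

lemma M_pow {N : ℕ} {h : Hec p} (hh : h ∈ Hn p N) (n : ℕ) : D.M N (h ^ n) = D.M N h ^ n := by
  induction n with
  | zero => simp [M_one]
  | succ n ih => rw [pow_succ, M_mul _ (pow_mem hh n) hh, ih, pow_succ]

lemma M_tens {a b N : ℕ} (hN : N = a + b) {h h' : Hec p} (hh : h ∈ Hn p a) (hh' : h' ∈ Hn p b) :
    D.M N (h * sh a h') = tens hN (D.M a h) (D.M b h') := by
  apply M_eq; rw [map_mul, ρ_sh]; exact (D.loc hh).tens hN (D.loc hh')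

lemma M_cat {a b N : ℕ} (hN : N = a + b) {h h' : Hec p} (hh : h ∈ Hn p a) (hh' : h' ∈ Hn p b) (u u' w w') :
    D.M N (h * sh a h') (cat hN u w) (cat hN u' w') = D.M a h u u' * D.M b h' w w' := by
  rw [M_tens D hN hh hh', tens_cat]

lemma M_catl {a b N : ℕ} (hN : N = a + b) {h : Hec p} (hh : h ∈ Hn p a) (u u' w w') :
    D.M N h (cat hN u w) (cat hN u' w') = D.M a h u u' * if w = w' then 1 else 0 := by
  have := D.M_cat hN hh (one_mem (Hn p b)) u u' w w'
  rwa [map_one, mul_one, M_one, Matrix.one_apply] at this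

lemma M_catr {a b N : ℕ} (hN : N = a + b) {h : Hec p} (hh : h ∈ Hn p b) (u u' w w') :
    D.M N (sh a h) (cat hN u w) (cat hN u' w') = (if u = u' then 1 else 0) * D.M b h w w' := by
  have := D.M_cat hN (one_mem (Hn p a)) hh u u' w w'
  rwa [one_mul, M_one, Matrix.one_apply] at this

lemma M_S0 : D.M 2 (S p 0) = fun s t => D.X (s 0) (s 1) (t 0) (t 1) := by
  apply M_eq; rw [ρ_S]
  have : Sh 0 (op0 D.X) = op0 D.X := by
    ext f s
    have := Sh_app (n := 0) (op0 D.X) f Fin.elim0 s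
    have e : ∀ s : ℕ → I, app (n := 0) Fin.elim0 s = s := fun s => by funext i; simp [app]
    simpa [e] using this
  rw [this]; exact op0_loc _

lemma ρ_eq_zero {N : ℕ} {h : Hec p} (hh : h ∈ Hn p N) (h0 : D.M N h = 0) : D.ρ h = 0 := by
  ext f s
  obtain ⟨u, e, rfl⟩ := exists_app N s
  rw [D.loc hh, h0]; simp

lemma M_eq_zero {N : ℕ} {h : Hec p} (h0 : D.ρ h = 0) : D.M N h = 0 := by
  ext s t; simp [M, h0]

lemma M_congr {N : ℕ} {h h' : Hec p} (h0 : D.ρ h = D.ρ h') : D.M N h = D.M N h' := by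
  ext s t; simp [M, h0]

/-- weights -/
def wt {N : ℕ} (s : Fin N → I) : k := ∏ i, D.g (s i)

lemma wt_ne {N : ℕ} (s : Fin N → I) : D.wt s ≠ 0 := Finset.prod_ne_zero_iff.2 fun i _ => D.g0 _

lemma wt_cat {a b N : ℕ} (h : N = a + b) (u : Fin a → I) (w : Fin b → I) : D.wt (cat h u w) = D.wt u * D.wt w := by
  subst h
  simp only [wt, Fin.prod_univ_add]
  congr 1 <;> refine Finset.prod_congr rfl fun i _ => ?_ <;> simp [cat]

lemma M_wt {N : ℕ} {h : Hec p} (hh : h ∈ Hn p N) : 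
    D.M N h * Matrix.diagonal D.wt = Matrix.diagonal D.wt * D.M N h := by
  induction hh using Algebra.adjoin_induction with
  | mem x hx =>
    obtain ⟨i, hi, rfl⟩ := hx
    have hN1 : i + 2 = i + 2 := rfl
    have hN2 : N = (i + 2) + (N - (i+2)) := by omega
    ext s t
    simp only [Matrix.mul_diagonal, Matrix.diagonal_mul]
    obtain ⟨s, w, rfl⟩ := exists_cat hN2 s
    obtain ⟨t, w', rfl⟩ := exists_cat hN2 t
    obtain ⟨u, v, rfl⟩ := exists_cat hN1 s
    obtain ⟨u', v', rfl⟩ := exists_cat hN1 t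
    rw [M_catl _ _ (S_mem (by omega))]
    have : S p i = sh i (S p 0) := by simp
    rw [this, M_catr _ _ (S_mem (by omega)), M_S0]
    simp only [wt_cat]
    split_ifs with h1 h2
    · subst h1; subst h2
      have := D.hg (v 0) (v 1) (v' 0) (v' 1)
      simp only [wt, Fin.prod_univ_two] at *
      linear_combination (∏ i, D.g (u i)) * (∏ i, D.g (w i)) * this
    all_goals simp
  | algebraMap r => rw [Algebra.algebraMap_eq_smul_one, map_smul, M_one]; simp
  | add x y _ _ hx hy => rw [map_add, add_mul, mul_add, hx, hy]
  | mul x y mx my hx hy => rw [M_mul D mx my, mul_assoc, hy, ← mul_assoc, hx, mul_assoc]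

lemma M_wt' {N : ℕ} {h : Hec p} (hh : h ∈ Hn p N) (s t) : D.M N h s t * D.wt t = D.wt s * D.M N h s t := by
  have := congrFun (congrFun (D.M_wt hh) s) t
  simpa [Matrix.mul_diagonal, Matrix.diagonal_mul] using this

def χ (N : ℕ) : Hec p →ₗ[k] k :=
  (Matrix.traceLinearMap _ k k ∘ₗ LinearMap.mulRight k (Matrix.diagonal D.wt)) ∘ₗ D.M N

lemma χ_def (N : ℕ) (h : Hec p) : D.χ N h = ∑ s, D.M N h s s * D.wt s := by
  simp [χ, Matrix.trace, Matrix.mul_diagonal]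

lemma χ_def' (N : ℕ) (h : Hec p) : D.χ N h = (D.M N h * Matrix.diagonal D.wt).trace := rfl

lemma χ_comm {N : ℕ} {h h' : Hec p} (hh : h ∈ Hn p N) (hh' : h' ∈ Hn p N) : D.χ N (h * h') = D.χ N (h' * h) := by
  rw [χ_def', χ_def', M_mul _ hh hh', M_mul _ hh' hh, mul_assoc, Matrix.trace_mul_comm, mul_assoc, mul_assoc, M_wt _ hh]

lemma χ_cat {a b N : ℕ} (hN : N = a + b) {h h' : Hec p} (hh : h ∈ Hn p a) (hh' : h' ∈ Hn p b) :
    D.χ N (h * sh a h') = D.χ a h * D.χ b h' := by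
  simp only [χ_def]
  rw [sum_cat hN, Finset.sum_mul_sum]
  refine Finset.sum_congr rfl fun u _ => Finset.sum_congr rfl fun w _ => ?_
  rw [M_cat _ _ hh hh', wt_cat]; ring

lemma χ_zero : D.χ 0 1 = 1 := by
  rw [χ_def, M_one]; simp [wt]

end Dat
end fin
end HS

namespace HS
set_option linter.unusedSectionVars false
set_option linter.unusedVariables false
set_option linter.unusedSimpArgs false
variable {k : Type} [Field k] {p : k} {I : Type} [Fintype I] [DecidableEq I] [Nonempty I]
  {J : Type} [Fintype J] [DecidableEq J] [Nonempty J]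

lemma chi_agree_aux (D1 : Dat p I) (D2 : Dat p J)
    (ht : ∀ r, D1.χ (r+1) (asc (S p) 0 r) = D2.χ (r+1) (asc (S p) 0 r)) (N : ℕ) :
    ∀ j L, L = N + 1 + j → ∀ h ∈ Hn p (N+1), D1.χ L (h * asc (S p) N j) = D2.χ L (h * asc (S p) N j) := by
  induction N with
  | zero =>
    intro j L hL h hh
    obtain ⟨c, rfl⟩ := Hn_le_one (by omega) hh
    obtain rfl : L = j + 1 := by omega
    simp [ht j]
  | succ N ih =>
    intro j L hL h hh
    refine Hn_ind (P := fun h => D1.χ L (h * asc (S p) (N+1) j) = D2.χ L (h * asc (S p) (N+1) j)) (N+1) ?_ ?_ ?_ hh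
    · intro x y hx hy
      rw [add_mul, map_add, map_add, hx, hy]
    · intro x hx
      have e : asc (S p) (N+1) j = sh (N+1) (asc (S p) 0 j) := by rw [sh_ascS, zero_add]
      have hm : asc (S p) 0 j ∈ Hn p (j+1) := ascS_mem (by omega)
      have h2 := ih 0 (N+1) (by omega) x hx
      simp only [asc, mul_one] at h2
      rw [e, D1.χ_cat (by omega : L = (N+1) + (j+1)) hx hm, D2.χ_cat (by omega : L = (N+1) + (j+1)) hx hm, ht, h2]
    · intro n hn x hx y hy
      obtain rfl : n = N := by omega
      have e : asc (S p) (n+1) j = sh (n+1) (asc (S p) 0 j) := by rw [sh_ascS, zero_add]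
      have e2 : x * S p n * y * asc (S p) (n+1) j = (x * asc (S p) n (j+1)) * y := by
        have := (comm_sh (le_refl (n+1)) hy (asc (S p) 0 j)).eq
        rw [asc_succ', e, mul_assoc, this]; simp only [mul_assoc]
      have hxL : x ∈ Hn p L := Hn_mono (by omega) hx
      have hyL : y ∈ Hn p L := Hn_mono (by omega) hy
      have ha : asc (S p) n (j+1) ∈ Hn p L := ascS_mem (by omega)
      rw [e2, D1.χ_comm (mul_mem hxL ha) hyL, D2.χ_comm (mul_mem hxL ha) hyL, ← mul_assoc]
      exact ih (j+1) L (by omega) _ (mul_mem hy hx)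

lemma chi_agree (D1 : Dat p I) (D2 : Dat p J)
    (ht : ∀ r, D1.χ (r+1) (asc (S p) 0 r) = D2.χ (r+1) (asc (S p) 0 r)) (N : ℕ) (h : Hec p) (hh : h ∈ Hn p N) :
    D1.χ N h = D2.χ N h := by
  cases N with
  | zero => 
    obtain ⟨c, rfl⟩ := Hn_le_one (by omega) hh
    simp [Dat.χ_zero]
  | succ N =>
    have := chi_agree_aux D1 D2 ht N 0 (N+1) (by omega) h hh
    simpa [asc] using this
end HS

namespace HS
set_option linter.unusedSectionVars false
set_option linter.unusedVariables false
set_option linter.unusedSimpArgs false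
variable {k : Type} [Field k] {p : k} {I : Type} [Fintype I] [DecidableEq I] [Nonempty I]
  {J : Type} [Fintype J] [DecidableEq J] [Nonempty J]

def CC (C : I → I → k) {r : ℕ} (y x : Fin r → I) : k := ∏ i, C (y i) (x i)

lemma CC_cat (C : I → I → k) {a b N : ℕ} (h : N = a + b) (u u' : Fin a → I) (w w' : Fin b → I) :
    CC C (cat h u w) (cat h u' w') = CC C u u' * CC C w w' := by
  subst h
  simp only [CC, Fin.prod_univ_add]
  congr 1 <;> refine Finset.prod_congr rfl fun i _ => ?_ <;> simp [cat]

def ptr (C : I → I → k) {n r N : ℕ} (h : N = n + r) :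
    Matrix (Fin N → I) (Fin N → I) k →ₗ[k] Matrix (Fin n → I) (Fin n → I) k where
  toFun Z := Matrix.of fun s t => ∑ x, ∑ y, Z (cat h s x) (cat h t y) * CC C y x
  map_add' Z W := by ext s t; simp [add_mul, Finset.sum_add_distrib]
  map_smul' c Z := by ext s t; simp [Finset.mul_sum, mul_assoc]

lemma ptr_apply (C : I → I → k) {n r N : ℕ} (h : N = n + r) (Z) (s t) :
    ptr C h Z s t = ∑ x, ∑ y, Z (cat h s x) (cat h t y) * CC C y x := rfl

lemma ptr_ptr (C : I → I → k) {n a b m r N : ℕ} (h1 : m = n + a) (h2 : N = m + b) (h3 : r = a + b) (h4 : N = n + r) (Z) :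
    ptr C h1 (ptr C h2 Z) = ptr C h4 Z := by
  ext s t
  simp only [ptr_apply]
  rw [sum_cat h3]
  refine Finset.sum_congr rfl fun x _ => ?_
  simp only [sum_cat h3, Finset.sum_mul]
  rw [Finset.sum_comm]
  refine Finset.sum_congr rfl fun x' _ => Finset.sum_congr rfl fun y _ => Finset.sum_congr rfl fun y' _ => ?_
  rw [cat_assoc h1 h2 h3 h4, cat_assoc h1 h2 h3 h4, CC_cat]; ring

lemma cat_zero {n : ℕ} (u : Fin n → I) (w : Fin 0 → I) : cat (a := n) (b := 0) (N := n) rfl u w = u := by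
  funext i; simp [cat]

lemma ptr_zero (C : I → I → k) {n : ℕ} (Z) : ptr C (n := n) (r := 0) (N := n) rfl Z = Z := by
  ext s t
  simp [ptr_apply, cat_zero, CC]

namespace Dat
variable (D : Dat p I)

lemma ptr_left (C : I → I → k) {n r N : ℕ} (h : N = n + r) {x : Hec p} (hx : x ∈ Hn p n) (Z) :
    ptr C h (D.M N x * Z) = D.M n x * ptr C h Z := by
  ext s t
  simp only [ptr_apply, Matrix.mul_apply]
  simp only [sum_cat h, D.M_catl h hx, mul_ite, mul_one, mul_zero, ite_mul, zero_mul, Finset.sum_ite_eq,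
    Finset.mem_univ, if_true, Finset.sum_mul, Finset.mul_sum]
  rw [Finset.sum_comm' (t' := Finset.univ) (s' := fun _ => Finset.univ) (by simp)]
  simp only [mul_assoc]
  rw [Finset.sum_comm]
  rw [Finset.sum_comm]
  conv_rhs => rw [Finset.sum_comm]
  rw [Finset.sum_comm]
  refine Finset.sum_congr rfl fun a _ => ?_
  rw [Finset.sum_comm]

lemma ptr_right (C : I → I → k) {n r N : ℕ} (h : N = n + r) {x : Hec p} (hx : x ∈ Hn p n) (Z) :
    ptr C h (Z * D.M N x) = ptr C h Z * D.M n x := by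
  ext s t
  simp only [ptr_apply, Matrix.mul_apply]
  simp only [sum_cat h, D.M_catl h hx, mul_ite, mul_one, mul_zero, ite_mul, zero_mul, Finset.sum_ite_eq', Finset.sum_ite_eq,
    Finset.mem_univ, if_true, Finset.sum_mul, Finset.mul_sum]
  conv_rhs => rw [Finset.sum_comm]
  refine Finset.sum_congr rfl fun a _ => ?_
  rw [Finset.sum_comm]
  refine Finset.sum_congr rfl fun a _ => Finset.sum_congr rfl fun b _ => ?_
  ring

lemma ptr_low (C : I → I → k) {n N : ℕ} (h : N = n + 1) {x : Hec p} (hx : x ∈ Hn p n) :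
    ptr C h (D.M N x) = (∑ a, C a a) • D.M n x := by
  ext s t
  simp only [ptr_apply, D.M_catl h hx, mul_ite, mul_one, mul_zero, ite_mul, zero_mul, Finset.sum_ite_eq,
    Finset.mem_univ, if_true, ← Finset.mul_sum, Matrix.smul_apply, smul_eq_mul, CC]
  rw [mul_comm]; congr 1
  rw [← (Equiv.funUnique (Fin 1) I).symm.sum_comp]; simp

structure Mk (D : Dat p I) (C : I → I → k) (τ κ : k) : Prop where
  tr : ∑ a, C a a = τ
  mkv : ∀ c d, ∑ a, ∑ b, D.X c a d b * C b a = if c = d then κ else 0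

variable {D} {C : I → I → k} {τ κ : k}

lemma Mk.low (h : Mk D C τ κ) {n N : ℕ} (hN : N = n + 1) {x : Hec p} (hx : x ∈ Hn p n) :
    ptr C hN (D.M N x) = τ • D.M n x := by rw [D.ptr_low C hN hx, h.tr]

lemma Mk.S1 (h : Mk D C τ κ) {n N : ℕ} (hN : N = (n + 1) + 1) : ptr C hN (D.M N (S p n)) = κ • 1 := by
  have h1 : n + 1 = n + 1 := rfl
  have h2 : (2:ℕ) = 1 + 1 := rfl
  have h3 : N = n + 2 := by omega
  ext s t
  obtain ⟨u, c, rfl⟩ := exists_cat h1 s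
  obtain ⟨u', d, rfl⟩ := exists_cat h1 t
  have e : S p n = sh n (S p 0) := by simp
  simp only [ptr_apply, cat_assoc h1 hN h2 h3]
  rw [e]
  simp only [D.M_catr h3 (S_mem (by omega : 0 + 1 < 2)), M_S0]
  rw [← (Equiv.funUnique (Fin 1) I).symm.sum_comp]
  simp only [← (Equiv.funUnique (Fin 1) I).symm.sum_comp]
  have := h.mkv (c 0) (d 0)
  simp only [CC, mul_assoc, ← Finset.mul_sum]
  simp only [Matrix.smul_apply, Matrix.one_apply, cat_inj, smul_eq_mul]
  have e3 : (c = d) ↔ c 0 = d 0 := by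
    constructor
    · rintro rfl; rfl
    · intro h; funext i; rwa [Subsingleton.elim i 0]
  simp only [e3]
  simp [cat] at this ⊢
  rw [this]
  split_ifs <;> simp_all

lemma Mk.S (h : Mk D C τ κ) {n N : ℕ} (hN : N = (n + 1) + 1) {x y : Hec p} (hx : x ∈ Hn p (n+1)) (hy : y ∈ Hn p (n+1)) :
    ptr C hN (D.M N (x * HS.S p n * y)) = κ • D.M (n+1) (x * y) := by
  have hx' : x ∈ Hn p N := Hn_mono (by omega) hx
  have hy' : y ∈ Hn p N := Hn_mono (by omega) hy
  have hS : HS.S p n ∈ Hn p N := S_mem (by omega)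
  rw [D.M_mul (mul_mem hx' hS) hy', D.M_mul hx' hS, ptr_right _ _ _ hy, ptr_left _ _ _ hx, h.S1, D.M_mul hx hy]
  simp

lemma Mk.T (hp : p ≠ 0) (h : Mk D C τ (p + (p-1) * τ)) {n N : ℕ} (hN : N = (n + 1) + 1) {x y : Hec p} (hx : x ∈ Hn p (n+1)) (hy : y ∈ Hn p (n+1)) :
    ptr C hN (D.M N (x * HS.T p n * y)) = D.M (n+1) (x * y) := by
  have e : x * HS.T p n * y = p⁻¹ • (x * HS.S p n * y - (p - 1) • (x * y)) := by
    simp [HS.T, mul_sub, sub_mul]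
  rw [e, map_smul, map_smul, map_sub, map_sub, map_smul, map_smul, h.S hN hx hy, h.low hN (mul_mem hx hy), smul_smul, ← sub_smul, smul_smul]
  have : p⁻¹ * (p + (p - 1) * τ - (p - 1) * τ) = 1 := by field_simp; ring
  rw [this, one_smul]

lemma Mk.T' (hp : p ≠ 0) (h : Mk D C τ (p + (p-1) * τ)) {n L N : ℕ} (hL : L = n + 1) (hN : N = L + 1) {x y : Hec p} (hx : x ∈ Hn p L) (hy : y ∈ Hn p L) :
    ptr C hN (D.M N (x * HS.T p n * y)) = D.M L (x * y) := by
  subst hL; exact h.T hp hN hx hy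

lemma Mk.red1 {D2 : Dat p J} {C2 : J → J → k} (h : Mk D C τ κ) (h2 : Mk D2 C2 τ κ) {n N : ℕ} (hN : N = n + 1)
    {x : Hec p} (hx : x ∈ Hn p N) : ∃ y ∈ Hn p n, ptr C hN (D.M N x) = D.M n y ∧ ptr C2 hN (D2.M N x) = D2.M n y := by
  subst hN
  refine Hn_ind (P := fun x => ∃ y ∈ Hn p n, ptr C rfl (D.M (n+1) x) = D.M n y ∧ ptr C2 rfl (D2.M (n+1) x) = D2.M n y) n ?_ ?_ ?_ hx
  · rintro x x' ⟨y, hy, e1, e2⟩ ⟨y', hy', e1', e2'⟩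
    exact ⟨y + y', add_mem hy hy', by simp only [map_add, *], by simp only [map_add, *]⟩
  · intro x hx
    exact ⟨τ • x, Subalgebra.smul_mem _ hx _, by rw [h.low rfl hx, map_smul], by rw [h2.low rfl hx, map_smul]⟩
  · rintro m rfl x hx y hy
    exact ⟨κ • (x * y), Subalgebra.smul_mem _ (mul_mem hx hy) _, by rw [h.S rfl hx hy, map_smul], by rw [h2.S rfl hx hy, map_smul]⟩

lemma Mk.red {D2 : Dat p J} {C2 : J → J → k} (h : Mk D C τ κ) (h2 : Mk D2 C2 τ κ) (r : ℕ) : ∀ {n N : ℕ} (hN : N = n + r)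
    {x : Hec p} (hx : x ∈ Hn p N), ∃ y ∈ Hn p n, ptr C hN (D.M N x) = D.M n y ∧ ptr C2 hN (D2.M N x) = D2.M n y := by
  induction r with
  | zero => 
    intro n N hN x hx
    obtain rfl : N = n := hN
    exact ⟨x, hx, ptr_zero _ _, ptr_zero _ _⟩
  | succ r ih =>
    rintro n N rfl x hx
    obtain ⟨y, hy, e1, e2⟩ := h.red1 h2 (by omega : n + (r+1) = (n + r) + 1) hx
    obtain ⟨z, hz, e3, e4⟩ := ih rfl hy
    refine ⟨z, hz, ?_, ?_⟩
    · rw [← e3, ← e1, ptr_ptr C (rfl : n + r = n + r) (by omega) rfl]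
    · rw [← e4, ← e2, ptr_ptr C2 (rfl : n + r = n + r) (by omega) rfl]

def ψ (D : Dat p I) (C : I → I → k) {n r N : ℕ} (hN : N = n + r) (h : Hec p) : k :=
  ∑ w, D.wt w * ptr C hN (D.M N h) w w

lemma ψ_agree {D2 : Dat p J} {C2 : J → J → k} (h : Mk D C τ κ) (h2 : Mk D2 C2 τ κ) 
    (hχ : ∀ N, ∀ h ∈ Hn p N, D.χ N h = D2.χ N h) {n r N : ℕ} (hN : N = n + r) {x : Hec p} (hx : x ∈ Hn p N) :
    ψ D C hN x = ψ D2 C2 hN x := by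
  obtain ⟨y, hy, e1, e2⟩ := h.red h2 r hN hx
  have := hχ n y hy
  rw [χ_def, χ_def] at this
  simpa only [ψ, e1, e2, mul_comm] using this

lemma Mk.omega_aux (hp : p ≠ 0) (h : Mk D C τ (p + (p-1) * τ)) (r n j : ℕ) : ∀ {N : ℕ} (hN : N = (n + (r + 1)) + j) (x y : Hec p) (hx : x ∈ Hn p (n + (r+1)))
    (hy : y ∈ Hn p (r+1)), ptr C hN (D.M N (x * bt p (r+1) (n + j) * y)) = D.M (n+(r+1)) (x * bt p (r+1) n * (asc (HS.T p) 0 r ^ j * y)) := by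
  induction j with
  | zero => 
    rintro N rfl x y hx hy
    simp [ptr_zero]
  | succ j ih =>
    rintro N rfl x y hx hy
    have hA : asc (HS.T p) 0 r ∈ Hn p (r+1) := ascT_mem (by omega)
    have e : x * bt p (r+1) (n + (j+1)) * y = (x * sh (n+j) (asc (HS.T p) 0 r)) * HS.T p (n + j + r) * (bt p (r+1) (n+j) * y) := by
      rw [← add_assoc, bt, asc, sh_ascT, zero_add]; simp only [mul_assoc]
    rw [← ptr_ptr C (rfl : n + (r+1) + j = n + (r+1) + j) (by omega : n + (r+1) + (j+1) = (n + (r + 1) + j) + 1) rfl, e]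
    have hm : n + (r+1) + j = (n + j + r) + 1 := by omega
    have key2 := h.T' hp hm (by omega : n + (r+1) + (j+1) = (n + (r + 1) + j) + 1)
      (x := x * sh (n+j) (asc (HS.T p) 0 r)) (y := bt p (r+1) (n+j) * y) 
      (mul_mem (Hn_mono (by omega) hx) (sh_mem hA (by omega)))
      (mul_mem (bt_mem (by omega)) (Hn_mono (by omega) hy))
    rw [key2]
    have e2 : x * sh (n+j) (asc (HS.T p) 0 r) * (bt p (r+1) (n+j) * y) = x * bt p (r+1) (n+j) * (asc (HS.T p) 0 r * y) := by
      rw [mul_assoc, ← mul_assoc (sh _ _), bt_comm' hp (r+1) (n+j) hA]; simp only [mul_assoc]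
    rw [e2, ih rfl _ _ hx (mul_mem hA hy), pow_succ]
    simp only [mul_assoc]

end Dat
end HS

namespace HS
set_option linter.unusedSectionVars false
set_option linter.unusedVariables false
set_option linter.unusedSimpArgs false
variable {k : Type} [Field k] {p : k} {I : Type} [Fintype I] [DecidableEq I] [Nonempty I]
  {J : Type} [Fintype J] [DecidableEq J] [Nonempty J]

namespace Dat
variable (D : Dat p I)

def B (r N : ℕ) (s : Fin N → I) (x u : Fin r → I) (t : Fin N → I) : k :=
  D.M (N + r) (bt p r N) (cat rfl s x) (cat (add_comm N r) u t)

def InjB (r N : ℕ) : Prop := ∀ f : (Fin N → I) → (Fin r → I) → k,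
  (∀ s u, ∑ t, ∑ x, D.B r N s x u t * f t x = 0) → f = 0

lemma B_N (r N : ℕ) (s1 t1 : Fin N → I) (s2 t2 : Fin 1 → I) (x u : Fin r → I) :
    D.B r (N+1) (cat rfl s1 s2) x u (cat rfl t1 t2) = ∑ v, D.B r N s1 v u t1 * D.B r 1 s2 x v t2 := by
  have h1 : N + 1 + r = N + (1 + r) := by ring
  have h2 : N + 1 + r = (N + r) + 1 := by ring
  have h3 : 1 + r = r + 1 := by ring
  have h4 : N + r = r + N := by ring
  simp only [B]
  rw [bt_add, D.M_mul (sh_mem (bt_mem (M := 1 + r) (by omega)) (by omega)) (bt_mem (by omega)), Matrix.mul_apply, sum_cat h1]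
  rw [cat_assoc rfl rfl rfl h1, ← cat_assoc h4 h2 rfl]
  simp only [D.M_catr h1 (bt_mem (M := 1 + r) (le_refl _)), sum_cat h3]
  simp only [← cat_assoc (rfl : N + r = N + r) h2 h3 h1, D.M_catl h2 (bt_mem (M := N + r) (le_refl _))]
  simp only [mul_ite, mul_one, mul_zero, ite_mul, zero_mul, one_mul, Finset.sum_ite_eq', Finset.sum_ite_eq,
    Finset.mem_univ, if_true, Finset.sum_ite_irrel, Finset.sum_const_zero]
  exact Finset.sum_congr rfl fun v _ => mul_comm _ _

lemma B_r (r N : ℕ) (s t : Fin N → I) (x1 u1 : Fin 1 → I) (x2 u2 : Fin r → I) :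
    D.B (r+1) N s (cat (add_comm r 1) x1 x2) (cat (add_comm r 1) u1 u2) t = ∑ s', D.B 1 N s x1 u1 s' * D.B r N s' x2 u2 t := by
  have h1 : N + (r + 1) = (N + 1) + r := by ring
  have h2 : N + (r + 1) = 1 + (N + r) := by ring
  have h3 : r + 1 = 1 + r := by ring
  have h4 : N + 1 = 1 + N := by ring
  simp only [B]
  rw [bt_succ_left, D.M_mul (bt_mem (by omega)) (sh_mem (bt_mem (M := N + r) (by omega)) (by omega)), Matrix.mul_apply, sum_cat h1]
  rw [← cat_assoc (rfl : N + 1 = N + 1) h1 h3 rfl, cat_assoc h3 (by omega) (by omega : N + r = r + N) h2]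
  simp only [D.M_catl h1 (bt_mem (M := N + 1) (le_refl _)), sum_cat h4]
  simp only [cat_assoc h4 h1 (rfl : N + r = N + r) h2, D.M_catr h2 (bt_mem (M := N + r) (le_refl _))]
  simp only [mul_ite, mul_one, mul_zero, ite_mul, zero_mul, one_mul, Finset.sum_ite_eq', Finset.sum_ite_eq,
    Finset.mem_univ, if_true, Finset.sum_ite_irrel, Finset.sum_const_zero]

lemma InjB_zeroN (r : ℕ) : D.InjB r 0 := by
  intro f hf
  funext t u
  have := hf t u
  simp only [B, bt, M_one, Matrix.one_apply] at this
  have e : ∀ (t t' : Fin 0 → I) (x u : Fin r → I), (cat (rfl : 0 + r = 0 + r) t x = cat (add_comm 0 r) u t') ↔ x = u := by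
    intro t t' x u
    have : cat (add_comm 0 r) u t' = cat rfl t u := by
      funext i; simp [cat]; 
      have := i.2
      split_ifs
      · rfl
      · omega
    rw [this, cat_inj]; simp [Subsingleton.elim t t']
  simp only [e] at this
  simpa [Subsingleton.elim default t] using this

lemma InjB_zeror (N : ℕ) : D.InjB 0 N := by
  intro f hf
  funext t u
  have := hf t u
  have hb : bt p 0 N = 1 := by 
    clear this hf f t u
    induction N with
    | zero => rfl
    | succ N ih => simp [bt, asc, ih]
  simp only [B, hb, M_one, Matrix.one_apply] at this
  have e : ∀ (t t' : Fin N → I) (x u : Fin 0 → I), (cat (rfl : N + 0 = N + 0) t x = cat (add_comm N 0) u t') ↔ t = t' := by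
    intro t t' x u
    have : cat (add_comm N 0) u t' = cat rfl t' u := by
      funext i; simp [cat]
    rw [this, cat_inj]; simp [Subsingleton.elim x u]
  simp only [e] at this
  simpa [Subsingleton.elim default u] using this

lemma InjB_N (r N : ℕ) (h1 : D.InjB r 1) (hN : D.InjB r N) : D.InjB r (N+1) := by
  intro f hf
  have key : ∀ s2 : Fin 1 → I, (fun (t1 : Fin N → I) v => ∑ t2, ∑ x, D.B r 1 s2 x v t2 * f (cat rfl t1 t2) x) = 0 := by
    intro s2
    apply hN
    intro s1 u
    rw [← hf (cat rfl s1 s2) u, sum_cat (rfl : N + 1 = N + 1)]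
    refine Finset.sum_congr rfl fun t1 _ => ?_
    simp only [B_N, Finset.mul_sum, Finset.sum_mul]
    rw [Finset.sum_comm]
    refine Finset.sum_congr rfl fun t2 _ => ?_
    rw [Finset.sum_comm]
    simp only [mul_assoc]
  funext t x
  obtain ⟨t1, t2, rfl⟩ := exists_cat (rfl : N + 1 = N + 1) t
  have := h1 (fun t2 x => f (cat rfl t1 t2) x) (fun s2 v => congrFun (congrFun (key s2) t1) v)
  exact congrFun (congrFun this t2) x

lemma InjB_r (r N : ℕ) (h1 : D.InjB 1 N) (hr : D.InjB r N) : D.InjB (r+1) N := by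
  intro f hf
  have key : ∀ u2 : Fin r → I, (fun (s' : Fin N → I) (x1 : Fin 1 → I) => ∑ t, ∑ x2, D.B r N s' x2 u2 t * f t (cat (add_comm r 1) x1 x2)) = 0 := by
    intro u2
    apply h1
    intro s u1
    rw [← hf s (cat (add_comm r 1) u1 u2)]
    simp only [sum_cat (add_comm r 1), B_r, Finset.mul_sum, Finset.sum_mul]
    rw [Finset.sum_comm]
    simp only [← mul_assoc]
    conv_rhs => rw [Finset.sum_comm]
    refine Finset.sum_congr rfl fun x1 _ => ?_
    rw [Finset.sum_comm]
    refine Finset.sum_congr rfl fun t _ => ?_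
    rw [Finset.sum_comm]
  funext t x
  obtain ⟨x1, x2, rfl⟩ := exists_cat (add_comm r 1) x
  have := hr (fun t x2 => f t (cat (add_comm r 1) x1 x2)) (fun s u2 => congrFun (congrFun (key u2) s) x1)
  exact congrFun (congrFun this t) x2

lemma InjB_all (h : D.InjB 1 1) (r N : ℕ) : D.InjB r N := by
  have h1 : ∀ N, D.InjB 1 N := fun N => by
    induction N with
    | zero => exact D.InjB_zeroN 1
    | succ N ih => exact D.InjB_N 1 N h ih
  induction r with
  | zero => exact D.InjB_zeror N
  | succ r ih => exact D.InjB_r r N (h1 N) ih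

def Inj : Prop := ∀ f : I → I → k, 
  (∀ s u, ∑ t, ∑ x, (D.X s x u t - (p - 1) * if s = u ∧ x = t then 1 else 0) * f t x = 0) → f = 0

lemma B11 (s x u t : Fin 1 → I) : D.B 1 1 s x u t = p⁻¹ * (D.X (s 0) (x 0) (u 0) (t 0) - (p - 1) * if s 0 = u 0 ∧ x 0 = t 0 then 1 else 0) := by
  have e : bt p 1 1 = HS.T p 0 := by simp [bt, asc]
  have e1 : ∀ c d : Fin 1 → I, c = d ↔ c 0 = d 0 := by
    intro c d
    constructor
    · rintro rfl; rfl
    · intro h; funext i; rwa [Subsingleton.elim i 0]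
  have hS : D.M (1 + 1) (HS.S p 0) = Matrix.of fun s t => D.X (s 0) (s 1) (t 0) (t 1) := D.M_S0
  simp only [B, e, HS.T, map_smul, map_sub, M_one, Matrix.smul_apply, Matrix.sub_apply, hS, Matrix.of_apply, Matrix.one_apply, cat_inj, e1]
  simp [cat]

lemma Inj.injB (hp : p ≠ 0) (h : D.Inj) : D.InjB 1 1 := by
  intro f hf
  have := h (fun t x => f (fun _ => t) (fun _ => x)) (fun s u => by
    have := hf (fun _ => s) (fun _ => u)
    simp only [B11] at this
    rw [← (Equiv.funUnique (Fin 1) I).symm.sum_comp] at this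
    simp only [← (Equiv.funUnique (Fin 1) I).symm.sum_comp] at this
    simp only [mul_assoc, ← Finset.mul_sum] at this
    have := (mul_eq_zero.1 this).resolve_left (inv_ne_zero hp)
    exact this)
  funext t x
  have := congrFun (congrFun this (t 0)) (x 0)
  have e : ∀ t : Fin 1 → I, t = fun _ => t 0 := fun t => by funext i; rw [Subsingleton.elim i 0]
  rw [e t, e x]; exact this

lemma Inj.exists_C (hp : p ≠ 0) (h : D.Inj) : ∃ C : I → I → k, D.Mk C (∑ a, C a a) (p + (p - 1) * ∑ a, C a a) := by
  let F : (I → I → k) →ₗ[k] (I → I → k) :=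
    { toFun := fun f s u => ∑ t, ∑ x, (D.X s x u t - (p - 1) * if s = u ∧ x = t then 1 else 0) * f t x
      map_add' := fun f g => by funext s u; simp [mul_add, Finset.sum_add_distrib]
      map_smul' := fun c f => by funext s u; simp only [Pi.smul_apply, smul_eq_mul, RingHom.id_apply, Finset.mul_sum, mul_left_comm] }
  have hF : Function.Injective F := by
    rw [injective_iff_map_eq_zero]
    intro f hf
    exact h f fun s u => congrFun (congrFun hf s) u
  obtain ⟨C, hC⟩ := LinearMap.injective_iff_surjective.1 hF (fun s u => if s = u then p else 0)
  refine ⟨C, rfl, fun c d => ?_⟩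
  have h1 : ∑ t, ∑ x, (D.X c x d t - (p - 1) * if c = d ∧ x = t then 1 else 0) * C t x = if c = d then p else 0 :=
    congrFun (congrFun hC c) d
  simp only [sub_mul, Finset.sum_sub_distrib, sub_eq_iff_eq_add] at h1
  rw [Finset.sum_comm, h1]
  by_cases hcd : c = d
  · simp [hcd, mul_assoc, ← Finset.mul_sum]; ring
  · simp [hcd]
end Dat
end HS

namespace HS
set_option linter.unusedSectionVars false
set_option linter.unusedVariables false
set_option linter.unusedSimpArgs false
variable {k : Type} [Field k] {p : k} {I : Type} [Fintype I] [DecidableEq I] [Nonempty I]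
  {J : Type} [Fintype J] [DecidableEq J] [Nonempty J]

lemma ascT_inv (hp : p ≠ 0) (n r N : ℕ) (h : n + r < N) : ∃ y ∈ Hn p N, y * asc (T p) n r = 1 := by
  induction r with
  | zero => exact ⟨1, one_mem _, by simp [asc]⟩
  | succ r ih =>
    obtain ⟨y, hy, e⟩ := ih (by omega)
    refine ⟨S p (n + r) * y, mul_mem (S_mem (by omega)) hy, ?_⟩
    rw [asc, mul_assoc, ← mul_assoc y, e, one_mul, S_T hp]

lemma bt_inv (hp : p ≠ 0) (r n N : ℕ) (h : n + r ≤ N) : ∃ y ∈ Hn p N, y * bt p r n = 1 := by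
  induction n with
  | zero => exact ⟨1, one_mem _, by simp [bt]⟩
  | succ n ih =>
    obtain ⟨y, hy, e⟩ := ih (by omega)
    obtain ⟨z, hz, e2⟩ := ascT_inv hp n r N (by omega)
    refine ⟨y * z, mul_mem hy hz, ?_⟩
    rw [bt, mul_assoc, ← mul_assoc z, e2, one_mul, e]

lemma omega_inv (hp : p ≠ 0) (r n : ℕ) : ∃ y ∈ Hn p (n + (r+1)), y * (bt p (r+1) n * asc (T p) 0 r ^ (r+1)) = 1 := by
  obtain ⟨y, hy, e⟩ := bt_inv hp (r+1) n (n+(r+1)) (by omega)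
  obtain ⟨z, hz, e2⟩ := ascT_inv hp 0 r (n+(r+1)) (by omega)
  refine ⟨z ^ (r+1) * y, mul_mem (pow_mem hz _) hy, ?_⟩
  rw [mul_assoc, ← mul_assoc y, e, one_mul]
  have : ∀ m, z ^ m * asc (T p) 0 r ^ m = 1 := fun m => by
    induction m with
    | zero => simp
    | succ m ih => rw [pow_succ, pow_succ', mul_assoc, ← mul_assoc z, e2, one_mul, ih]
  exact this _

namespace Dat
variable (D : Dat p I)

lemma M_bt_sh {r N : ℕ} {h : Hec p} (hh : h ∈ Hn p N) (s x u t) :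
    D.M (N + r) (bt p r N * sh r h) (cat rfl s x) (cat (add_comm N r) u t) = ∑ t', D.B r N s x u t' * D.M N h t' t := by
  rw [D.M_mul (bt_mem (le_refl _)) (sh_mem hh (le_refl _)), Matrix.mul_apply, sum_cat (add_comm N r)]
  simp only [D.M_catr (add_comm N r) hh]
  simp only [mul_ite, mul_one, mul_zero, ite_mul, zero_mul, one_mul, Finset.sum_ite_eq', Finset.sum_ite_eq,
    Finset.mem_univ, if_true, Finset.sum_ite_irrel, Finset.sum_const_zero]
  rfl

lemma M_nc {n r N : ℕ} (hN : N = n + r) (hN' : N = r + n) {b c : Hec p} (hb : b ∈ Hn p N) (hc : c ∈ Hn p N) (s x u t) :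
    D.M (N + r) (b * sh r c) (cat rfl s x) (cat (add_comm N r) u t) = 
      ∑ w, D.M N b s (cat hN' u w) * D.M N c (cat hN w x) t := by
  rw [D.M_mul (Hn_mono (by omega) hb) (sh_mem hc (le_refl _)), Matrix.mul_apply, sum_cat (rfl : N + r = N + r)]
  simp only [D.M_catl rfl hb, sum_cat hN']
  simp only [cat_assoc hN' (rfl : N + r = N + r) hN (add_comm N r), D.M_catr (add_comm N r) hc]
  simp only [mul_ite, mul_one, mul_zero, ite_mul, zero_mul, one_mul, Finset.sum_ite_eq', Finset.sum_ite_eq,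
    Finset.mem_univ, if_true, Finset.sum_ite_irrel, Finset.sum_const_zero]

variable {D} {C : I → I → k} {τ : k}

lemma key_b (hp : p ≠ 0) (h : Mk D C τ (p + (p-1) * τ)) {n r N : ℕ} (hN : N = n + (r+1)) (hN' : N = (r+1) + n)
    {ω b : Hec p} (hω : ω ∈ Hn p N) (hω1 : ω * (bt p (r+1) n * asc (HS.T p) 0 r ^ (r+1)) = 1) (hb : b ∈ Hn p N) (s u w) :
    ∑ s', ∑ x', D.B (r+1) N s x' u s' * ∑ y, D.M N (b * ω) s' (cat hN w y) * CC C y x' = D.M N b s (cat hN' u w) := by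
  subst hN
  have h1 := h.omega_aux hp r n (r+1) rfl (b * ω) 1 (mul_mem hb hω) (one_mem _)
  have e : b * ω * bt p (r+1) n * asc (HS.T p) 0 r ^ (r+1) = b := by
    rw [mul_assoc (b * ω), mul_assoc b ω, hω1, mul_one]
  rw [mul_one, mul_one, e, bt_comm hp _ _ (mul_mem hb hω)] at h1
  rw [← h1, ptr_apply, Finset.sum_comm]
  refine Finset.sum_congr rfl fun x' _ => ?_
  simp only [cat_assoc hN' rfl rfl (add_comm (n + (r+1)) (r+1)), M_bt_sh D (mul_mem hb hω), Finset.sum_mul, Finset.mul_sum]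
  rw [Finset.sum_comm]
  simp only [mul_assoc]

lemma star (hp : p ≠ 0) (h : Mk D C τ (p + (p-1) * τ)) (hI : D.InjB 1 1) {n r N : ℕ} (hN : N = n + (r+1))
    {ω a : Hec p} (hω : ω ∈ Hn p N) (hω1 : ω * (bt p (r+1) n * asc (HS.T p) 0 r ^ (r+1)) = 1) (ha : a ∈ Hn p N)
    {m : ℕ} (b c : Fin m → Hec p) (hb : ∀ j, b j ∈ Hn p N) (hc : ∀ j, c j ∈ Hn p N)
    (he : D.ρ (a * bt p (r+1) N) = D.ρ (∑ j, b j * sh (r+1) (c j))) (s' t : Fin N → I) (x' x : Fin (r+1) → I) :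
    D.M N a s' t * (if x' = x then 1 else 0) = ∑ j, ∑ w, ∑ y, D.M N (b j * ω) s' (cat hN w y) * CC C y x' * D.M N (c j) (cat hN w x) t := by
  have hN' : N = (r+1) + n := by omega
  have := D.InjB_all hI (r+1) N (fun s' x' => D.M N a s' t * (if x' = x then 1 else 0) - ∑ j, ∑ w, ∑ y, D.M N (b j * ω) s' (cat hN w y) * CC C y x' * D.M N (c j) (cat hN w x) t) ?_
  · exact sub_eq_zero.1 (congrFun (congrFun this s') x')
  intro s u
  simp only [mul_sub, Finset.sum_sub_distrib]
  rw [sub_eq_zero]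
  have h1 : ∑ t', ∑ x', D.B (r+1) N s x' u t' * (D.M N a t' t * (if x' = x then 1 else 0)) = 
      D.M (N + (r+1)) (a * bt p (r+1) N) (cat rfl s x) (cat (add_comm N (r+1)) u t) := by
    rw [bt_comm hp _ _ ha, M_bt_sh D ha]; simp
  rw [h1, D.M_congr he, map_sum, Matrix.sum_apply]
  simp only [M_nc D hN hN' (hb _) (hc _), ← key_b hp h hN hN' hω hω1 (hb _), Finset.sum_mul, Finset.mul_sum]
  rw [Finset.sum_comm' (t' := Finset.univ) (s' := fun _ => Finset.univ) (by simp)]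
  conv_rhs => 
    enter [2, t']
    rw [Finset.sum_comm]
  conv_rhs => rw [Finset.sum_comm]
  rw [Finset.sum_comm]
  refine Finset.sum_congr rfl fun j _ => ?_
  conv_rhs => 
    enter [2, t']
    rw [Finset.sum_comm]
  conv_rhs => rw [Finset.sum_comm]
  refine Finset.sum_congr rfl fun w _ => Finset.sum_congr rfl fun s' _ => Finset.sum_congr rfl fun x' _ => Finset.sum_congr rfl fun y _ => ?_
  ring

lemma deep1 (hp : p ≠ 0) (h : Mk D C τ (p + (p-1) * τ)) (hI : D.InjB 1 1) {n r N : ℕ} (hN : N = n + (r+1))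
    {ω a e : Hec p} (hω : ω ∈ Hn p N) (hω1 : ω * (bt p (r+1) n * asc (HS.T p) 0 r ^ (r+1)) = 1) (ha : a ∈ Hn p N)
    {m : ℕ} (b c : Fin m → Hec p) (hb : ∀ j, b j ∈ Hn p N) (hc : ∀ j, c j ∈ Hn p N)
    (he : D.ρ (a * bt p (r+1) N) = D.ρ (∑ j, b j * sh (r+1) (c j))) (hee : e ∈ Hn p (r+1)) :
    D.χ N a * ∑ x, (D.wt x)⁻¹ * D.M (r+1) e x x = ψ D C hN (∑ j, sh n e * (c j * (b j * ω))) := by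
  have h1 : D.χ N a * ∑ x, (D.wt x)⁻¹ * D.M (r+1) e x x = 
     ∑ t, ∑ x, ∑ x', (D.M N a t t * (if x' = x then 1 else 0)) * (D.wt t * (D.wt x)⁻¹ * D.M (r+1) e x' x) := by
    rw [χ_def, Finset.sum_mul_sum]
    refine Finset.sum_congr rfl fun t _ => Finset.sum_congr rfl fun x _ => ?_
    simp; ring
  rw [h1]
  simp only [star hp h hI hN hω hω1 ha b c hb hc he]
  simp only [ψ, ptr_apply, map_sum, Matrix.sum_apply]
  have h2 : ∀ j (w : Fin n → I) x' y, D.M N (sh n e * (c j * (b j * ω))) (cat hN w x') (cat hN w y) = 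
      ∑ x, ∑ t, D.M (r+1) e x' x * (D.M N (c j) (cat hN w x) t * D.M N (b j * ω) t (cat hN w y)) := by
    intro j w x' y
    have m1 : sh n e ∈ Hn p N := sh_mem hee (by omega)
    have m2 := mul_mem (hb j) hω
    rw [D.M_mul m1 (mul_mem (hc j) m2), Matrix.mul_apply, sum_cat hN]
    simp only [D.M_catr hN hee, D.M_mul (hc j) m2, Matrix.mul_apply]
    simp only [mul_ite, mul_one, mul_zero, ite_mul, zero_mul, one_mul, Finset.sum_ite_eq', Finset.sum_ite_eq,
      Finset.mem_univ, if_true, Finset.sum_ite_irrel, Finset.sum_const_zero, Finset.mul_sum]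
  simp only [h2, Finset.mul_sum, Finset.sum_mul]
  have h3 : ∀ j (w : Fin n → I) (x : Fin (r+1) → I) t, D.M N (c j) (cat hN w x) t * D.wt t * (D.wt x)⁻¹ = D.wt w * D.M N (c j) (cat hN w x) t := by
    intro j w x t
    rw [D.M_wt' (hc j), wt_cat]
    field_simp [D.wt_ne x]
  have lhs : ∀ t x x' j w y, D.M N (b j * ω) t (cat hN w y) * CC C y x' * D.M N (c j) (cat hN w x) t *
      (D.wt t * (D.wt x)⁻¹ * D.M (r+1) e x' x) = D.wt w * (D.M (r+1) e x' x * (D.M N (c j) (cat hN w x) t * D.M N (b j * ω) t (cat hN w y)) * CC C y x') := by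
    intro t x x' j w y
    linear_combination (D.M N (b j * ω) t (cat hN w y) * CC C y x' * D.M (r+1) e x' x) * h3 j w x t
  simp only [lhs]
  let f : (Fin N → I) → (Fin (r+1) → I) → (Fin (r+1) → I) → Fin m → (Fin n → I) → (Fin (r+1) → I) → k :=
    fun t x x' j w y => D.wt w * (D.M (r+1) e x' x * (D.M N (c j) (cat hN w x) t * D.M N (b j * ω) t (cat hN w y)) * CC C y x')
  have gl : ∑ t, ∑ x, ∑ x', ∑ j, ∑ w, ∑ y, f t x x' j w y = ∑ z : (Fin N → I) × (Fin (r+1) → I) × (Fin (r+1) → I) × Fin m × (Fin n → I) × (Fin (r+1) → I), f z.1 z.2.1 z.2.2.1 z.2.2.2.1 z.2.2.2.2.1 z.2.2.2.2.2 := by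
    simp only [Fintype.sum_prod_type]
  have gr : ∑ w, ∑ x', ∑ y, ∑ j, ∑ x, ∑ t, f t x x' j w y = ∑ z : (Fin n → I) × (Fin (r+1) → I) × (Fin (r+1) → I) × Fin m × (Fin (r+1) → I) × (Fin N → I), f z.2.2.2.2.2 z.2.2.2.2.1 z.2.1 z.2.2.2.1 z.1 z.2.2.1 := by
    simp only [Fintype.sum_prod_type]
  refine gl.trans (Eq.trans ?_ gr.symm)
  refine Fintype.sum_equiv ⟨fun z => (z.2.2.2.2.1, z.2.2.1, z.2.2.2.2.2, z.2.2.2.1, z.2.1, z.1), fun z => (z.2.2.2.2.2, z.2.2.2.2.1, z.2.1, z.2.2.2.1, z.1, z.2.2.1), fun _ => rfl, fun _ => rfl⟩ _ _ fun _ => rfl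

end Dat

lemma deep2 (hp : p ≠ 0) {D : Dat p I} {D2 : Dat p J} {C : I → I → k} {C2 : J → J → k} {τ : k}
    (h : D.Mk C τ (p + (p-1) * τ)) (h2 : D2.Mk C2 τ (p + (p-1) * τ)) (hI : D.InjB 1 1) (hI2 : D2.InjB 1 1)
    (hχ : ∀ N, ∀ h ∈ Hn p N, D.χ N h = D2.χ N h) {n r N : ℕ} (hN : N = n + (r+1)) {a : Hec p}
    (hd : Deep (D.ρ.prod D2.ρ) (r+1) N a) (h0 : D.χ N a ≠ 0) {e : Hec p} (hee : e ∈ Hn p (r+1)) :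
    ∑ x, (D.wt x)⁻¹ * D.M (r+1) e x x = ∑ x, (D2.wt x)⁻¹ * D2.M (r+1) e x x := by
  obtain ⟨ha, z, hz, hz2⟩ := hd
  obtain ⟨m, f, g, rfl⟩ := Submodule.mem_span_set'.1 hz
  choose b hb c hc hbc using fun i => (g i).2
  obtain ⟨ω, hω, hω1⟩ := omega_inv hp r n
  rw [← hN] at hω
  have hz3 : ∑ i, f i • (g i : Hec p) = ∑ i, (f i • b i) * sh (r+1) (c i) := 
    Finset.sum_congr rfl fun i _ => by rw [hbc, smul_mul_assoc]
  rw [hz3] at hz2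
  have hb' : ∀ i, f i • b i ∈ Hn p N := fun i => Subalgebra.smul_mem _ (hb i) _
  have k1 := Dat.deep1 hp h hI hN hω hω1 ha _ c hb' hc (congrArg Prod.fst hz2) hee
  have k2 := Dat.deep1 hp h2 hI2 hN hω hω1 ha _ c hb' hc (congrArg Prod.snd hz2) hee
  rw [← hχ N a ha, ← Dat.ψ_agree h h2 hχ hN (sum_mem fun j _ => mul_mem (sh_mem hee (by omega)) (mul_mem (hc j) (mul_mem (hb' j) hω))), ← k1] at k2
  exact (mul_left_cancel₀ h0 k2).symm
end HS

namespace HS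
set_option linter.unusedSectionVars false
set_option linter.unusedVariables false
set_option linter.unusedSimpArgs false
section std
variable {k : Type} [Field k] {p : k} {I : Type} [LinearOrder I]

def ww (p : k) (a b : I) : k := if a < b then p else if b < a then 1 else 0
def uu (p : k) (σ : I → k) (a b : I) : k := if a < b then 0 else if b < a then p - 1 else σ a

def sw (i : ℕ) (s : ℕ → I) : ℕ → I := fun n => s (Equiv.swap i (i+1) n)

lemma sw_apply (i : ℕ) (s : ℕ → I) (n : ℕ) : sw i s n = if n = i then s (i+1) else if n = i + 1 then s i else s n := by
  simp only [sw, Equiv.swap_apply_def]; split_ifs <;> rfl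

lemma sw_sw (i : ℕ) (s : ℕ → I) : sw i (sw i s) = s := by funext n; simp [sw]

lemma sw_braid (s : ℕ → I) : sw 0 (sw 1 (sw 0 s)) = sw 1 (sw 0 (sw 1 s)) := by
  funext n
  simp only [sw_apply]
  rcases n with _ | _ | _ | n <;> simp

def stA (p : k) (σ : I → k) : Module.End k (Fn k I) where
  toFun f s := ww p (s 0) (s 1) * f (sw 0 s) + uu p σ (s 0) (s 1) * f s
  map_add' f g := by funext s; simp; ring
  map_smul' c f := by funext s; simp; ring

lemma stA_apply (σ : I → k) (f : Fn k I) (s) : stA p σ f s = ww p (s 0) (s 1) * f (sw 0 s) + uu p σ (s 0) (s 1) * f s := rfl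

lemma Sh_stA (σ : I → k) (i : ℕ) (f : Fn k I) (s) : Sh i (stA p σ) f s = ww p (s i) (s (i+1)) * f (sw i s) + uu p σ (s i) (s (i+1)) * f s := by
  rw [Sh_apply, stA_apply]
  have e1 : spl i s (sw 0 (fun n => s (n + i))) = sw i s := by
    funext n; simp only [spl, sw_apply]
    split_ifs <;> first | rfl | (exfalso; omega) | (congr 1; omega)
  have e2 : spl i s (fun n => s (n + i)) = s := by
    funext n; simp only [spl]
    split_ifs <;> first | rfl | (congr 1; omega)
  rw [e1, e2, zero_add, add_comm 1 i]

lemma stA_hk (σ : I → k) (hσ : ∀ a, σ a = p ∨ σ a = -1) : IsHk p (stA p σ) where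
  quad := by
    ext f s
    simp only [Module.End.mul_apply, LinearMap.add_apply, LinearMap.smul_apply, Pi.add_apply, Pi.smul_apply, smul_eq_mul, stA_apply, sw_sw,
      Module.End.one_apply]
    simp only [sw_apply, ww, uu]
    have := hσ (s 0)
    rcases lt_trichotomy (s 0) (s 1) with h | h | h
    · simp [h, h.not_gt]; ring
    · simp [h] at *; rcases this with h | h <;> rw [h] <;> ring
    · simp [h, h.not_gt]; ring
  braid := by
    ext f s
    simp only [Module.End.mul_apply, stA_apply, Sh_stA, sw_sw, ← sw_braid]
    simp only [sw_apply]
    simp only [zero_ne_one, one_ne_zero, zero_add, if_true, if_false, Nat.reduceAdd, OfNat.ofNat_ne_zero, OfNat.zero_ne_ofNat, OfNat.ofNat_ne_one, OfNat.one_ne_ofNat]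
    generalize f s = f1
    generalize f (sw 0 s) = f2
    generalize f (sw 1 s) = f3
    generalize f (sw 1 (sw 0 s)) = f4
    generalize f (sw 0 (sw 1 s)) = f5
    generalize f (sw 0 (sw 1 (sw 0 s))) = f6
    generalize s 0 = a
    generalize s 1 = b
    generalize s 2 = c
    simp only [ww, uu]
    have key : ∀ a, σ a * σ a = (p - 1) * σ a + p := fun a => by rcases hσ a with h | h <;> rw [h] <;> ring
    have ha := key a
    have hb := key b
    have hc := key c
    rcases lt_trichotomy a b with h | h | h <;> rcases lt_trichotomy b c with h' | h' | h' <;> rcases lt_trichotomy a c with h'' | h'' | h'' <;>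
      first
      | (exfalso; order)
      | (try subst h
         try subst h'
         try subst h''
         simp only [*, lt_irrefl, not_lt_of_gt, if_true, if_false]
         first
         | ring1
         | linear_combination (f1) * ha
         | linear_combination (-f1) * hb
         | linear_combination (p - 1) * (f1) * ha
         | linear_combination (p - 1) * (-f1) * hb)
  comm := by
    intro B
    ext f s
    simp only [Module.End.mul_apply]
    rw [stA_apply, Sh_apply, Sh_apply, Sh_apply]
    have e1 : (fun n => sw 0 s (n + 2)) = fun n => s (n + 2) := by funext n; simp [sw_apply]
    have e2 : (fun s' => stA p σ f (spl 2 s s')) = ww p (s 0) (s 1) • (fun s' => f (spl 2 (sw 0 s) s')) + uu p σ (s 0) (s 1) • (fun s' => f (spl 2 s s')) := by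
      funext s'
      have e3 : sw 0 (spl 2 s s') = spl 2 (sw 0 s) s' := by
        funext n; simp only [spl, sw_apply]
        split_ifs <;> first | rfl | (exfalso; omega) 
      simp only [stA_apply, e3, Pi.add_apply, Pi.smul_apply, smul_eq_mul]
      simp [spl]
    rw [e1, e2, map_add, map_smul, map_smul]
    simp
end std
end HS

namespace HS
set_option linter.unusedSectionVars false
set_option linter.unusedVariables false
set_option linter.unusedSimpArgs false
section std
variable {k : Type} [Field k] {p : k} {I : Type} [LinearOrder I] [Fintype I] [Nonempty I]

def stX (p : k) (σ : I → k) (a b c d : I) : k := 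
  (if c = b ∧ d = a then ww p a b else 0) + (if c = a ∧ d = b then uu p σ a b else 0)

lemma op0_stX (σ : I → k) : op0 (stX p σ) = stA p σ := by
  ext f s
  simp only [op0, LinearMap.coe_mk, AddHom.coe_mk, stA_apply, stX, add_mul, ite_mul, zero_mul, Finset.sum_add_distrib, ite_and, Finset.sum_ite_irrel, Finset.sum_const_zero, Finset.sum_ite_eq', Finset.mem_univ, if_true]
  congr 3
  · funext n
    simp only [spl, sw_apply]
    rcases n with _ | _ | n <;> simp
  · funext n
    simp only [spl]
    rcases n with _ | _ | n <;> simp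

def stDat (p : k) (σ g : I → k) (hσ : ∀ a, σ a = p ∨ σ a = -1) (hg : ∀ a, g a ≠ 0) : Dat p I where
  X := stX p σ
  hk := by rw [op0_stX]; exact stA_hk σ hσ
  g := g
  g0 := hg
  hg a b c d := by
    simp only [stX]
    split_ifs with h1 h2 h2
    · rw [h1.1, h1.2]; ring
    · rw [h1.1, h1.2]; ring
    · rw [h2.1, h2.2]; ring
    · simp

variable (σ g : I → k) (hσ : ∀ a, σ a = p ∨ σ a = -1) (hg : ∀ a, g a ≠ 0)

lemma st_S (i : ℕ) : (stDat p σ g hσ hg).ρ (S p i) = Sh i (stA p σ) := by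
  rw [Dat.ρ_S, ← op0_stX]; rfl

lemma cat_one {n : ℕ} (s : Fin (n+1) → I) : s = cat (add_comm n 1) (fun _ => s 0) (Fin.tail s) := by
  funext i
  refine Fin.cases ?_ (fun i => ?_) i
  · simp [cat]
  · simp [cat, Fin.tail]

lemma st_diag (r : ℕ) (s : Fin (r+2) → I) : (stDat p σ g hσ hg).M (r+2) (asc (S p) 0 (r+1)) s s = 
    uu p σ (s 0) (s 1) * (stDat p σ g hσ hg).M (r+1) (asc (S p) 0 r) (Fin.tail s) (Fin.tail s) := by
  set D := stDat p σ g hσ hg with hD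
  have hm : asc (S p) 0 r ∈ Hn p (r+1) := ascS_mem (by omega)
  have e : asc (S p) 0 (r+1) = S p 0 * sh 1 (asc (S p) 0 r) := by rw [asc_succ', sh_ascS]
  have e0 : Sh 0 (stA p σ) = stA p σ := by 
    ext f s; rw [Sh_stA, stA_apply]
  have e1 : D.M (r+2) (asc (S p) 0 (r+1)) s s = stA p σ (D.ρ (sh 1 (asc (S p) 0 r)) (cyl s)) (app s (dflt I)) := by
    show D.ρ (asc (S p) 0 (r+1)) (cyl s) (app s (dflt I)) = _
    rw [e, map_mul, hD, st_S, e0]; rfl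
  rw [e1, stA_apply]
  have h0 : app s (dflt I) 0 = s 0 := by simp [app]
  have h1 : app s (dflt I) 1 = s 1 := by simp [app]
  rw [h0, h1]
  have h2 : ww p (s 0) (s 1) * D.ρ (sh 1 (asc (S p) 0 r)) (cyl s) (sw 0 (app s (dflt I))) = 0 := by
    by_cases h : s 0 = s 1
    · simp [ww, h]
    · rw [D.ρ_sh, Sh_apply]
      have : (fun s' => cyl (k := k) s (spl 1 (sw 0 (app s (dflt I))) s')) = 0 := by
        funext s'
        simp only [cyl, Pi.zero_apply]
        rw [if_neg]
        intro h'
        have := h' 0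
        simp [spl, sw_apply, app] at this
        exact h this.symm
      rw [this]; simp
  rw [h2, zero_add]
  congr 1
  have h3 := D.M_catr (add_comm (r+1) 1) hm (fun _ => s 0) (fun _ => s 0) (Fin.tail s) (Fin.tail s)
  rw [← cat_one s] at h3
  rw [if_pos rfl, one_mul] at h3
  exact h3

lemma st_M1 (s : Fin 1 → I) : (stDat p σ g hσ hg).M 1 (asc (S p) 0 0) s s = 1 := by
  simp [asc, Dat.M_one]

/-- weighted sums with given first letter -/
def tv (gg : I → k) (r : ℕ) (a : I) : k :=
  ∑ s : Fin r → I, (stDat p σ g hσ hg).M (r+1) (asc (S p) 0 r) (Fin.cons a s) (Fin.cons a s) * ∏ i, gg ((Fin.cons a s : Fin (r+1) → I) i)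

lemma sum_cons {r : ℕ} (F : (Fin (r+1) → I) → k) : ∑ s, F s = ∑ a, ∑ s, F (Fin.cons a s) := by
  rw [← (Fin.consEquiv (fun _ : Fin (r+1) => I)).sum_comp, Fintype.sum_prod_type]; rfl

lemma tv_zero (gg : I → k) (a : I) : tv σ g hσ hg gg 0 a = gg a := by
  simp [tv, st_M1]

lemma tv_succ (gg : I → k) (r : ℕ) (a : I) : tv σ g hσ hg gg (r+1) a = gg a * ∑ b, uu p σ a b * tv σ g hσ hg gg r b := by
  simp only [tv]
  rw [sum_cons, Finset.mul_sum]
  refine Finset.sum_congr rfl fun b _ => ?_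
  rw [Finset.mul_sum, Finset.mul_sum]
  refine Finset.sum_congr rfl fun s _ => ?_
  rw [st_diag, Fin.prod_univ_succ]
  simp
  ring

def tSer (gg : I → k) (a : I) : PowerSeries k := PowerSeries.mk fun n => if n = 0 then 0 else tv σ g hσ hg gg (n - 1) a

open PowerSeries in
lemma tSer_eq (gg : I → k) (a : I) : tSer σ g hσ hg gg a = PowerSeries.C (gg a) * PowerSeries.X * (1 + ∑ b, PowerSeries.C (uu p σ a b) * tSer σ g hσ hg gg b) := by
  ext n
  rw [mul_assoc, PowerSeries.coeff_C_mul]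
  rcases n with _ | n
  · simp [tSer]
  · rw [PowerSeries.coeff_succ_X_mul, map_add, map_sum]
    simp only [PowerSeries.coeff_C_mul, tSer, PowerSeries.coeff_mk]
    rcases n with _ | n
    · simp [tv_zero]
    · simp [tv_succ]

def ZSer (gg : I → k) : PowerSeries k := 1 + PowerSeries.C (p - 1) * ∑ a, tSer σ g hσ hg gg a
end std

section fin
variable {k : Type} [Field k] {p : k} {d : ℕ} [NeZero d] (σ g : Fin d → k) (hσ : ∀ a, σ a = p ∨ σ a = -1) (hg : ∀ a, g a ≠ 0)
open PowerSeries

lemma Z_partial (gg : Fin d → k) (m : ℕ) (hm : m ≤ d) : 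
    (1 + PowerSeries.C (p - 1) * ∑ a with a.val < m, tSer σ g hσ hg gg a) * ∏ a with a.val < m, (1 - PowerSeries.C (σ a * gg a) * PowerSeries.X) =
      ∏ a with a.val < m, (1 + PowerSeries.C ((p - 1 - σ a) * gg a) * PowerSeries.X) := by
  induction m with
  | zero => simp
  | succ m ih =>
    have ih := ih (by omega)
    let b : Fin d := ⟨m, by omega⟩
    have hs : (Finset.univ.filter fun a : Fin d => a.val < m + 1) = insert b (Finset.univ.filter fun a : Fin d => a.val < m) := by
      ext a; simp [b, Fin.ext_iff]; omega
    have hb : b ∉ (Finset.univ.filter fun a : Fin d => a.val < m) := by simp [b]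
    rw [hs, Finset.sum_insert hb, Finset.prod_insert hb, Finset.prod_insert hb]
    have h1 := tSer_eq σ g hσ hg gg b
    have h2 : ∑ c, PowerSeries.C (uu p σ b c) * tSer σ g hσ hg gg c = PowerSeries.C (p - 1) * ∑ a with a.val < m, tSer σ g hσ hg gg a + PowerSeries.C (σ b) * tSer σ g hσ hg gg b := by
      have : ∀ c, PowerSeries.C (uu p σ b c) * tSer σ g hσ hg gg c = (if c.val < m then PowerSeries.C (p-1) * tSer σ g hσ hg gg c else 0) + (if c = b then PowerSeries.C (σ b) * tSer σ g hσ hg gg b else 0) := by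
        intro c
        simp only [uu]
        rcases lt_trichotomy c b with h | h | h
        · have : c.val < m := h
          simp [h, h.not_gt, this, h.ne]
        · simp [h, b]
        · have : ¬ c.val < m := not_lt.2 (le_of_lt h)
          simp [h, this, h.ne']
      simp only [this, Finset.sum_add_distrib, Finset.sum_ite_eq', Finset.mem_univ, if_true, Finset.mul_sum, Finset.sum_filter, mul_ite, mul_zero]
    rw [h2] at h1
    rw [← ih]
    generalize tSer σ g hσ hg gg b = t at *
    generalize ∑ a with a.val < m, tSer σ g hσ hg gg a = Z at *
    simp only [map_mul, map_sub, map_one] at *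
    generalize ∏ a with a.val < m, (1 - PowerSeries.C (σ a) * PowerSeries.C (gg a) * PowerSeries.X) = P at *
    linear_combination (PowerSeries.C p - 1) * P * h1

lemma Z_eq (gg : Fin d → k) : ZSer σ g hσ hg gg * ∏ a, (1 - PowerSeries.C (σ a * gg a) * PowerSeries.X) = ∏ a, (1 + PowerSeries.C ((p - 1 - σ a) * gg a) * PowerSeries.X) := by
  have := Z_partial σ g hσ hg gg d le_rfl
  simpa [ZSer] using this

lemma Z_coeff (gg : Fin d → k) (r : ℕ) : PowerSeries.coeff (r+1) (ZSer σ g hσ hg gg) = (p - 1) * ∑ s, (stDat p σ g hσ hg).M (r+1) (asc (S p) 0 r) s s * ∏ i, gg (s i) := by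
  rw [ZSer, map_add, PowerSeries.coeff_C_mul, map_sum, sum_cons]
  simp [tSer, tv, PowerSeries.coeff_one]
end fin
end HS

namespace HS
set_option linter.unusedSectionVars false
set_option linter.unusedVariables false
set_option linter.unusedSimpArgs false
variable {k : Type} [Field k] {p : k}

def rr (p : k) : Hec p →ₐ[k] Module.End k (Fn k ℕ) := rho (stA_hk (p := p) (fun _ : ℕ => p) (fun _ => Or.inl rfl))

lemma rr_S (i : ℕ) (f : Fn k ℕ) (s : ℕ → ℕ) : rr p (S p i) f s = ww p (s i) (s (i+1)) * f (sw i s) + uu p (fun _ => p) (s i) (s (i+1)) * f s := by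
  rw [rr, rho_S, Sh_stA]

lemma rr_supp {N : ℕ} {Q : (ℕ → ℕ) → Prop} (hQ : ∀ s i, i + 1 < N → Q s → Q (sw i s)) {h : Hec p} (hh : h ∈ Hn p N) :
    ∀ {f : Fn k ℕ} (hf : ∀ s, ¬ Q s → f s = 0) s, ¬ Q s → rr p h f s = 0 := by
  induction hh using Algebra.adjoin_induction with
  | mem x hx =>
    obtain ⟨i, hi, rfl⟩ := hx
    intro f hf s hs
    rw [rr_S, hf s hs, hf (sw i s), mul_zero, mul_zero, add_zero]
    intro h'
    apply hs
    rw [← sw_sw i s]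
    exact hQ _ _ hi h'
  | algebraMap r => 
    intro f hf s hs
    rw [AlgHom.commutes]
    simp [Module.algebraMap_end_apply, hf s hs]
  | add x y _ _ hx hy =>
    intro f hf s hs
    rw [map_add, LinearMap.add_apply, Pi.add_apply, hx hf s hs, hy hf s hs, add_zero]
  | mul x y _ _ hx hy =>
    intro f hf s hs
    rw [map_mul, Module.End.mul_apply]
    exact hx (hy hf) s hs

open Classical in
def dl (s : ℕ → ℕ) : Fn k ℕ := Pi.single s 1

open Classical in
lemma dl_apply (s t : ℕ → ℕ) : dl (k := k) s t = if t = s then 1 else 0 := by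
  simp [dl, Pi.single_apply]

lemma rr_S_dl (i : ℕ) (t : ℕ → ℕ) (h : t i < t (i+1)) : rr p (S p i) (dl t) = dl (sw i t) := by
  funext s
  rw [rr_S]
  simp only [dl_apply]
  have e : sw i s = t ↔ s = sw i t := ⟨fun h => by rw [← h, sw_sw], fun h => by rw [h, sw_sw]⟩
  rw [e]
  by_cases h1 : s = t
  · have : t ≠ sw i t := fun h' => by
      have := congrFun h' i
      simp [sw_apply] at this
      omega
    subst h1
    simp [this, uu, h]
  · by_cases h2 : s = sw i t
    · have e1 : s i = t (i+1) := by simp [h2, sw_apply]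
      have e2 : s (i+1) = t i := by simp [h2, sw_apply]
      simp only [h1, e1, e2, ww, h.not_gt, h, if_true, if_false]
      simp [h2]
    · simp [h1, h2]

def mv (n r : ℕ) (s : ℕ → ℕ) : ℕ → ℕ := fun m => if m < n then s m else if m < n + r then s (m+1) else if m = n + r then s n else s m

lemma mv_succ (n r : ℕ) (s : ℕ → ℕ) : sw (n + r) (mv n r s) = mv n (r+1) s := by
  funext m
  simp only [sw_apply, mv]
  split_ifs <;> first | rfl | (exfalso; omega) | (congr 1; omega)

lemma rr_dsc (n r : ℕ) (s : ℕ → ℕ) (hs : ∀ i, n < i → i ≤ n + r → s n < s i) : rr p (dsc p n r) (dl s) = dl (mv n r s) := by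
  induction r with
  | zero => 
    have : mv n 0 s = s := by
      funext m; simp only [mv]; split_ifs <;> first | rfl | (exfalso; omega) | (congr 1; omega)
    rw [this]; simp [dsc]
  | succ r ih =>
    rw [dsc, map_mul, Module.End.mul_apply, ih (fun i h1 h2 => hs i h1 (by omega)), rr_S_dl, mv_succ]
    have e1 : mv n r s (n + r) = s n := by simp [mv]
    have e2 : mv n r s (n + r + 1) = s (n+r+1) := by
      simp only [mv]; split_ifs <;> first | rfl | (exfalso; omega) 
    rw [e1, e2]
    exact hs _ (by omega) (by omega)

lemma rr_sep (N : ℕ) (ih : ∀ h ∈ Hn p N, ∀ s : ℕ → ℕ, (∀ i j, i < j → j < N → s i < s j) → rr p h (dl s) = 0 → h = 0)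
    (c : ℕ → Hec p) (hc : ∀ j, c j ∈ Hn p N) (s : ℕ → ℕ) (hs : ∀ i j, i < j → j < N + 1 → s i < s j)
    (h0 : rr p (∑ j ∈ Finset.range (N+1), c j * dsc p (N - j) j) (dl s) = 0) : ∀ j, j < N + 1 → c j = 0 := by
  have e : ∀ j ∈ Finset.range (N+1), rr p (c j * dsc p (N - j) j) (dl s) = rr p (c j) (dl (mv (N-j) j s)) := by
    intro j hj
    rw [Finset.mem_range] at hj
    rw [map_mul, Module.End.mul_apply, rr_dsc]
    intro i h1 h2
    exact hs _ _ h1 (by omega)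
  rw [map_sum, LinearMap.sum_apply, Finset.sum_congr rfl e] at h0
  have hl : ∀ j, j < N + 1 → mv (N-j) j s N = s (N-j) := by
    intro j hj
    simp only [mv]; split_ifs <;> first | rfl | (exfalso; omega) 
  intro j hj
  apply ih _ (hc j) (mv (N-j) j s)
  · intro i i' h1 h2
    simp only [mv]
    split_ifs <;> first | (exfalso; omega) | (apply hs <;> omega)
  · funext t
    by_cases ht : t N = s (N-j)
    · have := congrFun h0 t
      rw [Finset.sum_apply, Finset.sum_eq_single_of_mem j (Finset.mem_range.2 hj)] at this
      · exact this
      · intro i hi hij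
        rw [Finset.mem_range] at hi
        apply rr_supp (Q := fun t => t N = s (N-i)) _ (hc i)
        · intro t ht
          rw [dl_apply, if_neg]
          rintro rfl
          exact ht (hl i hi)
        · rw [ht]
          intro h'
          rcases lt_or_gt_of_ne (show N - j ≠ N - i by omega) with h2 | h2
          · have := hs _ _ h2 (by omega); omega
          · have := hs _ _ h2 (by omega); omega
        · intro t i' hi' ht
          simp only [sw_apply]
          rw [if_neg (by omega), if_neg (by omega)]; exact ht
    · apply rr_supp (Q := fun t => t N = s (N-j)) _ (hc j) _ _ ht
      · intro t i' hi' ht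
        simp only [sw_apply]
        rw [if_neg (by omega), if_neg (by omega)]; exact ht
      · intro t ht
        rw [dl_apply, if_neg]
        rintro rfl
        exact ht (hl j hj)

lemma rr_inj (N : ℕ) : ∀ h ∈ Hn p N, ∀ s : ℕ → ℕ, (∀ i j, i < j → j < N → s i < s j) → rr p h (dl s) = 0 → h = 0 := by
  induction N with
  | zero =>
    intro h hh s hs h0
    obtain ⟨c, rfl⟩ := Hn_le_one (by omega) hh
    have := congrFun h0 s
    simp [dl_apply] at this
    simp [this]
  | succ N ih =>
    intro h hh s hs h0
    obtain ⟨c, hc, rfl⟩ := Hn_normal N hh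
    have hz := rr_sep N ih c hc s hs h0
    refine Finset.sum_eq_zero fun j hj => ?_
    rw [hz j (Finset.mem_range.1 hj), zero_mul]

def tau (p : k) : Hec p →ₗ[k] k where
  toFun h := rr p h (dl id) id
  map_add' x y := by simp
  map_smul' c x := by simp

lemma tau_apply (h : Hec p) : tau p h = rr p h (dl id) id := rfl

lemma tau_xSy (n : ℕ) (x y : Hec p) (hx : x ∈ Hn p (n+1)) (hy : y ∈ Hn p (n+1)) : tau p (x * S p n * y) = 0 := by
  rw [tau_apply, map_mul, map_mul, Module.End.mul_apply, Module.End.mul_apply]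
  have h1 := rr_supp (k := k) (p := p) (N := n+1) (Q := fun s => (∀ i ≤ n, s i ≤ n) ∧ s (n+1) = n+1) (fun s i hi hQ => by
    refine ⟨fun j hj => ?_, ?_⟩
    · simp only [sw_apply]
      split_ifs
      · exact hQ.1 _ (by omega)
      · exact hQ.1 _ (by omega)
      · exact hQ.1 _ hj
    · simp only [sw_apply]
      rw [if_neg (by omega), if_neg (by omega)]; exact hQ.2) hy (f := dl id) (fun s hs => by
        rw [dl_apply, if_neg]
        rintro rfl
        exact hs ⟨fun i hi => hi, rfl⟩)
  apply rr_supp (Q := fun s => s (n+1) ≤ n) _ hx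
  · intro s hs
    rw [rr_S]
    have e1 : rr p y (dl id) (sw n s) = 0 := by
      apply h1
      intro h
      have := h.1 n le_rfl
      simp [sw_apply] at this
      omega
    rw [e1, mul_zero, zero_add]
    by_cases h : (∀ i ≤ n, s i ≤ n) ∧ s (n+1) = n+1
    · have : s n < s (n+1) := by
        have := h.1 n le_rfl
        omega
      simp [uu, this]
    · rw [h1 s h, mul_zero]
  · simp
  · intro s i hi h
    simp only [sw_apply]
    rw [if_neg (by omega), if_neg (by omega)]; exact h

lemma tau_nondeg (hp : p ≠ 0) {N : ℕ} {z : Hec p} (hz : z ∈ Hn p N) (h0 : z ≠ 0) : ∃ h ∈ Hn p N, tau p (h * z) ≠ 0 := by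
  have h1 : rr p z (dl id) ≠ 0 := fun h => h0 (rr_inj N z hz id (fun i j h _ => h) h)
  obtain ⟨t, ht⟩ := Function.ne_iff.1 h1
  by_contra hcon
  push Not at hcon
  apply ht
  apply rr_supp (Q := fun t => Function.Injective t ∧ ∃ h ∈ Hn p N, ∃ c : k, c ≠ 0 ∧ ∀ f, rr p h f id = c * f t) _ hz
  · intro s hs
    rw [dl_apply, if_neg]
    rintro rfl
    exact hs ⟨Function.injective_id, 1, one_mem _, 1, one_ne_zero, by simp⟩
  · rintro ⟨-, h, hh, c, hc, hf⟩
    have := hcon h hh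
    rw [tau_apply, map_mul, Module.End.mul_apply, hf] at this
    exact ht ((mul_eq_zero.1 this).resolve_left hc)
  · rintro s i hi ⟨hs, h, hh, c, hc, hf⟩
    refine ⟨hs.comp (Equiv.injective _), ?_⟩
    rcases lt_or_gt_of_ne (show s i ≠ s (i+1) from fun h => by have := hs h; omega) with h' | h'
    · refine ⟨h * S p i, mul_mem hh (S_mem hi), c * p, mul_ne_zero hc hp, fun f => ?_⟩
      rw [map_mul, Module.End.mul_apply, hf, rr_S]
      simp [ww, uu, h', mul_assoc]
    · refine ⟨h * (S p i - (p-1) • 1), mul_mem hh (sub_mem (S_mem hi) (Subalgebra.smul_mem _ (one_mem _) _)), c, hc, fun f => ?_⟩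
      rw [map_mul, Module.End.mul_apply, hf, map_sub, LinearMap.sub_apply, Pi.sub_apply, rr_S]
      simp [ww, uu, h', h'.not_gt]
end HS

namespace HS
set_option linter.unusedSectionVars false
set_option linter.unusedVariables false
set_option linter.unusedSimpArgs false
variable {k : Type} [Field k] {p : k} {I : Type} [Fintype I] [DecidableEq I] [Nonempty I]
  {J : Type} [Fintype J] [DecidableEq J] [Nonempty J]

lemma Hn_big (p : k) (N : ℕ) : ∃ (ι : Type) (_ : Fintype ι) (f : ι → Hec p), Fintype.card ι = N.factorial ∧ (∀ i, f i ∈ Hn p N) ∧ LinearIndependent k f := by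
  induction N with
  | zero =>
    refine ⟨Unit, inferInstance, fun _ => 1, by simp, fun _ => one_mem _, ?_⟩
    rw [Fintype.linearIndependent_iff]
    intro g hg i
    by_contra h
    simp only [Finset.univ_unique, Finset.sum_singleton] at hg
    have := congrArg (fun h => rr p h (dl id) id) hg
    simp [dl_apply] at this
    exact h this
  | succ N ih =>
    obtain ⟨ι, _, f, hc, hf, hl⟩ := ih
    refine ⟨ι × Fin (N+1), inferInstance, fun x => f x.1 * dsc p (N - x.2) x.2, ?_, fun x => ?_, ?_⟩
    · rw [Fintype.card_prod, hc, Fintype.card_fin, Nat.factorial_succ, mul_comm]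
    · exact mul_mem (Hn_mono (by omega) (hf _)) (dsc_mem (by omega))
    · rw [Fintype.linearIndependent_iff] at hl ⊢
      intro g hg
      have h1 := rr_sep N (rr_inj N) (fun j => if h : j < N + 1 then ∑ i, g (i, ⟨j, h⟩) • f i else 0) (fun j => by
        split_ifs
        · exact Subalgebra.sum_mem _ fun i _ => Subalgebra.smul_mem _ (hf i) _
        · exact zero_mem _) id (fun i j h _ => h) (by
        rw [show (∑ j ∈ Finset.range (N+1), (fun j => if h : j < N + 1 then ∑ i, g (i, ⟨j, h⟩) • f i else 0) j * dsc p (N - j) j) = 0 from ?_, map_zero, LinearMap.zero_apply]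
        rw [← hg, Finset.sum_range, Fintype.sum_prod_type, Finset.sum_comm]
        refine Finset.sum_congr rfl fun j _ => ?_
        simp only [dif_pos j.2, Finset.sum_mul, Fin.eta, smul_mul_assoc])
      rintro ⟨i, j⟩
      have := h1 j j.2
      rw [dif_pos j.2] at this
      exact hl _ this i

lemma fact_big (c : ℕ) : ∃ N : ℕ, 1 ≤ N ∧ c ^ N < N.factorial := by
  have := (FloorSemiring.tendsto_pow_div_factorial_atTop (c : ℝ)).eventually (gt_mem_nhds (zero_lt_one))
  obtain ⟨N, h1, h2⟩ := (this.and (Filter.eventually_ge_atTop 1)).exists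
  refine ⟨N, h2, ?_⟩
  rw [div_lt_one (by positivity)] at h1
  exact_mod_cast h1

lemma big_ker (D : Dat p I) (D2 : Dat p J) : ∃ N, ∃ z ∈ Hn p N, z ≠ 0 ∧ D.ρ z = 0 ∧ D2.ρ z = 0 := by
  obtain ⟨N, hN, hc⟩ := fact_big (Fintype.card I ^ 2 + Fintype.card J ^ 2)
  obtain ⟨ι, _, f, hι, hf, hl⟩ := Hn_big p N
  let L : (ι → k) →ₗ[k] Matrix (Fin N → I) (Fin N → I) k × Matrix (Fin N → J) (Fin N → J) k :=
    ((D.M N).prod (D2.M N)) ∘ₗ (Fintype.linearCombination k f)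
  have hk : L.ker ≠ ⊥ := by
    apply LinearMap.ker_ne_bot_of_finrank_lt
    rw [Module.finrank_prod, Module.finrank_matrix, Module.finrank_matrix, Module.finrank_fintype_fun_eq_card]
    simp only [Fintype.card_pi, Finset.prod_const, Finset.card_univ, Fintype.card_fin, Module.finrank_self, mul_one, hι]
    refine lt_of_le_of_lt ?_ hc
    rw [← mul_pow, ← mul_pow, ← pow_two, ← pow_two]
    exact pow_add_pow_le (by positivity) (by positivity) (by omega)
  obtain ⟨g, hg, hg0⟩ := Submodule.exists_mem_ne_zero_of_ne_bot hk
  rw [LinearMap.mem_ker] at hg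
  have hz : Fintype.linearCombination k f g ∈ Hn p N := by
    rw [Fintype.linearCombination_apply]
    exact Subalgebra.sum_mem _ fun i _ => Subalgebra.smul_mem _ (hf i) _
  refine ⟨N, Fintype.linearCombination k f g, hz, ?_, D.ρ_eq_zero hz (congrArg Prod.fst hg), D2.ρ_eq_zero hz (congrArg Prod.snd hg)⟩
  intro h
  apply hg0
  funext i
  exact Fintype.linearIndependent_iff.1 hl g (by rwa [Fintype.linearCombination_apply] at h) i

lemma min_ker (hp : p ≠ 0) (D : Dat p I) (D2 : Dat p J) : ∃ n, ∃ z ∈ Hn p (n+2), tau p z ≠ 0 ∧ D.ρ z = 0 ∧ D2.ρ z = 0 ∧ 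
    ∀ z ∈ Hn p (n+1), D.ρ z = 0 → D2.ρ z = 0 → z = 0 := by
  classical
  have hex := big_ker D D2
  obtain ⟨z, hz, hz0, h1, h2⟩ := Nat.find_spec hex
  have hmin := fun m => Nat.find_min hex (m := m)
  set N := Nat.find hex
  have : 2 ≤ N := by
    by_contra h
    obtain ⟨c, rfl⟩ := Hn_le_one (by omega) hz
    have := congrFun (DFunLike.congr_fun h1 (fun _ => 1)) (dflt I)
    simp at this
    simp [this] at hz0
  obtain ⟨n, hn⟩ : ∃ n, N = n + 2 := ⟨N - 2, by omega⟩
  obtain ⟨h, hh, ht⟩ := tau_nondeg hp hz hz0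
  rw [hn] at hh hz
  refine ⟨n, h * z, mul_mem hh hz, ht, by simp [h1], by simp [h2], fun z hz h1 h2 => ?_⟩
  by_contra h0
  exact hmin (n+1) (by omega) ⟨z, hz, h0, h1, h2⟩
end HS

namespace HS
set_option linter.unusedSectionVars false
set_option linter.unusedVariables false
set_option linter.unusedSimpArgs false
section
variable {k : Type} [Field k] {p : k} {I : Type} [LinearOrder I] [Fintype I] [Nonempty I]

lemma st_inj (hp : p ≠ 0) (σ g : I → k) (hσ : ∀ a, σ a = p ∨ σ a = -1) (hg : ∀ a, g a ≠ 0) : (stDat p σ g hσ hg).Inj := by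
  intro f hf
  have h1 : ∀ s u, s ≠ u → f s u = 0 := by
    intro s u hsu
    have := hf s u
    simp only [stDat, stX, hsu, hsu.symm, false_and, if_false, add_zero, mul_zero, sub_zero, ite_and, ite_mul, zero_mul, Finset.sum_ite_eq, Finset.sum_ite_eq', Finset.sum_ite_irrel, Finset.sum_const_zero, Finset.mem_univ, if_true] at this
    refine (mul_eq_zero.1 this).resolve_left ?_
    rcases lt_or_gt_of_ne hsu with h | h
    · simp [ww, h, hp]
    · simp [ww, h, h.not_gt]
  have h2 : ∀ s, ∑ x, (uu p σ s x - (p - 1)) * f x x = 0 := by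
    intro s
    have := hf s s
    rw [← this, Finset.sum_comm]
    refine Finset.sum_congr rfl fun x _ => ?_
    rw [Finset.sum_eq_single x]
    · by_cases h : x = s
      · subst h; simp [stDat, stX, ww]
      · simp [stDat, stX, h]
    · intro t _ ht
      rw [h1 t x ht, mul_zero]
    · simp
  have h3 : ∀ s, f s s = 0 := by
    intro s
    induction s using WellFoundedGT.induction with
    | ind s ih =>
      have := h2 s
      rw [Finset.sum_eq_single s] at this
      · refine (mul_eq_zero.1 this).resolve_left ?_
        have e : uu p σ s s = σ s := by simp [uu]
        rw [e]
        rcases hσ s with h | h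
        · rw [h]; simp
        · rw [h]; intro h'; apply hp; linear_combination -h'
      · intro x _ hx
        rcases lt_or_gt_of_ne hx with h | h
        · simp [uu, h, h.not_gt]
        · rw [ih x h, mul_zero]
      · simp
  funext s u
  by_cases h : s = u
  · rw [← h, h3]; rfl
  · rw [h1 _ _ h]; rfl
end
section
variable {k : Type} [Field k] {p : k} 
open Polynomial

def VM (hp : p ≠ 0) (M : ℕ) : Dat p (Fin (M+1)) := stDat p (fun _ => p) (fun a => p⁻¹ ^ a.val) (fun _ => Or.inl rfl) (fun a => pow_ne_zero _ (inv_ne_zero hp))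

def CM (p : k) (M : ℕ) (a b : Fin (M+1)) : k := if a = b then p⁻¹ ^ a.val else 0

lemma VM_aux (hp : p ≠ 0) (n : ℕ) : p * p⁻¹ ^ n + (p-1) * ∑ i ∈ Finset.range n, p⁻¹ ^ i = p := by
  induction n with
  | zero => simp
  | succ n ih =>
    rw [Finset.sum_range_succ, pow_succ]
    linear_combination ih + p⁻¹ ^ n * (mul_inv_cancel₀ hp)

lemma VM_Mk (hp : p ≠ 0) (M : ℕ) : (VM hp M).Mk (CM p M) (qn p (M+1)) p where
  tr := by
    simp only [CM, if_true, qn]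
    rw [Finset.sum_range]
  mkv c d := by
    simp only [CM, mul_ite, mul_zero, Finset.sum_ite_eq', Finset.mem_univ, if_true, VM, stDat, stX]
    by_cases h : c = d
    · subst h
      rw [if_pos rfl]
      refine Eq.trans ?_ (VM_aux hp c)
      rw [Finset.mul_sum]
      have : ∀ x : Fin (M+1), ((if c = x ∧ x = c then ww p c x else 0) + if c = c ∧ x = x then uu p (fun _ => p) c x else 0) * p⁻¹ ^ x.val = 
          (if x = c then p * p⁻¹ ^ c.val else 0) + (if x.val < c.val then (p-1) * p⁻¹ ^ x.val else 0) := by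
        intro x
        rcases lt_trichotomy x c with h | h | h
        · simp [uu, h.ne, h.ne', h, h.not_gt, ww]
        · simp [uu, h, ww]
        · simp [uu, h.ne, h.ne', h, h.not_gt, ww]
      simp only [and_true, if_true] at this ⊢
      rw [Finset.sum_congr rfl (fun x _ => this x), Finset.sum_add_distrib]
      simp only [Finset.sum_ite_eq', Finset.mem_univ, if_true]
      congr 1
      rw [← Finset.sum_filter, Finset.sum_range]
      symm
      refine Finset.sum_bij (fun x _ => ⟨x.val, by omega⟩) ?_ ?_ ?_ ?_
      · intro a _; first | (simp; done) | exact Finset.mem_filter.2 ⟨Finset.mem_univ _, a.2⟩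
      · intro a _ b _ hab; simpa [Fin.ext_iff] using hab
      · intro b hb
        simp only [Finset.mem_filter, Finset.mem_univ, true_and] at hb
        exact ⟨⟨b.val, hb⟩, Finset.mem_univ _, by simp⟩
      · intro a _; first | (simp; done) | exact Finset.mem_filter.2 ⟨Finset.mem_univ _, a.2⟩
    · rw [if_neg h]
      refine Finset.sum_eq_zero fun x _ => ?_
      have : ¬ (d = x ∧ x = c) := fun h' => h (h'.2.symm.trans h'.1.symm)
      simp [this, Ne.symm h]

lemma VM_χ (hp : p ≠ 0) (M : ℕ) {N : ℕ} (h : Hec p) : (VM hp M).χ (N+1) h = ∑ s, (VM hp M).wt s * ptr (CM p M) rfl ((VM hp M).M (N+1) h) s s := by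
  rw [Dat.χ_def, sum_cat (show N + 1 = N + 1 from rfl)]
  refine Finset.sum_congr rfl fun s _ => ?_
  rw [ptr_apply, Finset.mul_sum]
  refine Finset.sum_congr rfl fun x _ => ?_
  rw [Finset.sum_eq_single x, Dat.wt_cat]
  · simp only [Dat.wt, CC, CM, if_true, VM, stDat]; ring
  · intro y _ hy
    rw [CC, Fin.prod_univ_one, CM, if_neg, mul_zero]
    intro h; apply hy; funext i; rw [Subsingleton.elim i 0, h]
  · simp

lemma VM_poly (hp : p ≠ 0) (N : ℕ) : ∀ h ∈ Hn p N, ∃ P : k[X], P.natDegree ≤ N ∧ P.coeff N = tau p h ∧ ∀ M, (VM hp M).χ N h = P.eval (qn p (M+1)) := by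
  induction N with
  | zero =>
    intro h hh
    obtain ⟨c, rfl⟩ := Hn_le_one (by omega) hh
    refine ⟨Polynomial.C c, by simp, ?_, fun M => ?_⟩
    · simp [tau_apply, dl_apply]
    · simp [Dat.χ_zero]
  | succ N ih =>
    intro h hh
    refine Hn_ind N (P := fun h => ∃ P : k[X], P.natDegree ≤ N + 1 ∧ P.coeff (N+1) = tau p h ∧ ∀ M, (VM hp M).χ (N+1) h = P.eval (qn p (M+1))) ?_ ?_ ?_ hh
    · rintro x y ⟨P, h1, h2, h3⟩ ⟨Q, h4, h5, h6⟩
      refine ⟨P + Q, natDegree_add_le_of_degree_le h1 h4, by simp [h2, h5], fun M => by simp [h3, h6]⟩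
    · intro x hx
      obtain ⟨P, h1, h2, h3⟩ := ih x hx
      refine ⟨Polynomial.X * P, ?_, by rw [coeff_X_mul, h2], fun M => ?_⟩
      · refine natDegree_mul_le.trans ?_
        have := natDegree_X_le (R := k)
        omega
      · rw [VM_χ, (VM_Mk hp M).low rfl hx, eval_mul, eval_X, ← h3, Dat.χ_def, Finset.mul_sum]
        refine Finset.sum_congr rfl fun s _ => ?_
        rw [Matrix.smul_apply, smul_eq_mul]; ring
    · rintro n rfl x hx y hy
      obtain ⟨P, h1, h2, h3⟩ := ih (x * y) (mul_mem hx hy)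
      refine ⟨Polynomial.C p * P, ?_, ?_, fun M => ?_⟩
      · exact (natDegree_C_mul_le _ _).trans (by omega)
      · rw [coeff_C_mul, coeff_eq_zero_of_natDegree_lt (by omega), tau_xSy _ _ _ hx hy, mul_zero]
      · rw [VM_χ, (VM_Mk hp M).S rfl hx hy, eval_mul, eval_C, ← h3, Dat.χ_def, Finset.mul_sum]
        refine Finset.sum_congr rfl fun s _ => ?_
        rw [Matrix.smul_apply, smul_eq_mul]; ring

lemma qn_inj (hp : p ≠ 0) (hq : ∀ n, qn p (n+1) ≠ 0) : Function.Injective (fun M => qn p (M+1)) := by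
  have : ∀ a b, a < b → qn p (a+1) ≠ qn p (b+1) := by
    intro a b hab h
    obtain ⟨c, rfl⟩ : ∃ c, b = a + (c + 1) := ⟨b - a - 1, by omega⟩
    have e : qn p (a + (c+1) + 1) = qn p (a+1) + p⁻¹ ^ (a+1) * qn p (c+1) := by
      simp only [qn]
      rw [show a + (c+1) + 1 = (a + 1) + (c+1) by ring, Finset.sum_range_add, Finset.mul_sum]
      simp [pow_add]
    rw [e] at h
    have : p⁻¹ ^ (a+1) * qn p (c+1) = 0 := by linear_combination -h
    exact (mul_ne_zero (pow_ne_zero _ (inv_ne_zero hp)) (hq c)) this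
  intro a b h
  by_contra hab
  rcases lt_or_gt_of_ne hab with h' | h'
  · exact this _ _ h' h
  · exact this _ _ h' h.symm

lemma tau_nil (hp : p ≠ 0) (hq : ∀ n, qn p (n+1) ≠ 0) {N l : ℕ} {a : Hec p} (ha : a ∈ Hn p N) (hl : a ^ l = 0) : tau p a = 0 := by
  obtain ⟨P, h1, h2, h3⟩ := VM_poly hp N a ha
  have : P = 0 := by
    apply eq_zero_of_infinite_isRoot
    refine (Set.infinite_range_of_injective (qn_inj hp hq)).mono ?_
    rintro _ ⟨M, rfl⟩
    show P.eval _ = 0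
    rw [← h3, Dat.χ_def']
    apply IsReduced.eq_zero
    apply Matrix.isNilpotent_trace_of_isNilpotent
    refine ⟨l, ?_⟩
    rw [Commute.mul_pow ((VM hp M).M_wt ha), ← Dat.M_pow _ ha, hl, map_zero, zero_mul]
  rw [← h2, this, coeff_zero]
end
end HS

namespace HS
set_option linter.unusedSectionVars false
set_option linter.unusedVariables false
set_option linter.unusedSimpArgs false
section
variable {k : Type} [Field k] [CharZero k] {n : Type} [Fintype n] [DecidableEq n]

lemma idem_trace (E : Matrix n n k) (h : E * E = E) : ∃ r : ℕ, E.trace = r ∧ (r = 0 → E = 0) := by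
  have h1 : IsIdempotentElem (Matrix.toLin' E) := by
    rw [IsIdempotentElem, Module.End.mul_eq_comp, ← Matrix.toLin'_mul, h]
  refine ⟨Module.finrank k (LinearMap.range (Matrix.toLin' E)), ?_, fun h2 => ?_⟩
  · rw [← (LinearMap.IsIdempotentElem.isProj_range _ h1).trace, Matrix.trace_toLin'_eq]
  · have : LinearMap.trace k _ (Matrix.toLin' E) = 0 := by
      rw [(LinearMap.IsIdempotentElem.isProj_range _ h1).trace, h2, Nat.cast_zero]
    rw [LinearMap.IsIdempotentElem.trace_eq_zero_iff h1] at this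
    exact (LinearEquiv.map_eq_zero_iff _).1 this

open Polynomial in
lemma nil_of_trace (ι : ℝ →+* k) (γ : n → ℝ) (hγ : ∀ i, 0 < γ i) (A : Matrix n n k) 
    (hc : A * Matrix.diagonal (fun i => ι (γ i)) = Matrix.diagonal (fun i => ι (γ i)) * A)
    (ht : ∀ j, (A ^ (j+1) * Matrix.diagonal (fun i => ι (γ i))).trace = 0) : IsNilpotent A := by
  obtain ⟨Q, hQ, hQ0⟩ := exists_eq_pow_rootMultiplicity_mul_and_not_dvd A.charpoly A.charpoly_monic.ne_zero 0
  rw [C_0, sub_zero] at hQ hQ0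
  set m := A.charpoly.rootMultiplicity 0
  have hcop : IsCoprime (X ^ (m+1)) Q := by
    apply IsCoprime.pow_left
    exact (Polynomial.irreducible_X.coprime_iff_not_dvd).2 hQ0
  obtain ⟨u, v, huv⟩ := hcop
  have hCH : aeval A (X ^ m * Q) = 0 := by rw [← hQ]; exact Matrix.aeval_self_charpoly A
  set e := aeval A (u * X ^ (m+1)) with he
  have he2 : e * e = e := by
    rw [he, ← map_mul, ← sub_eq_zero, ← map_sub]
    have : u * X ^ (m+1) * (u * X ^ (m+1)) - u * X ^ (m+1) = (-u * v * X) * (X ^ m * Q) := by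
      linear_combination (u * X ^ (m+1)) * huv
    rw [this, map_mul, hCH, mul_zero]
  have hec : e * Matrix.diagonal (fun i => ι (γ i)) = Matrix.diagonal (fun i => ι (γ i)) * e := by
    have h1 : A ∈ Subalgebra.centralizer k {Matrix.diagonal (fun i => ι (γ i))} := by
      rw [Subalgebra.mem_centralizer_iff]; rintro g rfl; exact hc.symm
    have h2 := Polynomial.aeval_mem_adjoin_singleton k A (p := u * X ^ (m+1))
    have h3 := (Algebra.adjoin_le (Set.singleton_subset_iff.2 h1)) h2
    rw [Subalgebra.mem_centralizer_iff] at h3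
    exact (h3 _ rfl).symm
  have het : (e * Matrix.diagonal (fun i => ι (γ i))).trace = 0 := by
    have : ∀ P : k[X], ((aeval A (P * X ^ (m+1))) * Matrix.diagonal (fun i => ι (γ i))).trace = 0 := by
      intro P
      induction P using Polynomial.induction_on' with
      | add P Q hP hQ => rw [add_mul, map_add, add_mul, Matrix.trace_add, hP, hQ, add_zero]
      | monomial j c =>
        rw [← C_mul_X_pow_eq_monomial, mul_assoc, ← pow_add, map_mul, aeval_C, map_pow, aeval_X, Algebra.algebraMap_eq_smul_one, smul_one_mul, smul_mul_assoc, Matrix.trace_smul, ← add_assoc, ht, smul_zero]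
    exact this u
  have hz : ∀ i j, γ i ≠ γ j → e i j = 0 := by
    intro i j hij
    have := congrFun (congrFun hec i) j
    simp only [Matrix.mul_diagonal, Matrix.diagonal_mul] at this
    have h0 : (ι (γ i) - ι (γ j)) * e i j = 0 := by linear_combination -this
    exact (mul_eq_zero.1 h0).resolve_left (sub_ne_zero.2 fun h => hij (ι.injective h))
  let E : ℝ → Matrix n n k := fun l => e * Matrix.diagonal (fun i => if γ i = l then 1 else 0)
  have hE : ∀ l, E l * E l = E l := by
    intro l
    have : Matrix.diagonal (fun i => if γ i = l then (1:k) else 0) * e = e * Matrix.diagonal (fun i => if γ i = l then 1 else 0) := by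
      ext i j
      simp only [Matrix.mul_diagonal, Matrix.diagonal_mul]
      by_cases h : γ i = γ j
      · rw [h]; ring
      · rw [hz i j h]; ring
    show e * _ * (e * _) = _
    rw [mul_assoc, ← mul_assoc _ e, this, mul_assoc e _ (Matrix.diagonal _), Matrix.diagonal_mul_diagonal, ← mul_assoc, he2]
    congr 2
    funext i
    simp
  choose r hr hr0 using fun l => idem_trace (E l) (hE l)
  have h1 : (e * Matrix.diagonal (fun i => ι (γ i))).trace = ι (∑ l ∈ Finset.univ.image γ, l * r l) := by
    rw [map_sum]
    simp only [map_mul, map_natCast, ← hr, E, Matrix.trace, Matrix.diag, Matrix.mul_diagonal]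
    rw [← Finset.sum_fiberwise_of_maps_to (g := γ) (t := Finset.univ.image γ) (fun i _ => Finset.mem_image_of_mem _ (Finset.mem_univ _))]
    refine Finset.sum_congr rfl fun l _ => ?_
    rw [Finset.sum_filter, Finset.mul_sum]
    refine Finset.sum_congr rfl fun i _ => ?_
    split_ifs with h
    · rw [h]; ring
    · simp
  rw [het] at h1
  have h2 := ι.injective (h1.symm.trans (map_zero ι).symm)
  rw [Finset.sum_eq_zero_iff_of_nonneg] at h2
  swap
  · intro l hl
    obtain ⟨i, -, rfl⟩ := Finset.mem_image.1 hl
    exact mul_nonneg (hγ i).le (Nat.cast_nonneg _)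
  have he0 : e = 0 := by
    ext i j
    have := h2 (γ j) (Finset.mem_image_of_mem _ (Finset.mem_univ _))
    have h3 := hr0 (γ j) (by exact_mod_cast (mul_eq_zero.1 this).resolve_left (hγ j).ne')
    have := congrFun (congrFun h3 i) j
    simpa [E, Matrix.mul_diagonal] using this
  refine ⟨m, ?_⟩
  have h4 : aeval A (X ^ m : k[X]) = aeval A (X ^ m * (u * X ^ (m+1)) + v * (X ^ m * Q)) := by
    congr 1
    linear_combination - X ^ m * huv
  rw [map_add, map_mul _ (X ^ m) (u * _), map_mul _ v, hCH, ← he, he0] at h4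
  simpa using h4
end
section
variable {k : Type} [Field k] [CharZero k] {p : k} {I : Type} [Fintype I] [DecidableEq I] [Nonempty I]
  {J : Type} [Fintype J] [DecidableEq J] [Nonempty J]

lemma nil_ρ (D : Dat p I) (ι : ℝ →+* k) (γ : I → ℝ) (hγ : ∀ i, 0 < γ i) (hg : ∀ i, D.g i = ι (γ i)) {N : ℕ} {a : Hec p} (ha : a ∈ Hn p N)
    (h : ∀ j, D.χ N (a ^ (j+1)) = 0) : ∃ l, D.ρ (a ^ l) = 0 := by
  have e : D.wt (N := N) = fun s => ι (∏ i, γ (s i)) := by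
    funext s; simp [Dat.wt, hg]
  obtain ⟨l, hl⟩ := nil_of_trace ι (fun s : Fin N → I => ∏ i, γ (s i)) (fun s => Finset.prod_pos fun i _ => hγ _) (D.M N a)
    (by rw [← e]; exact D.M_wt ha) (fun j => by rw [← e, ← D.M_pow ha, ← D.χ_def', h])
  exact ⟨l, D.ρ_eq_zero (pow_mem ha l) (by rw [D.M_pow ha, hl])⟩

lemma main_dual (hp : p ≠ 0) (hq : ∀ n, qn p (n+1) ≠ 0) (ι : ℝ →+* k) (D : Dat p I) (D2 : Dat p J)
    (γ : I → ℝ) (hγ : ∀ i, 0 < γ i) (hg : ∀ i, D.g i = ι (γ i))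
    (γ2 : J → ℝ) (hγ2 : ∀ i, 0 < γ2 i) (hg2 : ∀ i, D2.g i = ι (γ2 i))
    (hI : D.Inj) (hI2 : D2.Inj) (hχ : ∀ N, ∀ h ∈ Hn p N, D.χ N h = D2.χ N h) (r : ℕ) (e : Hec p) (he : e ∈ Hn p (r+1)) :
    ∑ x, (D.wt x)⁻¹ * D.M (r+1) e x x = ∑ x, (D2.wt x)⁻¹ * D2.M (r+1) e x x := by
  obtain ⟨n, z, hz, htz, hz1, hz2, hmin⟩ := min_ker hp D D2
  obtain ⟨a, ha, m, b, c, hb, hc, hzz⟩ := Hn_dec n hz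
  have hta : tau p a ≠ 0 := by
    rw [hzz, map_add, map_sum, Finset.sum_eq_zero (fun i _ => tau_xSy n _ _ (hb i) (hc i)), add_zero] at htz
    exact htz
  obtain ⟨j, hj⟩ : ∃ j, D.χ (n+1) (a ^ (j+1)) ≠ 0 := by
    by_contra hcon
    push Not at hcon
    obtain ⟨l, hl⟩ := nil_ρ D ι γ hγ hg ha hcon
    obtain ⟨l2, hl2⟩ := nil_ρ D2 ι γ2 hγ2 hg2 ha (fun j => by rw [← hχ _ _ (pow_mem ha _), hcon])
    have : a ^ (l + l2) = 0 := hmin _ (pow_mem ha _) (by rw [pow_add, map_mul, hl, zero_mul]) (by rw [pow_add, map_mul, hl2, mul_zero])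
    exact hta (tau_nil hp hq ha this)
  set a1 := a ^ (j+1) with ha1
  have ha1m : a1 ∈ Hn p (n+1) := pow_mem ha _
  set c' : Fin m → Hec p := fun i => c i * a ^ j with hc'
  have hc'm : ∀ i, c' i ∈ Hn p (n+1) := fun i => mul_mem (hc i) (pow_mem ha _)
  have hz' : z * a ^ j = a1 + ∑ i, b i * S p n * c' i := by
    rw [hzz, add_mul, Finset.sum_mul, ha1, pow_succ']
    simp only [hc', mul_assoc]
  obtain ⟨C, hC⟩ := Dat.Inj.exists_C D hp hI
  obtain ⟨C2, hC2⟩ := Dat.Inj.exists_C D2 hp hI2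
  have key : ∀ {I : Type} [Fintype I] [DecidableEq I] [Nonempty I] (D : Dat p I) (C : I → I → k) (τ κ : k) (hC : D.Mk C τ κ) (hz : D.ρ z = 0), 
      τ * D.χ (n+1) a1 + κ * D.χ (n+1) (∑ i, b i * c' i) = 0 := by
    intro I _ _ _ D C τ κ hC hz
    have h1 : D.M (n+2) (z * a ^ j) = 0 := D.M_eq_zero (by rw [map_mul, hz, zero_mul])
    have h2 := congrArg (ptr C (show n + 2 = n + 1 + 1 from rfl)) h1
    rw [hz', map_add, map_add, map_sum, map_sum, map_zero, hC.low rfl ha1m, Finset.sum_congr rfl (fun i _ => hC.S rfl (hb i) (hc'm i)), ← Finset.smul_sum, ← map_sum] at h2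
    rw [D.χ_def', D.χ_def', ← smul_eq_mul (a := τ), ← smul_eq_mul (a := κ), ← Matrix.trace_smul, ← Matrix.trace_smul, ← Matrix.trace_add, ← smul_mul_assoc, ← smul_mul_assoc, ← add_mul, h2, zero_mul, Matrix.trace_zero]
  have hbc : ∑ i, b i * c' i ∈ Hn p (n+1) := Subalgebra.sum_mem _ fun i _ => mul_mem (hb i) (hc'm i)
  have k1 := key D C _ _ hC hz1
  have k2 := key D2 C2 _ _ hC2 hz2
  rw [← hχ _ _ ha1m, ← hχ _ _ hbc] at k2
  generalize hτ : ∑ a, C a a = τ at *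
  generalize hτ2 : ∑ a, C2 a a = τ2 at *
  set F := D.χ (n+1) a1
  set G := D.χ (n+1) (∑ i, b i * c' i)
  have hττ : τ2 = τ := by
    have h0 : (τ2 - τ) * (F + (p-1) * G) = 0 := by linear_combination k2 - k1
    rcases mul_eq_zero.1 h0 with h | h
    · exact sub_eq_zero.1 h
    · exfalso
      have : p * G = 0 := by linear_combination k1 - τ * h
      have := (mul_eq_zero.1 this).resolve_left hp
      rw [this, mul_zero, add_zero] at h
      exact hj h
  subst hττ
  have hd1 : Deep (D.ρ.prod D2.ρ) 1 (n+1) a1 := by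
    refine ⟨ha1m, -∑ i, (b i * bt p 1 n) * sh 1 (c' i), ?_, ?_⟩
    · refine neg_mem (Submodule.sum_mem _ fun i _ => Submodule.subset_span ⟨_, mul_mem (hb i) (bt_mem le_rfl), _, hc'm i, rfl⟩)
    · have h1 : (D.ρ.prod D2.ρ) ((z * a ^ j) * bt p 1 (n+1)) = 0 := by
        rw [map_mul, map_mul, AlgHom.prod_apply, hz1, hz2]
        show (0 : _ × _) * _ * _ = 0
        rw [zero_mul, zero_mul]
      have h2 : ∑ i, (b i * bt p 1 n) * sh 1 (c' i) = (∑ i, b i * S p n * c' i) * bt p 1 (n+1) := by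
        rw [Finset.sum_mul]
        refine Finset.sum_congr rfl fun i _ => ?_
        rw [mul_assoc _ (c' i), bt_comm hp 1 (n+1) (hc'm i)]
        have : bt p 1 (n+1) = T p n * bt p 1 n := by simp [bt, asc]
        rw [this, mul_assoc (b i) (S p n), mul_assoc (T p n), S_assoc_cancel hp, mul_assoc]
      rw [hz', add_mul, ← h2, map_add] at h1
      rw [map_neg, eq_neg_iff_add_eq_zero, h1]
  have hΦ : ∀ x y, (D.ρ.prod D2.ρ) x = (D.ρ.prod D2.ρ) y → ∀ a, (D.ρ.prod D2.ρ) (sh a x) = (D.ρ.prod D2.ρ) (sh a y) := by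
    intro x y h a
    simp only [AlgHom.prod_apply, Prod.mk.injEq] at h ⊢
    rw [D.ρ_sh, D2.ρ_sh, h.1, h.2, D.ρ_sh, D2.ρ_sh]
    exact ⟨rfl, rfl⟩
  have hall : ∀ r, ∃ N a, r ≤ N ∧ Deep (D.ρ.prod D2.ρ) r N a ∧ D.χ N a ≠ 0 := by
    intro r
    induction r with
    | zero => 
      refine ⟨0, 1, le_rfl, ⟨one_mem _, 1, Submodule.subset_span ⟨1, one_mem _, 1, one_mem _, by simp⟩, by simp [bt]⟩, ?_⟩
      rw [D.χ_zero]; exact one_ne_zero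
    | succ r ih =>
      obtain ⟨N, a, hr, hd, h0⟩ := ih
      refine ⟨N + (n+1), _, by omega, Deep.combine hp hΦ hr (by omega) hd hd1, ?_⟩
      rw [D.χ_cat rfl hd.1 ha1m]
      exact mul_ne_zero h0 hj
  obtain ⟨N, a', hr, hd, h0⟩ := hall (r+1)
  exact deep2 hp hC hC2 (Dat.Inj.injB D hp hI) (Dat.Inj.injB D2 hp hI2) hχ (n := N - (r+1)) (by omega) hd h0 he
end
end HS

namespace HS
set_option linter.unusedSectionVars false
set_option linter.unusedVariables false
set_option linter.unusedSimpArgs false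
variable {k : Type} [Field k] {p : k} {I : Type} [Fintype I] [DecidableEq I] [Nonempty I]

lemma newton_step (hp : p ≠ 0) (hq : ∀ n, qn p (n+1) ≠ 0) (D : Dat p I) (n j : ℕ) :
    qn p (n+2) * D.χ (n+2+j) (An p (n+2) * asc (S p) (n+1) j) =
      D.χ (n+1) (An p (n+1)) * D.χ (j+1) (asc (S p) 0 j)
       - p⁻¹ * (qn p (n+1) * D.χ (n+1+(j+1)) (An p (n+1) * asc (S p) n (j+1))) := by
  obtain ⟨hm, he, hr, hl⟩ := An_props' hp hq (n+1)
  have hs : asc (S p) (n+1) j = sh (n+1) (asc (S p) 0 j) := by rw [sh_ascS, zero_add]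
  have hN : n + 2 + j = (n+1) + (j+1) := by omega
  have hA : An p (n+2) = (qn p (n+2))⁻¹ • (An p (n+1) + (-p⁻¹ * qn p (n+1)) • (An p (n+1) * S p n * An p (n+1))) := rfl
  have hsq : An p (n+1) * An p (n+1) = An p (n+1) := by
    rw [absorb_right hr hm, he, one_smul]
  have hc : An p (n+1) * asc (S p) (n+1) j = asc (S p) (n+1) j * An p (n+1) := by
    rw [hs]; exact comm_sh (le_refl _) hm _
  have hmA : An p (n+1) ∈ Hn p (n+2+j) := Hn_mono (by omega) hm
  rw [hA, smul_mul_assoc, map_smul, smul_eq_mul, mul_inv_cancel_left₀ (hq _), add_mul, map_add, smul_mul_assoc, map_smul, smul_eq_mul]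
  have h1 : D.χ (n+2+j) (An p (n+1) * asc (S p) (n+1) j) = D.χ (n+1) (An p (n+1)) * D.χ (j+1) (asc (S p) 0 j) := by
    rw [hs]; exact D.χ_cat hN hm (ascS_mem (by omega))
  have h2 : D.χ (n+2+j) (An p (n+1) * S p n * An p (n+1) * asc (S p) (n+1) j) = D.χ (n+1+(j+1)) (An p (n+1) * asc (S p) n (j+1)) := by
    rw [mul_assoc, hc, ← mul_assoc, D.χ_comm (mul_mem (mul_mem hmA (S_mem (by omega))) (ascS_mem (by omega))) hmA,
      asc_succ', ← mul_assoc, ← mul_assoc, hsq, hN, mul_assoc]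
  rw [h1, h2]; ring

lemma newton_w (hp : p ≠ 0) (hq : ∀ n, qn p (n+1) ≠ 0) (D : Dat p I) (n : ℕ) : ∀ j : ℕ,
    qn p (n+1) * D.χ (n+1+j) (An p (n+1) * asc (S p) n j) =
      ∑ i ∈ Finset.range (n+1), (-p⁻¹)^i * (D.χ (n-i) (An p (n-i)) * D.χ (j+i+1) (asc (S p) 0 (j+i))) := by
  induction n with
  | zero => 
    intro j
    have : An p 1 = 1 := rfl
    have h0 : An p 0 = 1 := rfl
    have : qn p 1 = 1 := by simp [qn]
    simp [*, D.χ_zero, add_comm 1 j]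
  | succ n ih =>
    intro j
    rw [newton_step hp hq, ih, Finset.sum_range_succ' _ (n+1), sub_eq_add_neg, add_comm, Finset.mul_sum, ← Finset.sum_neg_distrib]
    congr 1
    · refine Finset.sum_congr rfl fun i _ => ?_
      rw [Nat.add_sub_add_right, show j + 1 + i = j + (i+1) by omega, pow_succ]; ring
    · simp

lemma newton (hp : p ≠ 0) (hq : ∀ n, qn p (n+1) ≠ 0) (D : Dat p I) (e t : ℕ → k) (he : ∀ n, e n = D.χ n (An p n))
    (ht0 : t 0 = 1) (ht : ∀ n, t (n+1) = (p-1) * D.χ (n+1) (asc (S p) 0 n)) :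
    PowerSeries.mk (fun n => (-1)^n * e n) = PowerSeries.mk (fun n => (-p)^n * e n) * PowerSeries.mk t := by
  ext n
  rw [mul_comm, PowerSeries.coeff_mul, Finset.Nat.sum_antidiagonal_eq_sum_range_succ_mk]
  simp only [PowerSeries.coeff_mk]
  cases n with
  | zero => simp [ht0]
  | succ n =>
    rw [Finset.sum_range_succ', ht0]
    have h := newton_w hp hq D n 0
    have h2 : (p - 1) * p ^ n * qn p (n+1) = p ^ (n+1) - 1 := by
      clear h
      induction n with
      | zero => simp [qn]
      | succ n ih =>
        rw [qn_succ]
        have : (p-1) * p^(n+1) * (1 + p⁻¹ * qn p (n+1)) = (p-1) * p^(n+1) + (p * p⁻¹) * ((p - 1) * p ^ n * qn p (n+1)) := by ring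
        rw [this, ih, mul_inv_cancel₀ hp]; ring
    have h3 : ∑ x ∈ Finset.range (n+1), t (x+1) * ((-p)^(n+1-(x+1)) * e (n+1-(x+1))) = (p-1) * (-p)^n * (qn p (n+1) * e (n+1)) := by
      simp only [zero_add, add_zero] at h
      rw [he (n+1), show D.χ (n+1) (An p (n+1)) = D.χ (n+1) (An p (n+1) * asc (S p) n 0) by simp [asc], h, Finset.mul_sum]
      refine Finset.sum_congr rfl fun i hi => ?_
      rw [Nat.add_sub_add_right, ht, he]
      obtain ⟨c, rfl⟩ := Nat.exists_eq_add_of_le (Nat.lt_succ_iff.1 (Finset.mem_range.1 hi))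
      rw [Nat.add_sub_cancel_left, pow_add]
      have : (-p)^i * (-p⁻¹)^i = 1 := by rw [← mul_pow, neg_mul_neg, mul_inv_cancel₀ hp, one_pow]
      linear_combination (-(p-1) * (-p)^c * (D.χ c (An p c) * D.χ (i+1) (asc (S p) 0 i))) * this
    rw [h3, neg_pow p n, neg_pow p (n+1-0), Nat.sub_zero]
    linear_combination (-(-1)^n * e (n+1)) * h2
end HS

namespace HS
set_option linter.unusedSectionVars false
set_option linter.unusedVariables false
set_option linter.unusedSimpArgs false
variable {k : Type} [Field k] {p : k} {I : Type} [Fintype I] [DecidableEq I] [Nonempty I]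

lemma loc_ext {N : ℕ} {A B : Module.End k (Fn k I)} {X Y} (hA : LocBy N A X) (hB : LocBy N B Y)
    (h : ∀ t : Fin N → I, A (cyl t) = B (cyl t)) : A = B := by
  have : X = Y := by ext s t; rw [hA.eq, hB.eq, h]
  subst this
  ext f s
  obtain ⟨u, e, rfl⟩ := exists_app N s
  rw [hA, hB]

lemma op0_loc3 (X : I → I → I → I → k) : (∃ Y, LocBy 3 (op0 X) Y) ∧ ∃ Y, LocBy 3 (Sh 1 (op0 X)) Y := by
  constructor
  · have := (op0_loc X).tens (show 3 = 2 + 1 by rfl) (LocBy.one 1)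
    rw [map_one, mul_one] at this
    exact ⟨_, this⟩
  · have := (LocBy.one (k := k) (I := I) 1).tens (show 3 = 1 + 2 by rfl) (op0_loc X)
    rw [one_mul] at this
    exact ⟨_, this⟩

lemma op0_isHk {X : I → I → I → I → k} 
    (h2 : ∀ t : Fin 2 → I, op0 X (op0 X (cyl t)) = (p - 1) • op0 X (cyl t) + p • cyl t)
    (h3 : ∀ t : Fin 3 → I, op0 X (Sh 1 (op0 X) (op0 X (cyl t))) = Sh 1 (op0 X) (op0 X (Sh 1 (op0 X) (cyl t)))) :
    IsHk p (op0 X) := by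
  refine ⟨?_, ?_, op0_comm X⟩
  · exact loc_ext ((op0_loc X).mul (op0_loc X)) (((op0_loc X).smul _).add ((LocBy.one 2).smul p)) fun t => by
      simpa using h2 t
  · obtain ⟨⟨Y, hY⟩, Z, hZ⟩ := op0_loc3 X
    exact loc_ext ((hY.mul hZ).mul hY) ((hZ.mul hY).mul hZ) fun t => by simpa using h3 t

lemma op0_inv {q : k} {X Y : I → I → I → I → k}
    (hY : ∀ a b c d, Y a b c d = q⁻¹ * (X a b c d - (q - 1) * if a = c ∧ b = d then 1 else 0)) :
    op0 Y = q⁻¹ • (op0 X - (q-1) • 1) := by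
  have hl := ((op0_loc X).add ((LocBy.one 2).smul (-(q-1)))).smul q⁻¹
  rw [neg_smul (q-1) (1 : Module.End k (Fn k I)), ← sub_eq_add_neg] at hl
  refine loc_ext (N := 2) (op0_loc Y) hl ?_
  · intro t
    funext s
    obtain ⟨u, e, rfl⟩ := exists_app 2 s
    have h1 := op0_loc Y (cyl t) u e
    have h2 := op0_loc X (cyl t) u e
    simp only [cyl_app, mul_ite, mul_one, mul_zero, Finset.sum_ite_eq', Finset.mem_univ, if_true] at h1 h2
    have h3 : (u = t) ↔ u 0 = t 0 ∧ u 1 = t 1 := by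
      rw [funext_iff, Fin.forall_fin_two]
    simp [h1, h2, hY, cyl_app, h3]

lemma inv_isHk {q : k} (hq : q ≠ 0) {X Y : I → I → I → I → k} (h : IsHk q (op0 X))
    (hY : ∀ a b c d, Y a b c d = q⁻¹ * (X a b c d - (q - 1) * if a = c ∧ b = d then 1 else 0)) : IsHk q⁻¹ (op0 Y) := by
  have e := op0_inv hY
  have e1 : op0 X * op0 Y = 1 := by
    rw [e, mul_smul_comm, mul_sub, h.quad, mul_smul_comm, mul_one, add_sub_cancel_left, smul_smul, inv_mul_cancel₀ hq, one_smul]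
  have e2 : op0 Y * op0 X = 1 := by
    rw [e, smul_mul_assoc, sub_mul, h.quad, smul_mul_assoc, one_mul, add_sub_cancel_left, smul_smul, inv_mul_cancel₀ hq, one_smul]
  refine ⟨?_, ?_, op0_comm Y⟩
  · have : op0 X = q • op0 Y + (q-1) • 1 := by
      rw [e, smul_smul, mul_inv_cancel₀ hq, one_smul, sub_add_cancel]
    rw [this, add_mul, smul_mul_assoc, smul_mul_assoc, one_mul] at e1
    have h4 : op0 Y * op0 Y = q⁻¹ • (1 - (q-1) • op0 Y) := by
      rw [← e1, add_sub_cancel_right, smul_smul, inv_mul_cancel₀ hq, one_smul]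
    rw [h4, smul_sub, smul_smul]
    have : q⁻¹ - 1 = - (q⁻¹ * (q-1)) := by field_simp; ring
    rw [this, neg_smul (q⁻¹ * (q-1)) (op0 Y), sub_eq_add_neg, add_comm]
  · set A := op0 X
    set B := op0 Y
    have f1 : Sh 1 A * Sh 1 B = 1 := by rw [← map_mul, e1, map_one]
    have f2 : Sh 1 B * Sh 1 A = 1 := by rw [← map_mul, e2, map_one]
    have l : (B * Sh 1 B * B) * (A * Sh 1 A * A) = 1 := by
      calc _ = B * (Sh 1 B * (B * A) * Sh 1 A) * A := by noncomm_ring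
        _ = _ := by rw [e2, mul_one, f2, mul_one, e2]
    have r : (A * Sh 1 A * A) * (Sh 1 B * B * Sh 1 B) = 1 := by
      rw [h.braid]
      calc _ = Sh 1 A * (A * (Sh 1 A * Sh 1 B) * B) * Sh 1 B := by noncomm_ring
        _ = _ := by rw [f1, mul_one, e1, mul_one, f1]
    exact left_inv_eq_right_inv l r

section
variable {k' : Type} [Field k'] (φ : k →+* k')

lemma op0_map (X : I → I → I → I → k) (f : Fn k I) : op0 (fun a b c d => φ (X a b c d)) (fun s => φ (f s)) = fun s => φ (op0 X f s) := by
  funext s; simp [op0, map_sum]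

lemma Sh_map {A : Module.End k (Fn k I)} {B : Module.End k' (Fn k' I)} (h : ∀ f, B (fun s => φ (f s)) = fun s => φ (A f s)) (n : ℕ) (f : Fn k I) : 
    Sh n B (fun s => φ (f s)) = fun s => φ (Sh n A f s) := by
  funext s
  obtain ⟨u, e, rfl⟩ := exists_app n s
  rw [Sh_app, Sh_app, h]

lemma cyl_map {N : ℕ} (t : Fin N → I) : (cyl t : Fn k' I) = fun s => φ (cyl t s) := by
  funext s; simp only [cyl]; split_ifs <;> simp

def Dat.map (D : Dat p I) : Dat (φ p) I where
  X a b c d := φ (D.X a b c d)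
  hk := by
    have h1 := op0_map φ D.X
    have h2 := Sh_map φ h1 1
    refine op0_isHk (fun t => ?_) (fun t => ?_)
    · rw [cyl_map φ, h1, h1]
      funext s
      have := congrFun (LinearMap.congr_fun D.hk.quad (cyl t)) s
      simp only [Module.End.mul_apply] at this
      rw [this]; simp
    · rw [cyl_map φ, h1, h2, h1, h2, h1, h2]
      funext s
      have := congrFun (LinearMap.congr_fun D.hk.braid (cyl t)) s
      simp only [Module.End.mul_apply] at this
      rw [this]
  g i := φ (D.g i)
  g0 i := (map_ne_zero φ).2 (D.g0 i)
  hg a b c d := by simp only [← map_mul, D.hg]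

lemma Dat.map_asc (D : Dat p I) (N n r : ℕ) (s t : Fin N → I) :
    (D.map φ).M N (asc (S (φ p)) n r) s t = φ (D.M N (asc (S p) n r) s t) := by
  have key : ∀ f : Fn k I, (D.map φ).ρ (asc (S (φ p)) n r) (fun s => φ (f s)) = fun s => φ (D.ρ (asc (S p) n r) f s) := by
    induction r with
    | zero => intro f; simp [asc]
    | succ r ih =>
      intro f
      simp only [asc, map_mul, Module.End.mul_apply]
      rw [Dat.ρ_S, Dat.ρ_S]
      rw [show (Sh (n+r) (op0 (D.map φ).X)) (fun s => φ (f s)) = fun s => φ (Sh (n+r) (op0 D.X) f s) from Sh_map φ (op0_map φ D.X) _ f, ih]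
  show (D.map φ).ρ _ (cyl t) _ = φ (D.ρ _ (cyl t) _)
  rw [cyl_map φ, key]

lemma Dat.map_χ (D : Dat p I) (r : ℕ) :
    (D.map φ).χ (r+1) (asc (S (φ p)) 0 r) = φ (D.χ (r+1) (asc (S p) 0 r)) := by
  rw [Dat.χ_def, Dat.χ_def, map_sum]
  refine Finset.sum_congr rfl fun s _ => ?_
  rw [Dat.map_asc, map_mul, Dat.wt, Dat.wt, map_prod]; rfl

lemma Dat.Inj.map {D : Dat p I} (h : D.Inj) : (D.map φ).Inj := by
  let Q : Matrix (I × I) (I × I) k := fun a b => D.X a.1 b.2 a.2 b.1 - (p-1) * if a.1 = a.2 ∧ b.2 = b.1 then 1 else 0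
  have hQ : Q.det ≠ 0 := by
    intro h0
    obtain ⟨v, hv, hv2⟩ := Matrix.exists_mulVec_eq_zero_iff.2 h0
    refine hv ?_
    have := h (fun t x => v (t, x)) fun s u => by
      have := congrFun hv2 (s, u)
      simp only [Matrix.mulVec, dotProduct, Fintype.sum_prod_type, Q] at this
      exact this
    funext a
    exact congrFun (congrFun this a.1) a.2
  intro f hf
  have hQ' : (φ.mapMatrix Q).det ≠ 0 := by rw [← RingHom.map_det]; exact (map_ne_zero φ).2 hQ
  by_contra hne
  refine hQ' (Matrix.exists_mulVec_eq_zero_iff.1 ⟨fun a => f a.1 a.2, fun h0 => hne ?_, ?_⟩)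
  · funext a b; exact congrFun h0 (a, b)
  · funext a
    refine Eq.trans ?_ (hf a.1 a.2)
    simp only [Matrix.mulVec, dotProduct, Fintype.sum_prod_type, Q, RingHom.mapMatrix_apply, Matrix.map_apply, Dat.map]
    refine Finset.sum_congr rfl fun t _ => Finset.sum_congr rfl fun x _ => ?_
    rw [show (φ.mapMatrix Q) a (t, x) = φ (Q a (t, x)) from rfl]
    simp only [Q]
    split_ifs <;> simp
end
end HS

namespace HS
set_option linter.unusedSectionVars false
set_option linter.unusedVariables false
set_option linter.unusedSimpArgs false
section
variable {K : Type} [Field K] {V : Type} [AddCommGroup V] [Module K V] {I : Type} [Fintype I] [DecidableEq I] [Nonempty I]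
variable (b : Module.Basis I K V) (R : V ⊗[K] V →ₗ[K] V ⊗[K] V)

def Rm : I → I → I → I → K := fun i j a c => (b.tensorProduct b).repr (R (b a ⊗ₜ b c)) (i, j)

def Psi2 : V ⊗[K] V →ₗ[K] Fn K I where
  toFun x := fun s => (b.tensorProduct b).repr x (s 0, s 1)
  map_add' x y := by funext s; simp
  map_smul' c x := by funext s; simp

def Psi3 : (V ⊗[K] V) ⊗[K] V →ₗ[K] Fn K I where
  toFun x := fun s => ((b.tensorProduct b).tensorProduct b).repr x ((s 0, s 1), s 2)
  map_add' x y := by funext s; simp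
  map_smul' c x := by funext s; simp

lemma Psi2_R (x : V ⊗[K] V) : op0 (Rm b R) (Psi2 b x) = Psi2 b (R x) := by
  have : (op0 (Rm b R)) ∘ₗ (Psi2 b) = (Psi2 b) ∘ₗ R := by
    refine (b.tensorProduct b).ext fun ⟨a, c⟩ => ?_
    funext s
    simp [op0, Psi2, Rm, spl, Module.Basis.tensorProduct_apply, Module.Basis.tensorProduct_repr_tmul_apply, Finsupp.single_apply, Finset.sum_ite_eq]
  exact LinearMap.congr_fun this x

lemma Psi3_R1 (x : (V ⊗[K] V) ⊗[K] V) : op0 (Rm b R) (Psi3 b x) = Psi3 b (TensorProduct.map R LinearMap.id x) := by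
  have : (op0 (Rm b R)) ∘ₗ (Psi3 b) = (Psi3 b) ∘ₗ (TensorProduct.map R LinearMap.id) := by
    refine ((b.tensorProduct b).tensorProduct b).ext fun ⟨⟨a, c⟩, e⟩ => ?_
    funext s
    simp [op0, Psi3, Rm, spl, Module.Basis.tensorProduct_apply, Module.Basis.tensorProduct_repr_tmul_apply, Finsupp.single_apply, Finset.sum_ite_eq]
  exact LinearMap.congr_fun this x

lemma assoc_repr (v : V) (w : V ⊗[K] V) (i j l : I) :
    ((b.tensorProduct b).tensorProduct b).repr ((TensorProduct.assoc K V V V).symm (v ⊗ₜ w)) ((i, j), l) = 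
      b.repr v i * (b.tensorProduct b).repr w (j, l) := by
  induction w using TensorProduct.induction_on with
  | zero => simp
  | tmul x y => simp [Module.Basis.tensorProduct_repr_tmul_apply]; ring
  | add x y hx hy => simp only [TensorProduct.tmul_add, map_add, Finsupp.add_apply, hx, hy, mul_add]

lemma Psi3_R2 (x : (V ⊗[K] V) ⊗[K] V) : Sh 1 (op0 (Rm b R)) (Psi3 b x) = Psi3 b (((TensorProduct.assoc K V V V).symm.toLinearMap ∘ₗ
        TensorProduct.map LinearMap.id R ∘ₗ (TensorProduct.assoc K V V V).toLinearMap) x) := by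
  have : (Sh 1 (op0 (Rm b R))) ∘ₗ (Psi3 b) = (Psi3 b) ∘ₗ ((TensorProduct.assoc K V V V).symm.toLinearMap ∘ₗ
        TensorProduct.map LinearMap.id R ∘ₗ (TensorProduct.assoc K V V V).toLinearMap) := by
    refine ((b.tensorProduct b).tensorProduct b).ext fun ⟨⟨a, c⟩, e⟩ => ?_
    funext s
    simp only [LinearMap.comp_apply, Sh_apply, Module.Basis.tensorProduct_apply, LinearEquiv.coe_coe, TensorProduct.assoc_tmul, TensorProduct.map_tmul, Psi3, LinearMap.coe_mk, AddHom.coe_mk, assoc_repr]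
    simp [op0, Rm, spl, Module.Basis.tensorProduct_apply, Module.Basis.tensorProduct_repr_tmul_apply, Finsupp.single_apply, Finset.sum_ite_eq]
  exact LinearMap.congr_fun this x

lemma cyl2 (t : Fin 2 → I) : cyl t = Psi2 b (b (t 0) ⊗ₜ b (t 1)) := by
  funext s
  simp [cyl, Psi2, Module.Basis.tensorProduct_repr_tmul_apply, Finsupp.single_apply, Fin.forall_fin_two, ite_and, eq_comm]

lemma cyl3 (t : Fin 3 → I) : cyl t = Psi3 b ((b (t 0) ⊗ₜ b (t 1)) ⊗ₜ b (t 2)) := by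
  funext s
  have : (∀ i : Fin 3, s i = t i) ↔ t 0 = s 0 ∧ t 1 = s 1 ∧ t 2 = s 2 := by
    rw [Fin.forall_fin_succ, Fin.forall_fin_two, eq_comm, eq_comm (a := s _), eq_comm (b := t (Fin.succ 1))]; rfl
  simp only [cyl, this]
  simp [Psi3, Module.Basis.tensorProduct_repr_tmul_apply, Finsupp.single_apply, ite_and]

variable {q : K} (hq0 : q ≠ 0) {R} (hR : IsHeckeSymmetry K V q R)

lemma Rm_isHk {q : K} {R} (hR : IsHeckeSymmetry K V q R) : IsHk q (op0 (Rm b R)) := by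
  obtain ⟨-, h3, h2, -⟩ := hR
  refine op0_isHk (fun t => ?_) (fun t => ?_)
  · rw [cyl2 b, Psi2_R, Psi2_R, ← (Psi2 b).map_smul, ← (Psi2 b).map_smul, ← (Psi2 b).map_add]
    congr 1
    have := LinearMap.congr_fun h2 (b (t 0) ⊗ₜ b (t 1))
    simp only [LinearMap.comp_apply, LinearMap.add_apply, LinearMap.sub_apply, LinearMap.smul_apply, LinearMap.id_apply, map_sub, map_smul, LinearMap.zero_apply] at this
    rw [← sub_eq_zero, ← this]; module
  · rw [cyl3 b, Psi3_R1, Psi3_R2, Psi3_R1, Psi3_R2, Psi3_R1, Psi3_R2]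
    congr 1
    exact LinearMap.congr_fun h3 _

def vDat : Dat q⁻¹ I where
  X a c d e := q⁻¹ * (Rm b R a c d e - (q - 1) * if a = d ∧ c = e then 1 else 0)
  hk := inv_isHk hq0 (Rm_isHk b hR) (fun _ _ _ _ => rfl)
  g _ := 1
  g0 _ := one_ne_zero
  hg _ _ _ _ := by ring

lemma R_sum (R : V ⊗[K] V →ₗ[K] V ⊗[K] V) (u w : I) : R (b u ⊗ₜ b w) = ∑ i, ∑ l, Rm b R i l u w • (b i ⊗ₜ[K] b l) := by
  rw [← (b.tensorProduct b).sum_repr (R (b u ⊗ₜ b w)), Fintype.sum_prod_type]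
  simp [Rm]

lemma vDat_inj : (vDat b hq0 hR).Inj := by
  intro f hf
  have hR' := hR
  obtain ⟨-, -, -, Rs, hbij, hRs⟩ := hR'
  let F : V ⊗[K] Module.Dual K V →ₗ[K] K := (b.tensorProduct b.dualBasis).constr K fun a => f a.2 a.1
  have hF : F ∘ₗ Rs = 0 := by
    refine (b.dualBasis.tensorProduct b).ext fun ⟨s, u⟩ => ?_
    have e : Rs (b.dualBasis s ⊗ₜ b u) = ∑ x, ∑ t, Rm b R s x u t • (b x ⊗ₜ b.dualBasis t) := by
      apply (TensorProduct.comm K V (Module.Dual K V)).injective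
      have hinj : Function.Injective (dualTensorHom K V V) := (dualTensorHomEquivOfBasis b).injective
      apply hinj
      refine b.ext fun w => ?_
      rw [hRs, R_sum]
      simp [map_sum, Module.Basis.dualBasis_apply_self, Finsupp.single_apply, ite_smul]
    simp only [Module.Basis.tensorProduct_apply, LinearMap.comp_apply, e, map_sum, map_smul, LinearMap.zero_apply]
    have hF2 : ∀ x t, F (b x ⊗ₜ b.dualBasis t) = f t x := fun x t => by
      rw [← Module.Basis.tensorProduct_apply, Module.Basis.constr_basis]
    simp only [hF2]
    have := hf s u
    rw [Finset.sum_comm]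
    have e3 : ∀ t x, ((vDat b hq0 hR).X s x u t - (q⁻¹ - 1) * if s = u ∧ x = t then 1 else 0) = q⁻¹ * Rm b R s x u t := by
      intro t x
      simp only [vDat]
      field_simp
      split_ifs <;> ring
    simp only [e3, mul_assoc, ← Finset.mul_sum] at this
    simpa [hq0] using this
  have h0 : F = 0 := LinearMap.ext fun z => by
    obtain ⟨w, rfl⟩ := hbij.2 z
    exact LinearMap.congr_fun hF w
  funext t x
  have := LinearMap.congr_fun h0 (b x ⊗ₜ b.dualBasis t)
  rwa [← Module.Basis.tensorProduct_apply, Module.Basis.constr_basis] at this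
end
end HS

namespace HS
set_option linter.unusedSectionVars false
set_option linter.unusedVariables false
set_option linter.unusedSimpArgs false
section
variable {K : Type} [Field K] {V : Type} [AddCommGroup V] [Module K V] {I : Type} [Fintype I] [DecidableEq I] [Nonempty I]
variable (b : Module.Basis I K V) (R : V ⊗[K] V →ₗ[K] V ⊗[K] V)

def xg (a : I) : RingQuot (lambdaRel K V R) := RingQuot.mkAlgHom K (lambdaRel K V R) (TensorAlgebra.ι K (b a))

def mon {A : Type} [Ring A] (x : I → A) {l : ℕ} (s : Fin l → I) : A := (List.ofFn fun i => x (s i)).prod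

lemma mon_cat {A : Type} [Ring A] (x : I → A) {a c N : ℕ} (h : N = a + c) (u : Fin a → I) (w : Fin c → I) : mon x (cat h u w) = mon x u * mon x w := by
  subst h
  have : (fun i => x (cat rfl u w i)) = Fin.append (fun i => x (u i)) (fun i => x (w i)) := by
    funext i
    refine Fin.addCases (fun i => ?_) (fun i => ?_) i
    · simp [cat, app]
    · simp [cat, app]
  rw [mon, this, List.ofFn_fin_append, List.prod_append]; rfl

lemma lambdaGrade_eq (l : ℕ) : lambdaGrade K V R l = LinearMap.range (Fintype.linearCombination K (mon (xg b R) (l := l))) := by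
  have h1 : LinearMap.range (TensorAlgebra.ι K : V →ₗ[K] TensorAlgebra K V) = Submodule.span K (Set.range fun a => TensorAlgebra.ι K (b a)) := by
    rw [LinearMap.range_eq_map, ← b.span_eq, Submodule.map_span, ← Set.range_comp]; rfl
  rw [lambdaGrade, h1, Submodule.span_pow, Submodule.map_span, Fintype.range_linearCombination]
  congr 1
  ext z
  constructor
  · rintro ⟨w, hw, rfl⟩
    obtain ⟨f, rfl⟩ := Set.mem_pow.1 hw
    choose g hg using fun i => (f i).2
    refine ⟨g, ?_⟩
    simp only [AlgHom.toLinearMap_apply, map_list_prod, List.map_ofFn, mon]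
    congr 2
    funext i
    simp [xg, ← hg]
  · rintro ⟨s, rfl⟩
    refine ⟨_, Set.mem_pow.2 ⟨fun i => ⟨_, ⟨s i, rfl⟩⟩, rfl⟩, ?_⟩
    simp only [AlgHom.toLinearMap_apply, map_list_prod, List.map_ofFn, mon]
    rfl

variable {q : K} (hq0 : q ≠ 0) {R} (hR : IsHeckeSymmetry K V q R)

lemma xg_rel (t : Fin 2 → I) : ∑ i, ∑ j, Rm b R i j (t 0) (t 1) • (xg b R i * xg b R j) = - (xg b R (t 0) * xg b R (t 1)) := by
  have h0 : RingQuot.mkAlgHom K (lambdaRel K V R) (mulTwo K V ((R + (LinearMap.id : V ⊗[K] V →ₗ[K] V ⊗[K] V)) (b (t 0) ⊗ₜ b (t 1)))) = 0 := by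
    rw [← map_zero (RingQuot.mkAlgHom K (lambdaRel K V R))]
    exact RingQuot.mkAlgHom_rel K ⟨rfl, _, rfl⟩
  have hm : ∀ a c, RingQuot.mkAlgHom K (lambdaRel K V R) (mulTwo K V (b a ⊗ₜ b c)) = xg b R a * xg b R c := by
    intro a c; simp [mulTwo, xg]
  rw [LinearMap.add_apply, R_sum, LinearMap.id_apply] at h0
  simp only [map_add, map_sum, map_smul, hm] at h0
  exact eq_neg_of_add_eq_zero_left h0

section
variable {A : Type} [Ring A] [Algebra K A] (x : I → A)
  (hx : ∀ t : Fin 2 → I, ∑ i, ∑ j, Rm b R i j (t 0) (t 1) • (x i * x j) = - (x (t 0) * x (t 1)))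

lemma mon_two (hx : ∀ t : Fin 2 → I, ∑ i, ∑ j, Rm b R i j (t 0) (t 1) • (x i * x j) = - (x (t 0) * x (t 1))) (t : Fin 2 → I) :
    ∑ s, (vDat b hq0 hR).M 2 (S q⁻¹ 0) s t • mon x s = - mon x t := by
  have hm2 : ∀ s : Fin 2 → I, mon x s = x (s 0) * x (s 1) := by
    intro s; simp [mon]
  rw [sum_two]
  simp only [hm2, Dat.M_S0, Matrix.cons_val_zero, Matrix.cons_val_one]
  show ∑ a, ∑ c, (q⁻¹ * (Rm b R a c (t 0) (t 1) - (q - 1) * if a = t 0 ∧ c = t 1 then 1 else 0)) • (x a * x c) = _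
  simp only [mul_smul, sub_smul, Finset.sum_sub_distrib, ← Finset.smul_sum]
  rw [hx]
  have : ∑ a, ∑ c, (if a = t 0 ∧ c = t 1 then (1:K) else 0) • (x a * x c) = x (t 0) * x (t 1) := by
    simp [ite_and, ite_smul]
  rw [this, ← sub_smul, smul_sub]
  have e1 : q⁻¹ * q = 1 := inv_mul_cancel₀ hq0
  set z := x (t 0) * x (t 1)
  rw [smul_smul, mul_sub, e1]
  module

lemma mon_S (hx : ∀ t : Fin 2 → I, ∑ i, ∑ j, Rm b R i j (t 0) (t 1) • (x i * x j) = - (x (t 0) * x (t 1))) {l i : ℕ} (hi : i + 1 < l) (t : Fin l → I) : ∑ s, (vDat b hq0 hR).M l (S q⁻¹ i) s t • mon x s = - mon x t := by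
  obtain ⟨c, hc⟩ := Nat.exists_eq_add_of_lt hi
  have h1 : l = i + (2 + c) := by omega
  obtain ⟨u, v, rfl⟩ := exists_cat h1 t
  obtain ⟨v, w, rfl⟩ := exists_cat (rfl : 2 + c = 2 + c) v
  have e : S q⁻¹ i = sh i (S q⁻¹ 0) := by rw [sh_S, zero_add]
  rw [sum_cat h1]
  simp only [sum_cat (rfl : 2 + c = 2 + c)]
  rw [e]
  simp only [(vDat b hq0 hR).M_catr h1 (S_mem (p := q⁻¹) (show 0 + 1 < 2 + c by omega)), (vDat b hq0 hR).M_catl rfl (S_mem (p := q⁻¹) (show 0 + 1 < 2 by omega)), mon_cat]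
  simp only [ite_mul, one_mul, zero_mul, ite_smul, zero_smul, mul_ite, mul_one, mul_zero, Finset.sum_ite_eq', Finset.sum_ite_eq, Finset.mem_univ, if_true, Finset.sum_ite_irrel, Finset.sum_const_zero]
  have := mon_two b hq0 hR x hx v
  have e3 : ∀ y : Fin 2 → I, (vDat b hq0 hR).M 2 (S q⁻¹ 0) y v • (mon x u * (mon x y * mon x w)) =
      mon x u * (((vDat b hq0 hR).M 2 (S q⁻¹ 0) y v • mon x y) * mon x w) := fun y => by
    rw [smul_mul_assoc, mul_smul_comm]
  simp only [e3]
  rw [← Finset.mul_sum, ← Finset.sum_mul, this]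
  simp

lemma mon_h (hx : ∀ t : Fin 2 → I, ∑ i, ∑ j, Rm b R i j (t 0) (t 1) • (x i * x j) = - (x (t 0) * x (t 1))) {l : ℕ} {h : Hec q⁻¹} (hh : h ∈ Hn q⁻¹ l) : ∀ (t : Fin l → I), ∑ s, (vDat b hq0 hR).M l h s t • mon x s = eps q⁻¹ h • mon x t := by
  induction hh using Algebra.adjoin_induction with
  | mem y hy =>
    obtain ⟨i, hi, rfl⟩ := hy
    intro t; rw [mon_S b hq0 hR x hx hi, eps_S, neg_smul, one_smul]
  | algebraMap r => 
    intro t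
    rw [Algebra.algebraMap_eq_smul_one, map_smul, map_smul, Dat.M_one]
    simp [Matrix.one_apply, ite_smul]
  | add y z hy hz h1 h2 => intro t; simp only [map_add, Matrix.add_apply, add_smul, Finset.sum_add_distrib, h1, h2]
  | mul y z hy hz h1 h2 => 
    intro t
    rw [Dat.M_mul _ hy hz]
    simp only [Matrix.mul_apply, Finset.sum_smul, mul_comm ((vDat b hq0 hR).M l y _ _), mul_smul]
    rw [Finset.sum_comm]
    simp only [← Finset.smul_sum, h1]
    simp only [smul_comm _ (eps q⁻¹ y), ← Finset.smul_sum, h2, map_mul, mul_smul]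

end
end
end HS

namespace HS
set_option linter.unusedSectionVars false
set_option linter.unusedVariables false
set_option linter.unusedSimpArgs false
section
variable {K : Type} [Field K] {V : Type} [AddCommGroup V] [Module K V] {I : Type} [Fintype I] [DecidableEq I] [Nonempty I]
variable (b : Module.Basis I K V)

def prep : V →ₗ[K] Fn K I →ₗ[K] Fn K I :=
  LinearMap.mk₂ K (fun v f s => b.repr v (s 0) * f (fun n => s (n+1)))
    (fun v w f => by funext s; simp [add_mul]) (fun c v f => by funext s; simp [mul_assoc])
    (fun v f g => by funext s; simp [mul_add]) (fun c v f => by funext s; simp [mul_left_comm])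

lemma prep_apply (v : V) (f : Fn K I) (s : ℕ → I) : prep b v f s = b.repr v (s 0) * f (fun n => s (n+1)) := rfl

lemma Sh_prep (A : Module.End K (Fn K I)) (v : V) (f : Fn K I) : Sh 1 A (prep b v f) = prep b v (A f) := by
  funext s
  rw [Sh_apply, prep_apply]
  have : (fun s' => prep b v f (spl 1 s s')) = b.repr v (s 0) • f := by
    funext s'; simp [prep_apply, spl]
  rw [this, map_smul]; rfl

variable {q : K} (hq0 : q ≠ 0) {R : V ⊗[K] V →ₗ[K] V ⊗[K] V} (hR : IsHeckeSymmetry K V q R)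

def Lop (B : ℕ → Module.End K (Fn K I)) : V →ₗ[K] Module.End K (ℕ → Fn K I) :=
  LinearMap.mk₂ K (fun v x l => match l with
    | 0 => 0
    | l+1 => B (l+1) (prep b v (x l)))
    (fun v w f => by funext l; cases l <;> simp) (fun c v f => by funext l; cases l <;> simp)
    (fun v f g => by funext l; cases l <;> simp) (fun c v f => by funext l; cases l <;> simp)

lemma Lop_zero (B : ℕ → Module.End K (Fn K I)) (v : V) (x) : Lop b B v x 0 = 0 := rfl
lemma Lop_succ (B : ℕ → Module.End K (Fn K I)) (v : V) (x) (l : ℕ) : Lop b B v x (l+1) = B (l+1) (prep b v (x l)) := rfl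

lemma eps_sh {p : K} (a : ℕ) (h : Hec p) : eps p (sh a h) = eps p h := by
  have : (eps p).comp (sh a) = eps p := hec_ext fun i => by simp [sh_S]
  exact DFunLike.congr_fun this h

lemma An_sh {p : K} (hp : p ≠ 0) (hq : ∀ n, qn p (n+1) ≠ 0) (l : ℕ) : An p (l+1) * sh 1 (An p l) = An p (l+1) := by
  obtain ⟨-, -, hr, -⟩ := An_props' hp hq (l+1)
  obtain ⟨hm, he, -, -⟩ := An_props' hp hq l
  rw [absorb_right hr (sh_mem hm (le_refl _)), eps_sh, he, one_smul]

def BA : ℕ → Module.End K (Fn K I) := fun l => (vDat b hq0 hR).ρ (An q⁻¹ l)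

variable (hq : ∀ n, qn q⁻¹ (n+1) ≠ 0)

lemma BA_prep (hq : ∀ n, qn q⁻¹ (n+1) ≠ 0) (l : ℕ) (v : V) (f : Fn K I) : BA b hq0 hR (l+1) (prep b v (BA b hq0 hR l f)) = BA b hq0 hR (l+1) (prep b v f) := by
  rw [← Sh_prep]
  simp only [BA]
  rw [← Dat.ρ_sh]
  show ((vDat b hq0 hR).ρ _ * (vDat b hq0 hR).ρ _) _ = _
  rw [← map_mul, An_sh (inv_ne_zero hq0) hq]

lemma BA_R (hq : ∀ n, qn q⁻¹ (n+1) ≠ 0) (l : ℕ) (f : Fn K I) : BA b hq0 hR (l+2) (op0 (Rm b R) f) = - BA b hq0 hR (l+2) f := by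
  obtain ⟨-, -, hr, -⟩ := An_props' (inv_ne_zero hq0) hq (l+2)
  have h1 := congrArg (vDat b hq0 hR).ρ (hr 0 (by omega))
  have hs0 : ∀ A : Module.End K (Fn K I), Sh 0 A = A := fun A => by
    ext f s; rw [Sh_apply]; congr 2
  rw [map_mul, map_neg, Dat.ρ_S, hs0] at h1
  have h2 : op0 (vDat b hq0 hR).X = q⁻¹ • (op0 (Rm b R) - (q-1) • 1) := op0_inv fun _ _ _ _ => rfl
  have h3 := LinearMap.congr_fun h1 f
  rw [h2] at h3
  have h4 : op0 (Rm b R) f = q • ((q⁻¹ • (op0 (Rm b R) - (q-1) • 1) : Module.End K (Fn K I)) f) + (q - 1) • f := by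
    rw [LinearMap.smul_apply, smul_smul, mul_inv_cancel₀ hq0, one_smul]; simp
  rw [h4, map_add, map_smul, map_smul, show BA b hq0 hR (l+2) ((q⁻¹ • (op0 (Rm b R) - (q-1) • 1) : Module.End K (Fn K I)) f) = - BA b hq0 hR (l+2) f from h3]
  module

lemma prep2_R (u : V ⊗[K] V) (f : Fn K I) : op0 (Rm b R) (fun s => Psi2 b u s * f (fun n => s (n+2))) = fun s => Psi2 b (R u) s * f (fun n => s (n+2)) := by
  rw [← Psi2_R]
  funext s
  simp only [op0, LinearMap.coe_mk, AddHom.coe_mk, Finset.sum_mul]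
  refine Finset.sum_congr rfl fun c _ => Finset.sum_congr rfl fun d _ => ?_
  rw [mul_assoc]
  congr 3

lemma Lop_two (hq : ∀ n, qn q⁻¹ (n+1) ≠ 0) (u : V ⊗[K] V) (x : ℕ → Fn K I) : 
    TensorAlgebra.lift K (Lop b (BA b hq0 hR)) (mulTwo K V u) x 0 = 0 ∧ TensorAlgebra.lift K (Lop b (BA b hq0 hR)) (mulTwo K V u) x 1 = 0 ∧
    ∀ l, TensorAlgebra.lift K (Lop b (BA b hq0 hR)) (mulTwo K V u) x (l+2) = BA b hq0 hR (l+2) (fun s => Psi2 b u s * x l (fun n => s (n+2))) := by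
  induction u using TensorProduct.induction_on with
  | zero => 
    simp
    intro l
    exact (map_zero _).symm
  | tmul v w =>
    have e : TensorAlgebra.lift K (Lop b (BA b hq0 hR)) (mulTwo K V (v ⊗ₜ w)) = Lop b (BA b hq0 hR) v * Lop b (BA b hq0 hR) w := by
      simp [mulTwo]
    rw [e]
    simp only [Module.End.mul_apply]
    refine ⟨rfl, ?_, fun l => ?_⟩
    · rw [Lop_succ, Lop_zero]; simp
    · rw [Lop_succ, Lop_succ, BA_prep b hq0 hR hq]
      congr 1
      funext s
      simp [prep_apply, Psi2, Module.Basis.tensorProduct_repr_tmul_apply, mul_left_comm, mul_assoc]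
  | add u v hu hv =>
    refine ⟨?_, ?_, fun l => ?_⟩
    · simp only [map_add, LinearMap.add_apply, Pi.add_apply, hu.1, hv.1, add_zero]
    · simp only [map_add, LinearMap.add_apply, Pi.add_apply, hu.2.1, hv.2.1, add_zero]
    · simp only [map_add, LinearMap.add_apply, Pi.add_apply, hu.2.2, hv.2.2, add_mul]
      rw [← map_add]; rfl

def Mod (hq : ∀ n, qn q⁻¹ (n+1) ≠ 0) : RingQuot (lambdaRel K V R) →ₐ[K] Module.End K (ℕ → Fn K I) :=
  RingQuot.liftAlgHom K ⟨TensorAlgebra.lift K (Lop b (BA b hq0 hR)), by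
    rintro _ _ ⟨rfl, u, rfl⟩
    rw [map_zero]
    refine LinearMap.ext fun x => ?_
    funext l
    obtain ⟨h0, h1, h2⟩ := Lop_two b hq0 hR hq ((R + (LinearMap.id : V ⊗[K] V →ₗ[K] V ⊗[K] V)) u) x
    match l with
    | 0 => exact h0
    | 1 => exact h1
    | l+2 => 
      rw [h2]
      have : (fun s => Psi2 b ((R + (LinearMap.id : V ⊗[K] V →ₗ[K] V ⊗[K] V)) u) s * x l (fun n => s (n+2))) =
        op0 (Rm b R) (fun s => Psi2 b u s * x l (fun n => s (n+2))) + (fun s => Psi2 b u s * x l (fun n => s (n+2))) := by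
        rw [prep2_R]
        funext s; simp [add_mul]
      rw [this, map_add, BA_R b hq0 hR hq]
      simp⟩

lemma Mod_xg (hq : ∀ n, qn q⁻¹ (n+1) ≠ 0) (a : I) : Mod b hq0 hR hq (xg b R a) = Lop b (BA b hq0 hR) (b a) := by
  rw [Mod, xg, RingQuot.liftAlgHom_mkAlgHom_apply, TensorAlgebra.lift_ι_apply]

lemma cyl_prep {l : ℕ} (s : Fin (l+1) → I) : prep b (b (s 0)) (cyl fun i => s i.succ) = cyl s := by
  funext u
  simp [prep_apply, cyl, Fin.forall_fin_succ, Finsupp.single_apply, ite_and, eq_comm (a := u 0)]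
  split_ifs <;> rfl

lemma Mod_mon (hq : ∀ n, qn q⁻¹ (n+1) ≠ 0) : ∀ {l : ℕ} (s : Fin l → I),
    Mod b hq0 hR hq (mon (xg b R) s) (fun l => if l = 0 then 1 else 0) l = BA b hq0 hR l (cyl s) := by
  intro l
  induction l with
  | zero => 
    intro s
    have : An q⁻¹ 0 = 1 := rfl
    simp [mon, BA, this]
    funext u; simp [cyl]
  | succ l ih =>
    intro s
    have : mon (xg b R) s = xg b R (s 0) * mon (xg b R) (fun i => s i.succ) := by
      rw [mon, List.ofFn_succ, List.prod_cons]; rfl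
    rw [this, map_mul, Mod_xg, Module.End.mul_apply, Lop_succ, ih, BA_prep b hq0 hR hq, cyl_prep]

lemma dim_eq (hq : ∀ n, qn q⁻¹ (n+1) ≠ 0) (l : ℕ) : (Module.finrank K (lambdaGrade K V R l) : K) = (vDat b hq0 hR).χ l (An q⁻¹ l) := by
  obtain ⟨hm, he, hr, hl⟩ := An_props' (inv_ne_zero hq0) hq l
  set E := (vDat b hq0 hR).M l (An q⁻¹ l) with hE
  have hE2 : E * E = E := by
    rw [hE, ← Dat.M_mul _ hm hm, absorb_right hr hm, he, one_smul]
  have hker : LinearMap.ker (Fintype.linearCombination K (mon (xg b R) (l := l))) = LinearMap.ker (Matrix.toLin' E) := by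
    ext f
    rw [LinearMap.mem_ker, LinearMap.mem_ker, Matrix.toLin'_apply, Fintype.linearCombination_apply]
    constructor
    · intro h
      have h2 := congrArg (fun z => Mod b hq0 hR hq z (fun l => if l = 0 then 1 else 0) l) h
      simp only [map_sum, map_smul, LinearMap.sum_apply, LinearMap.smul_apply, Finset.sum_apply, Pi.smul_apply, Mod_mon b hq0 hR hq, map_zero, LinearMap.zero_apply, Pi.zero_apply] at h2
      funext u
      have h3 := congrFun h2 (app u (dflt I))
      rw [Finset.sum_apply] at h3
      rw [Matrix.mulVec, dotProduct]
      refine Eq.trans (Finset.sum_congr rfl fun t _ => ?_) h3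
      exact mul_comm _ _
    · intro h
      have h1 : ∀ t, mon (xg b R) t = ∑ s, E s t • mon (xg b R) s := fun t => by
        rw [mon_h b hq0 hR (xg b R) (xg_rel b) hm, he, one_smul]
      have : ∑ t, f t • mon (xg b R) t = ∑ s, (E.mulVec f) s • mon (xg b R) s := by
        simp only [Matrix.mulVec, dotProduct, Finset.sum_smul]
        rw [Finset.sum_comm]
        refine Finset.sum_congr rfl fun t _ => ?_
        rw [h1 t, Finset.smul_sum]
        refine Finset.sum_congr rfl fun s _ => ?_
        rw [smul_smul, mul_comm]
      rw [this, h]; simp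
  have h1 : IsIdempotentElem (Matrix.toLin' E) := by
    rw [IsIdempotentElem, Module.End.mul_eq_comp, ← Matrix.toLin'_mul, hE2]
  have h2 := LinearMap.finrank_range_add_finrank_ker (Fintype.linearCombination K (mon (xg b R) (l := l)))
  have h3 := LinearMap.finrank_range_add_finrank_ker (Matrix.toLin' E)
  rw [hker] at h2
  rw [lambdaGrade_eq b R l, show Module.finrank K (LinearMap.range (Fintype.linearCombination K (mon (xg b R) (l := l)))) = Module.finrank K (LinearMap.range (Matrix.toLin' E)) by omega,
    ← (LinearMap.IsIdempotentElem.isProj_range _ h1).trace, Matrix.trace_toLin'_eq, Dat.χ_def]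
  refine Finset.sum_congr rfl fun s _ => ?_
  simp [Dat.wt, vDat, hE]
end
end HS

namespace HS
set_option linter.unusedSectionVars false
set_option linter.unusedVariables false
set_option linter.unusedSimpArgs false

lemma exists_common (K : Type) [Field K] [CharZero K] : ∃ (L : Type) (_ : Field L), Nonempty (K →+* L) ∧ Nonempty (ℝ →+* L) := by
  obtain ⟨M, hM⟩ := Ideal.exists_maximal (TensorProduct ℚ K ℝ)
  refine ⟨_ ⧸ M, Ideal.Quotient.field M, ⟨(Ideal.Quotient.mk M).comp (Algebra.TensorProduct.includeLeftRingHom)⟩, 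
    ⟨(Ideal.Quotient.mk M).comp (Algebra.TensorProduct.includeRight (R := ℚ) (A := K) (B := ℝ)).toRingHom⟩⟩

section
variable {L : Type} [Field L]

lemma ratio_const {p : L} (hp1 : ∀ n : ℕ, p ^ (n+1) ≠ 1) (f h : PowerSeries L) (hf : PowerSeries.constantCoeff f = 1) 
    (hh : PowerSeries.constantCoeff h = 1)
    (e : f * PowerSeries.rescale p h = h * PowerSeries.rescale p f) : f = h := by
  have h0 : h ≠ 0 := by rintro rfl; simp at hh
  have hr0 : PowerSeries.constantCoeff (PowerSeries.rescale p h) = 1 := by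
    rw [← PowerSeries.coeff_zero_eq_constantCoeff_apply, PowerSeries.coeff_rescale]; simp [hh]
  have hr : PowerSeries.rescale p h ≠ 0 := by intro h1; rw [h1] at hr0; simp at hr0
  obtain ⟨u, hu⟩ : ∃ u, f = u * h := ⟨f * h⁻¹, by rw [mul_assoc, PowerSeries.inv_mul_cancel _ (by simp [hh]), mul_one]⟩
  rw [hu, map_mul] at e
  have e2 : u = PowerSeries.rescale p u := by
    apply mul_right_cancel₀ (mul_ne_zero h0 hr)
    rw [← mul_assoc, e]; ring
  have e3 : u = 1 := by
    ext n
    cases n with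
    | zero => 
      have := congrArg PowerSeries.constantCoeff hu
      rw [map_mul, hf, hh, mul_one] at this
      simp [← this]
    | succ n =>
      have := congrArg (PowerSeries.coeff (n+1)) e2
      rw [PowerSeries.coeff_rescale] at this
      have h5 : (p^(n+1) - 1) * PowerSeries.coeff (n+1) u = 0 := by rw [sub_mul, ← this]; ring
      rcases mul_eq_zero.1 h5 with h6 | h6
      · exact absurd (sub_eq_zero.1 h6) (hp1 n)
      · rw [h6]; simp [PowerSeries.coeff_one]
  rw [hu, e3, one_mul]
end

section
open Polynomial
lemma lc_lin (c : ℝ) (hc : c ≠ 0) : (1 + C c * X : ℝ[X]).leadingCoeff = c := by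
  rw [add_comm, ← C_1, leadingCoeff_linear hc]

lemma prods_one {m n : ℕ} (x : Fin m → ℝ) (y : Fin n → ℝ) (hx : ∀ i, 0 < x i) (hy : ∀ j, 0 < y j)
    (h : (∏ i, (1 + C (-(x i)) * X) : ℝ[X]) * ∏ j, (1 + C ((y j)⁻¹) * X) = (∏ i, (1 + C (-(x i)⁻¹) * X)) * ∏ j, (1 + C (y j) * X)) :
    (∏ i, x i) = 1 ∧ (∏ j, y j) = 1 := by
  have cop : ∀ (x : Fin m → ℝ) (y : Fin n → ℝ) (hx : ∀ i, 0 < x i) (hy : ∀ j, 0 < y j), 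
      IsCoprime (∏ i, (1 + C (-(x i)) * X) : ℝ[X]) (∏ j, (1 + C (y j) * X)) := by
    intro x y hx hy
    refine IsCoprime.prod_left fun i _ => IsCoprime.prod_right fun j _ => ?_
    have h0 : x i + y j ≠ 0 := by have := hx i; have := hy j; positivity
    refine ⟨C ((x i + y j)⁻¹ * y j), C ((x i + y j)⁻¹ * x i), ?_⟩
    have e1 : (C ((x i + y j)⁻¹ * y j) * (1 + C (-(x i)) * X) + C ((x i + y j)⁻¹ * x i) * (1 + C (y j) * X) : ℝ[X]) = C ((x i + y j)⁻¹ * (x i + y j)) := by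
      simp only [map_mul, map_add, map_neg]; ring
    rw [e1, inv_mul_cancel₀ h0, C_1]
  set A := (∏ i, (1 + C (-(x i)) * X) : ℝ[X]) with hA
  set A' := (∏ i, (1 + C (-(x i)⁻¹) * X) : ℝ[X]) with hA'
  set B := (∏ j, (1 + C (y j) * X) : ℝ[X]) with hB
  set B' := (∏ j, (1 + C ((y j)⁻¹) * X) : ℝ[X]) with hB'
  have lA : A.leadingCoeff = (-1)^m * ∏ i, x i := by
    rw [hA, leadingCoeff_prod]
    simp only [fun i => lc_lin (-(x i)) (neg_ne_zero.2 (hx i).ne')]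
    rw [Finset.prod_neg]; simp
  have lA' : A'.leadingCoeff = (-1)^m * (∏ i, x i)⁻¹ := by
    rw [hA', leadingCoeff_prod]
    simp only [fun i => lc_lin (-(x i)⁻¹) (neg_ne_zero.2 (inv_pos.2 (hx i)).ne')]
    rw [Finset.prod_neg]; simp
  have lB : B.leadingCoeff = ∏ j, y j := by
    rw [hB, leadingCoeff_prod]
    simp only [fun i => lc_lin (y i) (hy i).ne']
  have lB' : B'.leadingCoeff = (∏ j, y j)⁻¹ := by
    rw [hB', leadingCoeff_prod]
    simp only [fun i => lc_lin ((y i)⁻¹) (inv_pos.2 (hy i)).ne']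
    simp
  have pX : 0 < ∏ i, x i := Finset.prod_pos fun i _ => hx i
  have pY : 0 < ∏ j, y j := Finset.prod_pos fun i _ => hy i
  have d1 : A ∣ A' := (cop x y hx hy).dvd_of_dvd_mul_right (Dvd.intro _ h)
  have d2 : A' ∣ A := (cop (fun i => (x i)⁻¹) (fun j => (y j)⁻¹) (fun i => inv_pos.2 (hx i)) (fun i => inv_pos.2 (hy i))).dvd_of_dvd_mul_right 
    (Dvd.intro _ h.symm)
  have cA : A.eval 0 = 1 := by simp [hA, eval_prod]
  have cA' : A'.eval 0 = 1 := by simp [hA', eval_prod]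
  have eA : A = A' := by
    obtain ⟨u, hu⟩ := associated_of_dvd_dvd d1 d2
    obtain ⟨c, hc, hcu⟩ := Polynomial.isUnit_iff.1 u.isUnit
    rw [← hcu] at hu
    have := congrArg (eval 0) hu
    rw [eval_mul, eval_C, cA, cA', one_mul] at this
    rw [← hu, this, C_1, mul_one]
  have A0 : A ≠ 0 := by intro h0; rw [h0] at cA; simp at cA
  have eB : B' = B := by
    rw [← eA] at h
    exact mul_left_cancel₀ A0 h
  have key : ∀ z : ℝ, 0 < z → z = z⁻¹ → z = 1 := by
    intro z hz h
    have : z * z = 1 := by nth_rw 2 [h]; exact mul_inv_cancel₀ hz.ne'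
    nlinarith
  constructor
  · apply key _ pX
    have := congrArg leadingCoeff eA
    rw [lA, lA'] at this
    exact mul_left_cancel₀ (pow_ne_zero _ (by norm_num)) this
  · apply key _ pY
    have := congrArg leadingCoeff eB
    rw [lB, lB'] at this
    exact this.symm
end
end HS

namespace HS
set_option linter.unusedSectionVars false
set_option linter.unusedVariables false
set_option linter.unusedSimpArgs false

section
variable {L : Type} [Field L]

def pr {m : ℕ} (c : Fin m → L) : PowerSeries L := ∏ i, (1 + PowerSeries.C (c i) * PowerSeries.X)

lemma pr_resc {m : ℕ} (a : L) (c : Fin m → L) : PowerSeries.rescale a (pr c) = pr (fun i => a * c i) := by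
  unfold pr
  rw [map_prod]
  refine Finset.prod_congr rfl fun i _ => ?_
  rw [map_add, map_mul, map_one, PowerSeries.rescale_X]
  have : PowerSeries.rescale a (PowerSeries.C (c i)) = PowerSeries.C (c i) := by
    ext n
    rw [PowerSeries.coeff_rescale, PowerSeries.coeff_C]
    split_ifs with h <;> simp [h]
  rw [this, map_mul]; ring

lemma pr_cc {m : ℕ} (c : Fin m → L) : PowerSeries.constantCoeff (pr c) = 1 := by
  simp [pr, map_prod]

lemma pr_ne {m : ℕ} (c : Fin m → L) : pr c ≠ 0 := by
  intro h; have := pr_cc c; rw [h] at this; simp at this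

lemma pr_coe {m : ℕ} (ι : ℝ →+* L) (c : Fin m → ℝ) : 
    pr (fun i => ι (c i)) = PowerSeries.map ι ((∏ i, (1 + Polynomial.C (c i) * Polynomial.X) : Polynomial ℝ) : PowerSeries ℝ) := by
  have : ((∏ i, (1 + Polynomial.C (c i) * Polynomial.X) : Polynomial ℝ) : PowerSeries ℝ) = ∏ i, (1 + PowerSeries.C (c i) * PowerSeries.X) := by
    rw [← Polynomial.coeToPowerSeries.ringHom_apply, map_prod]
    refine Finset.prod_congr rfl fun i _ => ?_
    rw [map_add, map_mul, map_one]
    simp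
  rw [this, map_prod]
  refine Finset.prod_congr rfl fun i _ => ?_
  simp

lemma pr_append {m n : ℕ} (c : Fin m → L) (d : Fin n → L) (e : Fin (m+n) → L) (h1 : ∀ i, e (Fin.castAdd n i) = c i) (h2 : ∀ j, e (Fin.natAdd m j) = d j) :
    pr e = pr c * pr d := by
  unfold pr
  rw [Fin.prod_univ_add]
  simp [h1, h2]

lemma resc_cc (a : L) (P : PowerSeries L) : PowerSeries.constantCoeff (PowerSeries.rescale a P) = PowerSeries.constantCoeff P := by
  rw [← PowerSeries.coeff_zero_eq_constantCoeff_apply, PowerSeries.coeff_rescale]; simp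

variable {I : Type} [Fintype I] [DecidableEq I] [Nonempty I]

lemma core [CharZero L] {p : L} (hp : p ≠ 0) (hp1 : ∀ n : ℕ, p ^ (n+1) ≠ 1) (hq : ∀ n, qn p (n+1) ≠ 0) (ι : ℝ →+* L) 
    (D : Dat p I) (hD : ∀ i, D.g i = 1) (hI : D.Inj) (P : PowerSeries L) (t : ℕ → L) (ht0 : t 0 = 1)
    (ht : ∀ n, t (n+1) = (p-1) * D.χ (n+1) (asc (S p) 0 n)) 
    (hP : PowerSeries.rescale (-1) P = PowerSeries.rescale (-p) P * PowerSeries.mk t)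
    {m n : ℕ} [NeZero (m+n)] (x : Fin m → ℝ) (y : Fin n → ℝ) (hx : ∀ i, 0 < x i) (hy : ∀ j, 0 < y j)
    (heq : P * pr (fun j => ι (-(y j))) = pr (fun i => ι (x i))) : (∏ i, x i) = 1 ∧ (∏ j, y j) = 1 := by
  have hpm : p - 1 ≠ 0 := by have := hp1 0; simpa [sub_eq_zero] using this
  have hι := ι.injective
  let σ : Fin (m+n) → L := Fin.append (fun _ => p) (fun _ => -1)
  let γ : Fin (m+n) → ℝ := Fin.append x y
  let g : Fin (m+n) → L := fun a => ι (γ a)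
  have hγ : ∀ a, 0 < γ a := by
    intro a
    refine Fin.addCases (fun i => ?_) (fun j => ?_) a
    · simpa [γ] using hx i
    · simpa [γ] using hy j
  have hσ : ∀ a, σ a = p ∨ σ a = -1 := by
    intro a
    refine Fin.addCases (fun i => ?_) (fun j => ?_) a
    · left; simp [σ]
    · right; simp [σ]
  have hg : ∀ a, g a ≠ 0 := fun a => by
    rw [Ne, map_eq_zero]; exact (hγ a).ne'
  set D2 := stDat p σ g hσ hg with hD2
  have hI2 : D2.Inj := st_inj hp σ g hσ hg
  have Zm : ∀ (u : Fin m → ℝ) (v : Fin n → ℝ) (gg : Fin (m+n) → L), (∀ i, gg (Fin.castAdd n i) = ι (u i)) → (∀ j, gg (Fin.natAdd m j) = ι (v j)) →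
      ZSer σ g hσ hg gg * (PowerSeries.rescale p (pr fun i => ι (-(u i))) * (pr fun j => ι (v j))) = 
      (pr fun i => ι (-(u i))) * PowerSeries.rescale p (pr fun j => ι (v j)) := by
    intro u v gg h1 h2
    have h := Z_eq σ g hσ hg gg
    have e1 : ∏ a, (1 - PowerSeries.C (σ a * gg a) * PowerSeries.X) = pr (fun a => -(σ a * gg a)) := by
      unfold pr
      refine Finset.prod_congr rfl fun a _ => ?_
      rw [map_neg]; ring
    have e2 : ∏ a, (1 + PowerSeries.C ((p - 1 - σ a) * gg a) * PowerSeries.X) = pr (fun a => (p-1-σ a) * gg a) := rfl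
    rw [e1, e2, pr_append (fun i => p * ι (-(u i))) (fun j => ι (v j)) _ ?_ ?_, 
      pr_append (fun i => ι (-(u i))) (fun j => p * ι (v j)) _ ?_ ?_] at h
    · rw [pr_resc, pr_resc]; exact h
    · intro i; simp [σ, h1]
    · intro i; simp [σ, h2]
    · intro i; simp [σ, h1]
    · intro i; simp [σ, h2]
  have Zcc : ∀ gg, PowerSeries.coeff 0 (ZSer σ g hσ hg gg) = 1 := by
    intro gg
    simp [ZSer, tSer]
  have hcP : PowerSeries.constantCoeff P = 1 := by
    have := congrArg PowerSeries.constantCoeff heq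
    rwa [map_mul, pr_cc, pr_cc, mul_one] at this
  have Zm1 := Zm x y g (fun i => by simp [g, γ]) (fun i => by simp [g, γ])
  have hZ : PowerSeries.mk t = ZSer σ g hσ hg g := by
    have r1 := congrArg (PowerSeries.rescale (-1)) heq
    have r2 := congrArg (PowerSeries.rescale (-p)) heq
    rw [map_mul, pr_resc, pr_resc] at r1 r2
    have a1 : (fun j => (-1 : L) * ι (-(y j))) = fun j => ι (y j) := by ext; simp
    have a2 : (fun j => (-1 : L) * ι ((x j))) = fun j => ι (-(x j)) := by ext; simp
    have a3 : (fun j => (-p : L) * ι (-(y j))) = fun j => p * ι (y j) := by ext; simp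
    have a4 : (fun j => (-p : L) * ι ((x j))) = fun j => p * ι (-(x j)) := by ext; simp
    rw [a1, a2] at r1
    rw [a3, a4] at r2
    rw [pr_resc, pr_resc] at Zm1
    have hne : PowerSeries.rescale (-p) P ≠ 0 := by
      intro h; have := resc_cc (-p) P; rw [h, hcP] at this; simp at this
    have n1 := pr_ne (fun j => p * ι (-(x j)))
    have n2 := pr_ne (fun j => ι (y j))
    refine mul_right_cancel₀ (mul_ne_zero n1 n2) ?_
    rw [Zm1, ← r1, ← r2, hP]; ring
  have hχ0 : ∀ r, D.χ (r+1) (asc (S p) 0 r) = D2.χ (r+1) (asc (S p) 0 r) := by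
    intro r
    have h := congrArg (PowerSeries.coeff (r+1)) hZ
    rw [PowerSeries.coeff_mk, ht, Z_coeff] at h
    rw [mul_left_cancel₀ hpm h, Dat.χ_def]
    rfl
  have hχ := chi_agree D D2 hχ0
  have hZ2 : ZSer σ g hσ hg g = ZSer σ g hσ hg (fun a => (g a)⁻¹) := by
    ext r
    cases r with
    | zero => rw [Zcc, Zcc]
    | succ r =>
      have h := main_dual hp hq ι D D2 (fun _ => 1) (fun _ => one_pos) (fun i => by rw [hD, map_one]) γ hγ (fun i => rfl) hI hI2 
        (fun N h hh => hχ N h hh) r _ (ascS_mem (by omega : 0 + r < r + 1))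
      rw [Z_coeff, Z_coeff]
      congr 1
      have w1 : ∀ s : Fin (r+1) → I, D.wt s = 1 := by intro s; simp [Dat.wt, hD]
      have h0 := hχ0 r
      rw [Dat.χ_def, Dat.χ_def] at h0
      simp only [w1, inv_one, one_mul, mul_one] at h h0
      rw [h0] at h
      have l1 : ∑ s, D2.M (r+1) (asc (S p) 0 r) s s * ∏ i, g (s i) = ∑ s, D2.M (r+1) (asc (S p) 0 r) s s * D2.wt s := rfl
      rw [← hD2, l1, h]
      refine Finset.sum_congr rfl fun s _ => ?_
      rw [mul_comm, Finset.prod_inv_distrib]; rfl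
  have Zm2 := Zm (fun i => (x i)⁻¹) (fun j => (y j)⁻¹) (fun a => (g a)⁻¹) (fun i => by simp [g, γ]) (fun i => by simp [g, γ])
  rw [← hZ2] at Zm2
  generalize ZSer σ g hσ hg g = Z at Zm1 Zm2
  have hfin : (pr fun i => ι (-(x i))) * (pr fun j => ι ((y j)⁻¹)) = (pr fun i => ι (-((x i)⁻¹))) * (pr fun j => ι (y j)) := by
    have cc1 := pr_cc (fun i => ι (-(x i)))
    have cc2 := pr_cc (fun i => ι (-((x i)⁻¹)))
    have cc3 := pr_cc (fun i => ι (y i))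
    have cc4 := pr_cc (fun i => ι ((y i)⁻¹))
    generalize (pr fun i => ι (-(x i))) = a at *
    generalize (pr fun i => ι (-((x i)⁻¹))) = a' at *
    generalize (pr fun i => ι (y i)) = c at *
    generalize (pr fun i => ι ((y i)⁻¹)) = c' at *
    have hZ0 : Z ≠ 0 := by
      rintro rfl
      rw [zero_mul] at Zm1
      have := congrArg PowerSeries.constantCoeff Zm1
      rw [map_mul, resc_cc, cc1, cc3] at this
      simp at this
    refine ratio_const hp1 _ _ (by rw [map_mul, cc1, cc4, mul_one]) (by rw [map_mul, cc2, cc3, mul_one]) ?_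
    rw [map_mul, map_mul]
    refine mul_left_cancel₀ hZ0 ?_
    calc Z * (a * c' * (PowerSeries.rescale p a' * PowerSeries.rescale p c)) = (Z * (PowerSeries.rescale p a' * c')) * (a * PowerSeries.rescale p c) := by ring
      _ = (a' * PowerSeries.rescale p c') * (Z * (PowerSeries.rescale p a * c)) := by rw [Zm2, Zm1]
      _ = _ := by ring
  apply prods_one x y hx hy
  rw [pr_coe, pr_coe, pr_coe, pr_coe, ← map_mul, ← map_mul, ← Polynomial.coe_mul, ← Polynomial.coe_mul] at hfin
  exact Polynomial.coe_injective ℝ (PowerSeries.map_injective ι hι hfin)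
end

lemma no_roots {m n : ℕ} (x : Fin m → ℝ) (y : Fin n → ℝ) (hx : ∀ i, 0 < x i) (hy : ∀ j, 0 < y j)
    (h : (∏ j : Fin n, (1 - Polynomial.C (y j) * Polynomial.X) : Polynomial ℝ) = ∏ i : Fin m, (1 + Polynomial.C (x i) * Polynomial.X)) :
    (∏ i, x i) = 1 ∧ (∏ j, y j) = 1 := by
  have hm : IsEmpty (Fin m) := by
    refine ⟨fun i => ?_⟩
    have := congrArg (Polynomial.eval (-(x i)⁻¹)) h
    rw [Polynomial.eval_prod, Polynomial.eval_prod, Finset.prod_eq_zero (Finset.mem_univ i) (by have := (hx i).ne'; simp [this])] at this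
    refine absurd this (Finset.prod_ne_zero_iff.2 fun j _ => ?_)
    have : 0 < y j * (x i)⁻¹ := mul_pos (hy j) (inv_pos.2 (hx i))
    simp; linarith
  have hn : IsEmpty (Fin n) := by
    refine ⟨fun j => ?_⟩
    have := congrArg (Polynomial.eval ((y j)⁻¹)) h
    rw [Polynomial.eval_prod, Polynomial.eval_prod, Finset.prod_eq_zero (Finset.mem_univ j) (by have := (hy j).ne'; simp [this])] at this
    simp at this
  constructor <;> simp

section
variable (K : Type) [Field K] [CharZero K]
    (V : Type) [AddCommGroup V] [Module K V] [FiniteDimensional K V]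
    (q : K) (hq0 : q ≠ 0) (hq : ∀ n : ℕ, 1 < n → q ^ n ≠ 1)
    (R : V ⊗[K] V →ₗ[K] V ⊗[K] V) (hR : IsHeckeSymmetry K V q R)

lemma qpow {K : Type} [Field K] {q : K} (hq : ∀ n : ℕ, 1 < n → q ^ n ≠ 1) (n : ℕ) : q ^ (n+1) ≠ 1 := by
  intro h
  refine hq ((n+1)*2) (by omega) ?_
  rw [pow_mul, h, one_pow]

lemma qn_ne {L : Type} [Field L] {p : L} (hp0 : p ≠ 0) (hp1 : ∀ n : ℕ, p ^ (n+1) ≠ 1) (n : ℕ) : qn p (n+1) ≠ 0 := by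
  intro h
  have := geom_sum_mul (p⁻¹) (n+1)
  unfold qn at h
  rw [h, zero_mul, inv_pow] at this
  apply hp1 n
  have h2 : (p^(n+1))⁻¹ = 1 := (sub_eq_zero.1 this.symm)
  exact inv_eq_one.1 h2
end

theorem main_thm 
    (K : Type) [Field K] [CharZero K]
    (V : Type) [AddCommGroup V] [Module K V] [FiniteDimensional K V]
    (q : K) (hq0 : q ≠ 0) (hq : ∀ n : ℕ, 1 < n → q ^ n ≠ 1)
    (R : V ⊗[K] V →ₗ[K] V ⊗[K] V) (hR : IsHeckeSymmetry K V q R)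
    (m n : ℕ) (x : Fin m → ℝ) (y : Fin n → ℝ)
    (hx : ∀ i, 0 < x i) (hy : ∀ j, 0 < y j)
    (heq : poincareLambda K V R *
        ((∏ j : Fin n, (1 - Polynomial.C (y j) * Polynomial.X) : Polynomial ℝ) :
          PowerSeries ℝ) =
      ((∏ i : Fin m, (1 + Polynomial.C (x i) * Polynomial.X) : Polynomial ℝ) :
        PowerSeries ℝ)) :
    (∏ i : Fin m, x i) = 1 ∧ (∏ j : Fin n, y j) = 1 := by
  have hcc : PowerSeries.constantCoeff (poincareLambda K V R) = 1 := by
    have := congrArg PowerSeries.constantCoeff heq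
    rw [map_mul, Polynomial.constantCoeff_coe, Polynomial.constantCoeff_coe, ← Polynomial.constantCoeff_apply, ← Polynomial.constantCoeff_apply, map_prod, map_prod] at this
    simpa using this
  rcases subsingleton_or_nontrivial V with hV | hV
  · apply no_roots x y hx hy
    have h1 : poincareLambda K V R = 1 := by
      ext l
      cases l with
      | zero => rw [PowerSeries.coeff_zero_eq_constantCoeff_apply, hcc]; simp
      | succ l =>
        have : LinearMap.range (TensorAlgebra.ι K : V →ₗ[K] TensorAlgebra K V) = ⊥ := by
          rw [LinearMap.range_eq_bot]; exact Subsingleton.elim _ _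
        have : lambdaGrade K V R (l+1) = ⊥ := by
          rw [lambdaGrade, this, pow_succ, Submodule.mul_bot, Submodule.map_bot]
        have h0 : Module.finrank K (lambdaGrade K V R (l+1)) = 0 := by
          rw [this]; exact finrank_bot K _
        simp [poincareLambda, h0, PowerSeries.coeff_one]
    rw [h1, one_mul] at heq
    exact Polynomial.coe_injective ℝ heq
  · by_cases hmn : m + n = 0
    · obtain rfl : m = 0 := by omega
      obtain rfl : n = 0 := by omega
      simp
    haveI : NeZero (m+n) := ⟨hmn⟩
    let b := Module.finBasis K V
    haveI : Nonempty (Fin (Module.finrank K V)) := ⟨⟨0, Module.finrank_pos⟩⟩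
    obtain ⟨L, _, ⟨φ⟩, ⟨ι⟩⟩ := exists_common K
    haveI : CharZero L := charZero_of_injective_ringHom ι.injective
    have hp0 : q⁻¹ ≠ 0 := inv_ne_zero hq0
    have hp1 : ∀ n : ℕ, q⁻¹ ^ (n+1) ≠ 1 := by
      intro n h
      rw [inv_pow, inv_eq_one] at h
      exact qpow hq n h
    have hp0' : φ q⁻¹ ≠ 0 := by rwa [Ne, map_eq_zero]
    have hp1' : ∀ n : ℕ, (φ q⁻¹) ^ (n+1) ≠ 1 := by
      intro n h
      rw [← map_pow, ← φ.map_one] at h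
      exact hp1 n (φ.injective h)
    have hqn := qn_ne hp0 hp1
    let D := vDat b hq0 hR
    let t : ℕ → K := fun n => if n = 0 then 1 else (q⁻¹ - 1) * D.χ (n-1+1) (asc (S q⁻¹) 0 (n-1))
    have hN := newton hp0 hqn D (fun l => (Module.finrank K (lambdaGrade K V R l) : K)) t (fun l => dim_eq b hq0 hR hqn l) (by simp [t]) 
      (fun n => by simp [t])
    refine core hp0' hp1' (qn_ne hp0' hp1') ι (D.map φ) (fun i => ?_) ((vDat_inj b hq0 hR).map φ) (PowerSeries.map ι (poincareLambda K V R)) (fun n => φ (t n)) (by simp [t]) 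
      (fun n => ?_) ?_ x y hx hy ?_
    · change φ 1 = 1
      exact map_one φ
    · rw [Dat.map_χ]; simp [t]
    · have h := congrArg (PowerSeries.map φ) hN
      rw [map_mul] at h
      convert h using 1
      · ext l
        simp [poincareLambda, PowerSeries.coeff_rescale]
      · congr 1
        ext l
        simp [poincareLambda, PowerSeries.coeff_rescale]
    · have h := congrArg (PowerSeries.map ι) heq
      rw [map_mul] at h
      have e : (∏ j : Fin n, (1 - Polynomial.C (y j) * Polynomial.X) : Polynomial ℝ) = ∏ j : Fin n, (1 + Polynomial.C (-(y j)) * Polynomial.X) := by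
        refine Finset.prod_congr rfl fun j _ => ?_
        rw [map_neg]; ring
      rw [pr_coe, pr_coe, ← e]
      exact h
end HS

/-- If `P_Λ(t) · ∏ (1 - yⱼ t) = ∏ (1 + xᵢ t)` with `xᵢ, yⱼ > 0`, then
`∏ xᵢ = 1` and `∏ yⱼ = 1`. -/
theorem poincare_series_lambda_prod_roots_eq_one
    (K : Type) [Field K] [CharZero K]
    (V : Type) [AddCommGroup V] [Module K V] [FiniteDimensional K V]
    (q : K) (hq0 : q ≠ 0) (hq : ∀ n : ℕ, 1 < n → q ^ n ≠ 1)
    (R : V ⊗[K] V →ₗ[K] V ⊗[K] V) (hR : IsHeckeSymmetry K V q R)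
    (m n : ℕ) (x : Fin m → ℝ) (y : Fin n → ℝ)
    (hx : ∀ i, 0 < x i) (hy : ∀ j, 0 < y j)
    (heq : poincareLambda K V R *
        ((∏ j : Fin n, (1 - Polynomial.C (y j) * Polynomial.X) : Polynomial ℝ) :
          PowerSeries ℝ) =
      ((∏ i : Fin m, (1 + Polynomial.C (x i) * Polynomial.X) : Polynomial ℝ) :
        PowerSeries ℝ)) :
    (∏ i : Fin m, x i) = 1 ∧ (∏ j : Fin n, y j) = 1 := by
  exact HS.main_thm K V q hq0 hq R hR m n x y hx hy heq

end
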